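/- Let n ≥ 21 and let s be an integer with 2 ≤ s ≤ 2^(n−1). Set N₁ = (∑_{k=3}^n C(n,k)) + (n−1) and N₂ = (∑_{k=3}^n C(n,k)) + C(n−1,2), so N₁ < N₂. If 𝓐₁ is a family of subsets of [n] of size N₁ maximising |𝕀^(s)| over families of size N₁, and 𝓐₂ is a family of size N₂ maximising |𝕀^(s)| over families of size N₂, then there is no permutation σ of [n] with {σ(A) : A ∈ 𝓐₁} ⊆ 𝓐₂; in particular 𝓐₁ is not contained in 𝓐₂. -/

import Mathlib

open Finset

/-- The ground set `[n] = {1, …, n}`. -/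
def groundSet (n : ℕ) : Finset ℕ := Finset.Icc 1 n

/-- All subsets of `[n]`. -/
def allFams (n : ℕ) : Finset (Finset ℕ) := (groundSet n).powerset

/-- `[n]^(≥ r)`: subsets of `[n]` of size at least `r`. -/
def layerGE (n r : ℕ) : Finset (Finset ℕ) := (allFams n).filter fun A => r ≤ A.card

/-- `[n]^(r)`: subsets of `[n]` of size exactly `r`. -/
def layerEQ (n r : ℕ) : Finset (Finset ℕ) := (groundSet n).powersetCard r

/-- `𝕀^(s)(𝓐)`: the intersecting subfamilies of `𝓐` of size `s`. -/
def interFams (s : ℕ) (𝓐 : Finset (Finset ℕ)) : Finset (Finset (Finset ℕ)) :=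
  (𝓐.powersetCard s).filter fun 𝓔 => ∀ B ∈ 𝓔, ∀ B' ∈ 𝓔, (B ∩ B').Nonempty

section Compression
variable {α : Type*} [DecidableEq α]

/-- Every two members of the family meet. -/
def Meets (F : Finset (Finset α)) : Prop := ∀ B ∈ F, ∀ B' ∈ F, (B ∩ B').Nonempty

instance (F : Finset (Finset α)) : Decidable (Meets F) := by unfold Meets; infer_instance

/-- The intersecting subfamilies of size `s`. -/
def meetFams (s : ℕ) (A : Finset (Finset α)) : Finset (Finset (Finset α)) :=
  (A.powersetCard s).filter Meets

theorem mem_meetFams {s : ℕ} {A F : Finset (Finset α)} :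
    F ∈ meetFams s A ↔ F ⊆ A ∧ #F = s ∧ Meets F := by
  simp [meetFams, mem_powersetCard, and_assoc]

/-- The compression replacing members `X ∈ S` of `A` by `γ X` whenever `γ X ∉ A`. -/
def compr (S : Finset (Finset α)) (γ : Finset α → Finset α) (A : Finset (Finset α)) :
    Finset (Finset α) :=
  {X ∈ A | X ∈ S → γ X ∈ A} ∪ (A ∩ S).image γ

/-- `γ` maps `S` injectively to larger sets outside `S`. -/
structure IsLift (S : Finset (Finset α)) (γ : Finset α → Finset α) : Prop where
  inj : Set.InjOn γ S
  notMem : ∀ X ∈ S, γ X ∉ S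
  card_lt : ∀ X ∈ S, #X < #(γ X)

theorem compr_mono {S : Finset (Finset α)} {γ : Finset α → Finset α} {A A' : Finset (Finset α)}
    (h : A ⊆ A') : compr S γ A ⊆ compr S γ A' := by
  unfold compr
  apply union_subset_union
  · intro X hX
    simp only [mem_filter] at hX ⊢
    exact ⟨h hX.1, fun hS => h (hX.2 hS)⟩
  · exact image_subset_image (inter_subset_inter_right h)

theorem compr_eq_self {S : Finset (Finset α)} {γ : Finset α → Finset α} {A : Finset (Finset α)}
    (h : ∀ X ∈ A, X ∈ S → γ X ∈ A) : compr S γ A = A := by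
  ext Y
  simp only [compr, mem_union, mem_filter, mem_image, mem_inter]
  grind

theorem compr_eq {S : Finset (Finset α)} {γ : Finset α → Finset α} (A : Finset (Finset α)) 
    (hS : IsLift S γ) : compr S γ A =
      A \ {X ∈ A ∩ S | γ X ∉ A} ∪ {X ∈ A ∩ S | γ X ∉ A}.image γ := by
  have h2 := hS.notMem
  ext Y
  simp only [compr, mem_union, mem_filter, mem_image, mem_inter, mem_sdiff]
  grind

theorem sum_compr {S : Finset (Finset α)} {γ : Finset α → Finset α} (hS : IsLift S γ)
    (A : Finset (Finset α)) (f : Finset α → ℕ) :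
    ∑ X ∈ compr S γ A, f X + ∑ X ∈ {X ∈ A ∩ S | γ X ∉ A}, f X =
      ∑ X ∈ A, f X + ∑ X ∈ {X ∈ A ∩ S | γ X ∉ A}, f (γ X) := by
  have hinj : Set.InjOn γ {X ∈ A ∩ S | γ X ∉ A} := fun X hX Y hY h => by
    simp at hX hY
    exact hS.inj hX.1.2 hY.1.2 h
  have hsub : {X ∈ A ∩ S | γ X ∉ A} ⊆ A := fun X hX => by
    simp at hX
    exact hX.1.1
  rw [compr_eq A hS, sum_union, sum_image (by simpa using hinj), ← sum_sdiff hsub]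
  · ring
  · rw [disjoint_left]
    intro X hX hX'
    simp only [mem_image, mem_filter, mem_sdiff] at hX hX'
    obtain ⟨Z, hZ, rfl⟩ := hX'
    exact hZ.2 hX.1

theorem card_compr {S : Finset (Finset α)} {γ : Finset α → Finset α} (hS : IsLift S γ)
    (A : Finset (Finset α)) : #(compr S γ A) = #A := by
  have := sum_compr hS A fun _ => 1
  simpa using this

theorem sum_card_le_compr {S : Finset (Finset α)} {γ : Finset α → Finset α} (hS : IsLift S γ)
    (A : Finset (Finset α)) : ∑ X ∈ A, #X ≤ ∑ X ∈ compr S γ A, #X := by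
  have := sum_compr hS A card
  have : ∑ X ∈ {X ∈ A ∩ S | γ X ∉ A}, #X ≤ ∑ X ∈ {X ∈ A ∩ S | γ X ∉ A}, #(γ X) := by
    apply sum_le_sum
    intro X hX
    simp at hX
    exact (hS.card_lt X hX.1.2).le
  lia

theorem sum_card_lt_compr {S : Finset (Finset α)} {γ : Finset α → Finset α} (hS : IsLift S γ)
    {A : Finset (Finset α)} {X : Finset α} (hX : X ∈ A) (hXS : X ∈ S) (hγ : γ X ∉ A) :
    ∑ X ∈ A, #X < ∑ X ∈ compr S γ A, #X := by
  have := sum_compr hS A card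
  have : ∑ X ∈ {X ∈ A ∩ S | γ X ∉ A}, #X < ∑ X ∈ {X ∈ A ∩ S | γ X ∉ A}, #(γ X) := by
    apply sum_lt_sum_of_nonempty ⟨X, by simp [hX, hXS, hγ]⟩
    intro X hX
    simp at hX
    exact hS.card_lt X hX.1.2
  lia

/-- `A` maximises the number of intersecting `s`-subfamilies among families of its size. -/
def IsMaxFam (s : ℕ) (A : Finset (Finset α)) : Prop :=
  ∀ A' : Finset (Finset α), #A' = #A → #(meetFams s A') ≤ #(meetFams s A)

theorem IsMaxFam.compr {s : ℕ} {A : Finset (Finset α)} (hA : IsMaxFam s A)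
    {S : Finset (Finset α)} {γ : Finset α → Finset α} (hS : IsLift S γ)
    (h : #(meetFams s A) ≤ #(meetFams s (compr S γ A))) : IsMaxFam s (compr S γ A) :=
  fun A' hA' => (hA A' (hA'.trans (card_compr hS A))).trans h

theorem card_meetFams_le_compr_singleton {s : ℕ} (A : Finset (Finset α)) {X X' : Finset α}
    (hX : X ⊂ X') : #(meetFams s A) ≤ #(meetFams s (compr {X} (fun _ => X') A)) := by
  by_cases h : X ∈ A ∧ X' ∉ A
  · obtain ⟨h1, h2⟩ := h
    apply card_le_card_of_injOn (fun F => F.image (Equiv.swap X X'))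
    · intro F hF
      simp only [mem_coe, mem_meetFams] at hF ⊢
      obtain ⟨hF1, hF2, hF3⟩ := hF
      refine ⟨?_, ?_, ?_⟩
      · intro Y hY
        obtain ⟨Z, hZ, rfl⟩ := mem_image.1 hY
        simp only [compr, mem_union, mem_filter, mem_image, mem_inter, mem_singleton]
        by_cases hZX : Z = X
        · subst hZX
          right
          exact ⟨Z, ⟨h1, rfl⟩, by simp⟩
        · left
          have : Z ≠ X' := fun h => h2 (h ▸ hF1 hZ)
          rw [Equiv.swap_apply_of_ne_of_ne hZX this]
          exact ⟨hF1 hZ, fun h => absurd h hZX⟩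
      · rw [card_image_of_injective _ (Equiv.injective _), hF2]
      · have key : ∀ Z ∈ F, Z ⊆ Equiv.swap X X' Z := by
          intro Z hZ
          by_cases hZX : Z = X
          · subst hZX
            simpa using hX.1
          · have : Z ≠ X' := fun h => h2 (h ▸ hF1 hZ)
            rw [Equiv.swap_apply_of_ne_of_ne hZX this]
        intro B hB B' hB'
        obtain ⟨Z, hZ, rfl⟩ := mem_image.1 hB
        obtain ⟨Z', hZ', rfl⟩ := mem_image.1 hB'
        exact (hF3 Z hZ Z' hZ').mono (inter_subset_inter (key Z hZ) (key Z' hZ'))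
    · exact (image_injective (Equiv.injective _)).injOn
  · rw [compr_eq_self]
    grind

/-- The members of `F` that have to be moved along with `F ∩ M` when `v` is traded for other
elements. -/
inductive Linked (F S M : Finset (Finset α)) (v : α) : Finset α → Prop
  | base {X : Finset α} : X ∈ F → X ∈ S → X ∈ M → Linked F S M v X
  | step {X X' : Finset α} : Linked F S M v X → X' ∈ F → X' ∈ S → X ∩ X' = {v} →
      Linked F S M v X'

theorem Linked.mem {F S M : Finset (Finset α)} {v : α} {X : Finset α} (h : Linked F S M v X) :
    X ∈ F ∧ X ∈ S := by
  cases h <;> tauto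

theorem Linked.image_notMem {F S A : Finset (Finset α)} {U : Finset α} {v : α}
    (hS : ∀ X, X ∈ S ↔ v ∈ X ∧ Disjoint X U) (hF : F ⊆ A) (hFm : Meets F) {X : Finset α}
    (h : Linked F S {X ∈ S | X.erase v ∪ U ∉ A} v X) : X.erase v ∪ U ∉ F := by
  cases h with
  | base h1 h2 h3 => exact fun h => (mem_filter.1 h3).2 (hF h)
  | step h1 h2 h3 h4 =>
    rename_i Y
    intro h
    obtain ⟨x, hx⟩ := hFm Y h1.mem.1 _ h
    have hY := (hS Y).1 h1.mem.2
    have hX := (hS X).1 h3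
    have := disjoint_left.1 hY.2
    simp only [mem_inter, mem_union, mem_erase] at hx
    have h5 : x ∉ U := this hx.1
    have h6 : x ∈ Y ∩ X := by simp; tauto
    rw [h4] at h6
    simp at h6
    tauto

open Classical in
/-- The effect of the compression on an intersecting subfamily. -/
noncomputable def moveLinked (S A : Finset (Finset α)) (v : α) (U : Finset α)
    (F : Finset (Finset α)) : Finset (Finset α) :=
  {X ∈ F | ¬ Linked F S {X ∈ S | X.erase v ∪ U ∉ A} v X} ∪
    {X ∈ F | Linked F S {X ∈ S | X.erase v ∪ U ∉ A} v X}.image (fun X => X.erase v ∪ U)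

theorem lift_injOn {S : Finset (Finset α)} {U : Finset α} {v : α} (hv : v ∉ U)
    (hS : ∀ X, X ∈ S ↔ v ∈ X ∧ Disjoint X U) :
    Set.InjOn (fun X : Finset α => X.erase v ∪ U) S := by
  intro X hX Y hY h
  have hX := (hS X).1 hX
  have hY := (hS Y).1 hY
  have hX' := disjoint_left.1 hX.2
  have hY' := disjoint_left.1 hY.2
  ext x
  have := congrArg (x ∈ ·) h
  simp only [mem_union, mem_erase, eq_iff_iff] at this
  by_cases hx : x = v
  · subst hx; tauto
  · by_cases hx : x ∈ U
    · have := @hX' x; have := @hY' x; tauto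
    · tauto

theorem linked_of_moveLinked_eq {F F' S A : Finset (Finset α)} {U : Finset α} {v : α} (hv : v ∉ U)
    (hS : ∀ X, X ∈ S ↔ v ∈ X ∧ Disjoint X U) (hF' : F' ⊆ A) (hFm' : Meets F')
    (h : moveLinked S A v U F = moveLinked S A v U F') {X : Finset α}
    (hX : Linked F S {X ∈ S | X.erase v ∪ U ∉ A} v X) :
    Linked F' S {X ∈ S | X.erase v ∪ U ∉ A} v X := by
  have hinj := lift_injOn hv hS
  have key : ∀ X, Linked F S {X ∈ S | X.erase v ∪ U ∉ A} v X → X.erase v ∪ U ∉ F' →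
      Linked F' S {X ∈ S | X.erase v ∪ U ∉ A} v X := by
    intro X hX hXF
    have h1 : X.erase v ∪ U ∈ moveLinked S A v U F := by
      unfold moveLinked
      apply mem_union_right
      exact mem_image_of_mem _ (by simp [hX.mem.1, hX])
    rw [h] at h1
    simp only [moveLinked, mem_union, mem_filter, mem_image] at h1
    rcases h1 with h1 | ⟨Y, hY, hXY⟩
    · exact absurd h1.1 hXF
    · rw [hinj hX.mem.2 hY.2.mem.2 hXY.symm]
      exact hY.2
  induction hX with
  | @base X h1 h2 h3 =>
    exact key X (.base h1 h2 h3) fun h => (mem_filter.1 h3).2 (hF' h)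
  | @step X X' h1 h2 h3 h4 ih =>
    refine key X' (.step h1 h2 h3 h4) fun hm => ?_
    obtain ⟨x, hx⟩ := hFm' X ih.mem.1 _ hm
    have hX := (hS X).1 h1.mem.2
    have := disjoint_left.1 hX.2
    simp only [mem_inter, mem_union, mem_erase] at hx
    have h5 : x ∉ U := this hx.1
    have h6 : x ∈ X ∩ X' := by simp; tauto
    rw [h4] at h6
    simp at h6
    tauto

theorem card_meetFams_le_compr {s : ℕ} (A S : Finset (Finset α)) {U : Finset α} {v : α}
    (hU : U.Nonempty) (hv : v ∉ U) (hS : ∀ X, X ∈ S ↔ v ∈ X ∧ Disjoint X U) :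
    #(meetFams s A) ≤ #(meetFams s (compr S (fun X => X.erase v ∪ U) A)) := by
  have hinj := lift_injOn hv hS
  apply card_le_card_of_injOn (moveLinked S A v U)
  · intro F hF
    simp only [mem_coe, mem_meetFams] at hF ⊢
    obtain ⟨hF1, hF2, hF3⟩ := hF
    refine ⟨?_, ?_, ?_⟩
    · intro Y hY
      simp only [moveLinked, mem_union, mem_filter, mem_image] at hY
      simp only [compr, mem_union, mem_filter, mem_image, mem_inter]
      rcases hY with ⟨h1, h2⟩ | ⟨X, ⟨h1, h2⟩, rfl⟩
      · refine Or.inl ⟨hF1 h1, fun hYS => ?_⟩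
        by_contra h3
        exact h2 (.base h1 hYS (by simp [hYS, h3]))
      · exact Or.inr ⟨X, ⟨hF1 h1, h2.mem.2⟩, rfl⟩
    · rw [moveLinked, card_union_of_disjoint, card_image_of_injOn]
      · rw [add_comm, card_filter_add_card_filter_not, hF2]
      · intro X hX Y hY h
        simp at hX hY
        exact hinj hX.2.mem.2 hY.2.mem.2 h
      · rw [disjoint_left]
        intro X hX hX'
        simp only [mem_filter, mem_image] at hX hX'
        obtain ⟨Y, hY, rfl⟩ := hX'
        exact hY.2.image_notMem hS hF1 hF3 hX.1
    · have key : ∀ Z X, Z ∈ F → ¬ Linked F S {X ∈ S | X.erase v ∪ U ∉ A} v Z →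
          Linked F S {X ∈ S | X.erase v ∪ U ∉ A} v X → (Z ∩ (X.erase v ∪ U)).Nonempty := by
        intro Z X hZ hZ' hX
        rw [← not_disjoint_iff_nonempty_inter]
        intro hd
        rw [disjoint_union_right] at hd
        obtain ⟨x, hx⟩ := hF3 Z hZ X hX.mem.1
        have h7 : ∀ x, x ∈ X → x ∈ Z → x = v := by
          intro x h1 h2
          by_contra h3
          exact disjoint_left.1 hd.1 h2 (by simp [h3, h1])
        simp only [mem_inter] at hx
        have hxv := h7 x hx.2 hx.1
        subst hxv
        refine hZ' (.step hX hZ ((hS Z).2 ⟨hx.1, hd.2⟩) ?_)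
        ext y
        simp only [mem_inter, mem_singleton]
        constructor
        · exact fun h => h7 y h.1 h.2
        · rintro rfl; exact hx.symm
      intro B hB B' hB'
      simp only [moveLinked, mem_union, mem_filter, mem_image] at hB hB'
      rcases hB with ⟨h1, h2⟩ | ⟨X, ⟨h1, h2⟩, rfl⟩ <;>
        rcases hB' with ⟨h1', h2'⟩ | ⟨X', ⟨h1', h2'⟩, rfl⟩
      · exact hF3 B h1 B' h1'
      · exact key _ _ h1 h2 h2'
      · rw [inter_comm]
        exact key _ _ h1' h2' h2
      · obtain ⟨u, hu⟩ := hU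
        exact ⟨u, by simp [hu]⟩
  · intro F hF F' hF' h
    simp only [mem_coe, mem_meetFams] at hF hF'
    obtain ⟨hF1, hF2, hF3⟩ := hF
    obtain ⟨hF1', hF2', hF3'⟩ := hF'
    have hK : ∀ X, Linked F S {X ∈ S | X.erase v ∪ U ∉ A} v X ↔
        Linked F' S {X ∈ S | X.erase v ∪ U ∉ A} v X := fun X =>
      ⟨linked_of_moveLinked_eq hv hS hF1' hF3' h, linked_of_moveLinked_eq hv hS hF1 hF3 h.symm⟩
    have one : ∀ F F' : Finset (Finset α), F ⊆ A → F' ⊆ A → Meets F → Meets F' →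
        moveLinked S A v U F = moveLinked S A v U F' →
        (∀ X, Linked F S {X ∈ S | X.erase v ∪ U ∉ A} v X ↔
          Linked F' S {X ∈ S | X.erase v ∪ U ∉ A} v X) → F ⊆ F' := by
      intro F F' hF1 hF1' hF3 hF3' h hK X hX
      by_cases hX' : Linked F S {X ∈ S | X.erase v ∪ U ∉ A} v X
      · exact ((hK X).1 hX').mem.1
      · have h1 : X ∈ moveLinked S A v U F := by
          unfold moveLinked
          apply mem_union_left
          simp [hX, hX']
        rw [h] at h1
        simp only [moveLinked, mem_union, mem_filter, mem_image] at h1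
        rcases h1 with h1 | ⟨Y, hY, rfl⟩
        · exact h1.1
        · exact absurd hX (((hK Y).2 hY.2).image_notMem hS hF1 hF3)
    exact (one F F' hF1 hF1' hF3 hF3' h hK).antisymm
      (one F' F hF1' hF1 hF3' hF3 h.symm fun X => (hK X).symm)

theorem isLift_trade {S : Finset (Finset α)} {U : Finset α} {v : α} (hU : 2 ≤ #U) (hv : v ∉ U)
    (hS : ∀ X, X ∈ S ↔ v ∈ X ∧ Disjoint X U) : IsLift S (fun X => X.erase v ∪ U) where
  inj := lift_injOn hv hS
  notMem X hX h := by
    have := ((hS _).1 h).1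
    simp [hv] at this
  card_lt X hX := by
    have hX := (hS X).1 hX
    rw [card_union_of_disjoint (hX.2.mono_left (erase_subset _ _)), card_erase_of_mem hX.1]
    have := card_pos.2 ⟨v, hX.1⟩
    lia

end Compression

section Stable
variable {α : Type*} [Fintype α] [DecidableEq α]

/-- `A` and `A'` maximise the number of intersecting `s`-subfamilies and cannot be changed by
compressions that do not decrease this number for both. -/
structure IsStablePair (s : ℕ) (A A' : Finset (Finset α)) : Prop where
  subset : A ⊆ A'
  max : IsMaxFam s A
  max' : IsMaxFam s A'
  stable : ∀ S γ, IsLift S γ → #(meetFams s A) ≤ #(meetFams s (compr S γ A)) →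
    #(meetFams s A') ≤ #(meetFams s (compr S γ A')) →
    ∀ X ∈ S, (X ∈ A → γ X ∈ A) ∧ (X ∈ A' → γ X ∈ A')

theorem exists_isStablePair {s : ℕ} {A A' : Finset (Finset α)} (hAA' : A ⊆ A')
    (hA : IsMaxFam s A) (hA' : IsMaxFam s A') :
    ∃ B B' : Finset (Finset α), #B = #A ∧ #B' = #A' ∧ IsStablePair s B B' := by
  classical
  obtain ⟨⟨B, B'⟩, hB, hmax⟩ := exists_max_image
    (univ.filter fun p : Finset (Finset α) × Finset (Finset α) =>
      p.1 ⊆ p.2 ∧ #p.1 = #A ∧ #p.2 = #A' ∧ IsMaxFam s p.1 ∧ IsMaxFam s p.2)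
    (fun p => ∑ X ∈ p.1, #X + ∑ X ∈ p.2, #X) ⟨(A, A'), by simp [*]⟩
  simp only [mem_filter, mem_univ, true_and] at hB hmax
  obtain ⟨h1, h2, h3, h4, h5⟩ := hB
  refine ⟨B, B', h2, h3, h1, h4, h5, fun S γ hS hB hB' X hX => ?_⟩
  have hle := hmax (compr S γ B, compr S γ B') ⟨compr_mono h1, by rw [card_compr hS, h2],
    by rw [card_compr hS, h3], h4.compr hS hB, h5.compr hS hB'⟩
  have l1 := sum_card_le_compr hS B
  have l2 := sum_card_le_compr hS B'
  simp only at hle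
  constructor
  · intro hXB
    by_contra hc
    have := sum_card_lt_compr hS hXB hX hc
    lia
  · intro hXB
    by_contra hc
    have := sum_card_lt_compr hS hXB hX hc
    lia

omit [Fintype α] [DecidableEq α] in
theorem isLift_singleton {X X' : Finset α} (h : #X < #X') : IsLift {X} (fun _ => X') where
  inj := by simp
  notMem Y hY := by
    simp only [mem_singleton]
    rintro rfl
    exact lt_irrefl _ h
  card_lt Y hY := by
    rw [mem_singleton.1 hY]
    exact h

/-- Closed under supersets and under trading one element for two others. -/
structure IsClosedFam (A : Finset (Finset α)) : Prop where
  up : ∀ X ∈ A, ∀ X', X ⊆ X' → X' ∈ A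
  trade : ∀ X ∈ A, ∀ v ∈ X, ∀ U, #U = 2 → Disjoint X U → X.erase v ∪ U ∈ A

theorem IsStablePair.isClosedFam {s : ℕ} {A A' : Finset (Finset α)} (h : IsStablePair s A A') :
    IsClosedFam A ∧ IsClosedFam A' := by
  have up : ∀ X X', X ⊆ X' → (X ∈ A → X' ∈ A) ∧ (X ∈ A' → X' ∈ A') := by
    intro X X' hX
    rcases hX.eq_or_ssubset with rfl | hX
    · simp
    · exact h.stable {X} (fun _ => X') (isLift_singleton (card_lt_card hX))
        (card_meetFams_le_compr_singleton A hX) (card_meetFams_le_compr_singleton A' hX) X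
        (by simp)
  have trade : ∀ X, ∀ v ∈ X, ∀ U, #U = 2 → Disjoint X U →
      (X ∈ A → X.erase v ∪ U ∈ A) ∧ (X ∈ A' → X.erase v ∪ U ∈ A') := by
    intro X v hv U hU hX
    have hvU : v ∉ U := disjoint_left.1 hX hv
    have hne : U.Nonempty := card_pos.1 (by lia)
    have hS : ∀ Y, Y ∈ univ.filter (fun Y : Finset α => v ∈ Y ∧ Disjoint Y U) ↔
      v ∈ Y ∧ Disjoint Y U := by simp
    exact h.stable _ _ (isLift_trade hU.ge hvU hS) (card_meetFams_le_compr A _ hne hvU hS)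
      (card_meetFams_le_compr A' _ hne hvU hS) X ((hS X).2 ⟨hv, hX⟩)
  exact ⟨⟨fun X hX X' hs => (up X X' hs).1 hX, fun X hX v hv U hU hd => (trade X v hv U hU hd).1 hX⟩,
    ⟨fun X hX X' hs => (up X X' hs).2 hX, fun X hX v hv U hU hd => (trade X v hv U hU hd).2 hX⟩⟩

/-- The members of size `2`. -/
def edgesOf (A : Finset (Finset α)) : Finset (Finset α) := {X ∈ A | #X = 2}

/-- All sets of size at least three. -/
def bigSets (α : Type*) [Fintype α] [DecidableEq α] : Finset (Finset α) := {X | 3 ≤ #X}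

/-- The elements covered by the pairs in `A`. -/
def edgeSupp (A : Finset (Finset α)) : Finset α := (edgesOf A).biUnion id

/-- The sets of size at least three missing from `A`. -/
def missing (A : Finset (Finset α)) : Finset (Finset α) := bigSets α \ A

theorem card_bigSets_add : #(bigSets α) + (Fintype.card α).choose 2 + Fintype.card α + 1 =
    2 ^ Fintype.card α := by
  have h1 : ∀ k, #({X | #X = k} : Finset (Finset α)) = (Fintype.card α).choose k := by
    intro k
    rw [← Finset.card_univ (α := α), ← card_powersetCard]
    congr 1
    ext X
    simp [mem_powersetCard]
  have h2 : (univ : Finset (Finset α)) = bigSets α ∪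
      (univ.filter (fun X => #X = 2) ∪ (univ.filter (fun X => #X = 1) ∪ univ.filter (fun X => #X = 0))) := by
    ext X
    simp only [bigSets, mem_union, mem_filter, mem_univ, true_and]
    lia
  have h3 := congrArg card h2
  rw [card_union_of_disjoint, card_union_of_disjoint, card_union_of_disjoint, h1, h1, h1] at h3
  · simp at h3
    lia
  all_goals
    rw [disjoint_left]
    intro X
    simp only [bigSets, mem_union, mem_filter, mem_univ, true_and]
    lia

theorem card_le_one_notMem {A : Finset (Finset α)} (hA : IsClosedFam A)
    (hcard : #A ≤ #(bigSets α) + (Fintype.card α - 1).choose 2) (hn : 3 ≤ Fintype.card α)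
    {X : Finset α} (hX : X ∈ A) : 2 ≤ #X := by
  by_contra! hc
  obtain ⟨x, hx⟩ : ∃ x, {x} ∈ A := by
    rcases Nat.le_one_iff_eq_zero_or_eq_one.1 (Nat.le_of_lt_succ hc) with h | h
    · have : Nonempty α := Fintype.card_pos_iff.1 (by lia)
      obtain ⟨x⟩ := this
      rw [card_eq_zero] at h
      subst h
      exact ⟨x, hA.up _ hX _ (by simp)⟩
    · obtain ⟨x, rfl⟩ := card_eq_one.1 h
      exact ⟨x, hX⟩
  have h2 : bigSets α ∪ powersetCard 2 univ ⊆ A := by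
    have h3 : powersetCard 2 univ ⊆ A := by
      intro U hU
      have hU := (mem_powersetCard.1 hU).2
      by_cases hxU : x ∈ U
      · exact hA.up _ hx _ (by simpa using hxU)
      · have := hA.trade _ hx x (by simp) U hU (by simpa using hxU)
        simpa using this
    apply union_subset _ h3
    intro X hX
    simp only [bigSets, mem_filter, mem_univ, true_and] at hX
    obtain ⟨U, hU, hUc⟩ := exists_subset_card_eq (show 2 ≤ #X by lia)
    exact hA.up U (h3 (by simp [mem_powersetCard, hUc])) _ hU
  have h3 := card_le_card h2
  rw [card_union_of_disjoint, card_powersetCard, card_univ] at h3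
  · obtain ⟨m, hm⟩ : ∃ m, Fintype.card α = m + 3 := ⟨_, (Nat.sub_add_cancel hn).symm⟩
    rw [hm] at h3 hcard
    rw [show m + 3 - 1 = m + 2 from rfl] at hcard
    have := Nat.choose_succ_succ (m + 2) 1
    simp at this
    lia
  · rw [disjoint_left]
    intro X
    simp [bigSets, mem_powersetCard]
    lia

omit [Fintype α] in
theorem mem_edgeSupp {A : Finset (Finset α)} {y : α} :
    y ∈ edgeSupp A ↔ ∃ e ∈ A, #e = 2 ∧ y ∈ e := by
  simp [edgeSupp, edgesOf, and_assoc]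

omit [Fintype α] in
theorem IsClosedFam.triple_mem {A : Finset (Finset α)} (hA : IsClosedFam A) {y : α}
    (hy : y ∈ edgeSupp A) {T : Finset α} (hT : #T = 3) (hyT : y ∈ T) : T ∈ A := by
  obtain ⟨e, he, he2, hye⟩ := mem_edgeSupp.1 hy
  by_cases hs : e ⊆ T
  · exact hA.up e he T hs
  · obtain ⟨x, hxe, hxT⟩ := not_subset.1 hs
    have hxy : x ≠ y := fun h => hxT (h ▸ hyT)
    have hexy : e = {x, y} := by
      symm
      apply eq_of_subset_of_card_le
      · intro z; simp; rintro (rfl | rfl) <;> assumption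
      · rw [he2, card_pair hxy]
    have := hA.trade e he x hxe (T.erase y) (by rw [card_erase_of_mem hyT, hT]) (by
      rw [hexy]
      simp [hxT])
    convert this using 1
    rw [hexy]
    ext z
    simp
    grind

omit [Fintype α] in
theorem IsClosedFam.big_mem {A : Finset (Finset α)} (hA : IsClosedFam A)
    (hne : (edgesOf A).Nonempty) {X : Finset α} (hX : 4 ≤ #X) : X ∈ A := by
  obtain ⟨e, he⟩ := hne
  simp only [edgesOf, mem_filter] at he
  obtain ⟨y, hy⟩ : e.Nonempty := card_pos.1 (by lia)
  have hyP : y ∈ edgeSupp A := mem_edgeSupp.2 ⟨e, he.1, he.2, hy⟩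
  obtain ⟨Y, hYX, hY⟩ := exists_subset_card_eq hX
  refine hA.up Y ?_ X hYX
  by_cases hyY : y ∈ Y
  · obtain ⟨T, hT1, hT2, hT⟩ := exists_subsuperset_card_eq (s := {y}) (t := Y) (n := 3)
      (by simpa using hyY) (by simp) (by lia)
    exact hA.up T (hA.triple_mem hyP hT (hT1 (by simp))) Y hT2
  · obtain ⟨U, hUY, hU⟩ := exists_subset_card_eq (show 2 ≤ #Y by lia)
    have hyU : y ∉ Y \ U := by simp [hyY]
    have hc : #(Y \ U) = 2 := by rw [card_sdiff_of_subset hUY]; lia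
    have h1 : insert y (Y \ U) ∈ A := hA.triple_mem hyP
      (by rw [card_insert_of_notMem hyU, hc]) (by simp)
    have h2 := hA.trade _ h1 y (by simp) U hU (by
      rw [disjoint_insert_left]
      exact ⟨fun h => hyY (hUY h), sdiff_disjoint⟩)
    rwa [erase_insert hyU, sdiff_union_of_subset hUY] at h2

theorem IsClosedFam.of_mem_missing {A : Finset (Finset α)} (hA : IsClosedFam A)
    (hne : (edgesOf A).Nonempty) {X : Finset α} (hX : X ∈ missing A) :
    #X = 3 ∧ Disjoint X (edgeSupp A) := by
  simp only [missing, bigSets, mem_sdiff, mem_filter, mem_univ, true_and] at hX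
  have h3 : #X = 3 := by
    by_contra h
    exact hX.2 (hA.big_mem hne (by lia))
  refine ⟨h3, disjoint_left.2 fun y hy hy' => hX.2 (hA.triple_mem hy' h3 hy)⟩

theorem eq_bigSets_sdiff_union_edgesOf {A : Finset (Finset α)} (h2 : ∀ X ∈ A, 2 ≤ #X) :
    A = (bigSets α \ missing A) ∪ edgesOf A := by
  ext X
  simp only [missing, bigSets, edgesOf, mem_union, mem_sdiff, mem_filter, mem_univ, true_and]
  have := h2 X
  constructor
  · intro h
    have := h2 X h
    by_cases h3 : #X = 2
    · exact Or.inr ⟨h, h3⟩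
    · left; refine ⟨by lia, by tauto⟩
  · tauto

theorem card_add_card_missing {A : Finset (Finset α)} (h2 : ∀ X ∈ A, 2 ≤ #X) :
    #A + #(missing A) = #(bigSets α) + #(edgesOf A) := by
  have h := congrArg card (eq_bigSets_sdiff_union_edgesOf h2)
  have hs : missing A ⊆ bigSets α := sdiff_subset
  rw [card_union_of_disjoint, card_sdiff_of_subset hs] at h
  · have := card_le_card hs
    lia
  · rw [disjoint_left]
    intro X
    simp [bigSets, edgesOf]
    lia

omit [Fintype α] in
theorem card_edgesOf_le (A : Finset (Finset α)) :
    #(edgesOf A) ≤ (#(edgeSupp A)).choose 2 := by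
  rw [← card_powersetCard]
  apply card_le_card
  intro e he
  rw [mem_powersetCard]
  refine ⟨fun y hy => ?_, (mem_filter.1 he).2⟩
  exact mem_edgeSupp.2 ⟨e, (mem_filter.1 he).1, (mem_filter.1 he).2, hy⟩

end Stable

section Flip
variable {α : Type*} [Fintype α] [DecidableEq α]

/-- Replace the sets in `S` by the complements of their images under `κ`. -/
def coFlip (S : Finset (Finset α)) (κ : Finset α → Finset α) (X : Finset α) : Finset α :=
  if X ∈ S then (κ X)ᶜ else X

theorem coFlip_injOn {S : Finset (Finset α)} {κ : Finset α → Finset α} (hκ : Set.InjOn κ S) :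
    Set.InjOn (coFlip S κ) {X | ∀ Y ∈ S, X ≠ (κ Y)ᶜ} := by
  intro X hX Y hY h
  simp only [Set.mem_ofPred_eq] at hX hY
  unfold coFlip at h
  split_ifs at h with h1 h2 h3
  · exact hκ h1 h2 (compl_injective h)
  · exact absurd h.symm (hY X h1)
  · exact absurd h (hX Y h3)
  · exact h

theorem meets_image_coFlip {S F : Finset (Finset α)} {κ : Finset α → Finset α} (hF : Meets F)
    (h1 : ∀ Y ∈ F, Y ∉ S → ∀ X ∈ F, X ∈ S → ¬ Y ⊆ κ X)
    (h2 : ∀ X ∈ F, X ∈ S → ∀ Y ∈ F, Y ∈ S → #(κ X) + #(κ Y) < Fintype.card α) :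
    Meets (F.image (coFlip S κ)) := by
  have key : ∀ X Y : Finset α, ¬ Y ⊆ X → (Y ∩ Xᶜ).Nonempty := by
    intro X Y h
    obtain ⟨x, hx, hx'⟩ := not_subset.1 h
    exact ⟨x, by simp [hx, hx']⟩
  intro B hB B' hB'
  obtain ⟨X, hX, rfl⟩ := mem_image.1 hB
  obtain ⟨Y, hY, rfl⟩ := mem_image.1 hB'
  unfold coFlip
  split_ifs with h3 h4 h4
  · rw [← compl_union, nonempty_iff_ne_empty, Ne, compl_eq_empty_iff]
    intro h
    have := h2 X hX h3 Y hY h4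
    have := card_union_le (κ X) (κ Y)
    rw [h, card_univ] at this
    lia
  · rw [inter_comm]
    exact key _ _ (h1 Y hY h4 X hX h3)
  · exact key _ _ (h1 X hX h3 Y hY h4)
  · exact hF X hX Y hY

end Flip

section Swap
variable {α : Type*} [Fintype α] [DecidableEq α] {a b c : α}

/-- The set contains exactly one of `b` and `c`. -/
def Splits (b c : α) (X : Finset α) : Prop := ¬ (b ∈ X ↔ c ∈ X)

instance (b c : α) (X : Finset α) : Decidable (Splits b c X) := by unfold Splits; infer_instance

/-- The families left when a pair `{b, c}` is removed from an intersecting family. -/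
structure IsPairLink (b c : α) (D : Finset (Finset α)) (k : ℕ) (F : Finset (Finset α)) : Prop where
  meets : Meets F
  card : #F = k
  hits : ∀ X ∈ F, b ∈ X ∨ c ∈ X
  ne : ∀ X ∈ F, X ≠ {b, c}
  two_le : ∀ X ∈ F, 2 ≤ #X
  pair : ∀ X ∈ F, #X = 2 → X ∈ D

/-- The families left when a triple `{a, b, c}` is removed from an intersecting family. -/
structure IsTripleLink (a b c : α) (D : Finset (Finset α)) (k : ℕ) (F : Finset (Finset α)) :
    Prop where
  meets : Meets F
  card : #F = k
  hits : ∀ X ∈ F, a ∈ X ∨ b ∈ X ∨ c ∈ X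
  three_le : ∀ X ∈ F, 3 ≤ #X
  triple : ∀ X ∈ F, #X = 3 → Splits b c X ∧ X ∉ D

/-- The sets in `Z` may be exchanged with complements of their partners under `ψ`. -/
structure IsPartner (a b c : α) (D F Z : Finset (Finset α)) (ψ : Finset α → Finset α) : Prop where
  subset : Z ⊆ F
  inj : Set.InjOn ψ Z
  low : ∀ X ∈ Z, #X ≤ 3 ∧ Splits b c X
  four : ∀ X ∈ Z, #(ψ X) = 4
  not_subset : ∀ X ∈ Z, a ∉ ψ X ∨ b ∉ ψ X ∨ c ∉ ψ X
  compl_notMem : ∀ X ∈ Z, (ψ X)ᶜ ∉ F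
  pair : ∀ X ∈ F, #X = 2 → X ∈ Z
  forbidden : ∀ X ∈ F, X ∈ D → X ∈ Z
  triple : ∀ Y ∈ F, #Y = 3 → Splits b c Y → ∀ X ∈ Z, Y ⊆ ψ X → Y ∈ Z

/-- The sets changed by the exchange. -/
def partnerSupp (b c : α) (Z : Finset (Finset α)) (ψ : Finset α → Finset α) :
    Finset (Finset α) :=
  Z ∪ Z.image ψ ∪ univ.filter fun X => #X = 3 ∧ b ∈ X ∧ c ∈ X

/-- The involution underlying the exchange. -/
noncomputable def partnerMap (a b c : α) (Z : Finset (Finset α)) (ψ : Finset α → Finset α)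
    (X : Finset α) : Finset α :=
  if X ∈ Z then ψ X else if X ∈ Z.image ψ then Function.invFunOn ψ Z X
    else if a ∈ X then {b, c} else X

/-- The exchange. -/
noncomputable def partnerFlip (a b c : α) (Z : Finset (Finset α)) (ψ : Finset α → Finset α) :
    Finset α → Finset α :=
  coFlip (partnerSupp b c Z ψ) (partnerMap a b c Z ψ)

variable {D F Z : Finset (Finset α)} {ψ : Finset α → Finset α} {k : ℕ}

theorem partnerMap_cases {X : Finset α}
    (hX : X ∈ partnerSupp b c Z ψ) :
    (X ∈ Z ∧ partnerMap a b c Z ψ X = ψ X) ∨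
    (partnerMap a b c Z ψ X ∈ Z ∧ X = ψ (partnerMap a b c Z ψ X)) ∨
    (#X = 3 ∧ b ∈ X ∧ c ∈ X ∧ a ∉ X ∧ partnerMap a b c Z ψ X = X) ∨
    (#X = 3 ∧ b ∈ X ∧ c ∈ X ∧ a ∈ X ∧ partnerMap a b c Z ψ X = {b, c}) := by
  unfold partnerMap
  split_ifs with h1 h2 h3
  · tauto
  · right; left
    have h3 : ∃ Y ∈ (Z : Set (Finset α)), ψ Y = X := by simpa using h2
    exact ⟨Function.invFunOn_mem h3, (Function.invFunOn_eq h3).symm⟩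
  · simp only [partnerSupp, mem_union, mem_filter, mem_univ, true_and] at hX
    tauto
  · simp only [partnerSupp, mem_union, mem_filter, mem_univ, true_and] at hX
    tauto

theorem partnerMap_injOn (hab : a ≠ b) (hac : a ≠ c) (hbc : b ≠ c) (h : IsPartner a b c D F Z ψ) :
    Set.InjOn (partnerMap a b c Z ψ) (partnerSupp b c Z ψ) := by
  have hlow := h.low
  have hfour := h.four
  unfold Splits at hlow
  have habc : ∀ X : Finset α, #X = 3 → b ∈ X → c ∈ X → a ∈ X → X = {a, b, c} := by
    intro X h3 hb hc ha
    symm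
    apply eq_of_subset_of_card_le
    · intro z; simp; rintro (rfl | rfl | rfl) <;> assumption
    · rw [h3, card_insert_of_notMem, card_pair hbc]
      simp [hab, hac]
  have h2 : #({b, c} : Finset α) = 2 := card_pair hbc
  have hb : b ∈ ({b, c} : Finset α) := by simp
  have hc : c ∈ ({b, c} : Finset α) := by simp
  have hinj := h.inj
  intro X hX Y hY hXY
  rcases partnerMap_cases (a := a) hX with h1 | h1 | h1 | h1 <;>
    rcases partnerMap_cases (a := a) hY with h3 | h3 | h3 | h3
  · exact h.inj h1.1 h3.1 (by rw [← h1.2, ← h3.2, hXY])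
  all_goals grind

theorem card_partnerMap_le (hbc : b ≠ c) (h : IsPartner a b c D F Z ψ) {X : Finset α}
    (hX : X ∈ partnerSupp b c Z ψ) : #(partnerMap a b c Z ψ X) ≤ 4 := by
  have hlow := h.low
  have hfour := h.four
  have h2 : #({b, c} : Finset α) = 2 := card_pair hbc
  rcases partnerMap_cases (a := a) hX with h1 | h1 | h1 | h1 <;> grind

theorem ne_compl_partnerMap (hbc : b ≠ c) (hF : IsPairLink b c D k F)
    (h : IsPartner a b c D F Z ψ) {X : Finset α} (hX : X ∈ F) :
    ∀ Y ∈ partnerSupp b c Z ψ, X ≠ (partnerMap a b c Z ψ Y)ᶜ := by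
  rintro Y hY rfl
  have hhit := hF.hits _ hX
  simp only [mem_compl] at hhit
  rcases partnerMap_cases (a := a) hY with h1 | h1 | h1 | h1
  · rw [h1.2] at hX
    exact h.compl_notMem Y h1.1 hX
  · obtain ⟨x, hx⟩ := hF.meets _ hX _ (h.subset h1.1)
    simp at hx
  · grind
  · grind

theorem partnerFlip_injOn (hab : a ≠ b) (hac : a ≠ c) (hbc : b ≠ c) {F' : Finset (Finset α)}
    (hF : IsPairLink b c D k F) (hF' : IsPairLink b c D k F') (h : IsPartner a b c D F Z ψ)
    (h' : IsPartner a b c D F' Z ψ)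
    (heq : F.image (partnerFlip a b c Z ψ) = F'.image (partnerFlip a b c Z ψ)) : F = F' := by
  have hinj := coFlip_injOn (partnerMap_injOn hab hac hbc h)
  have one : ∀ F F' : Finset (Finset α), IsPairLink b c D k F → IsPairLink b c D k F' →
      IsPartner a b c D F Z ψ → IsPartner a b c D F' Z ψ →
      F.image (partnerFlip a b c Z ψ) = F'.image (partnerFlip a b c Z ψ) → F ⊆ F' := by
    intro F F' hF hF' h h' heq X hX
    have h1 := mem_image_of_mem (partnerFlip a b c Z ψ) hX
    rw [heq] at h1
    obtain ⟨Y, hY, hYX⟩ := mem_image.1 h1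
    rwa [hinj (ne_compl_partnerMap hbc hF h hX) (ne_compl_partnerMap hbc hF' h' hY) hYX.symm]
  exact (one F F' hF hF' h h' heq).antisymm (one F' F hF' hF h' h heq.symm)

theorem isTripleLink_partnerFlip (hab : a ≠ b) (hac : a ≠ c) (hbc : b ≠ c)
    (hn : 9 ≤ Fintype.card α) (hF : IsPairLink b c D k F) (h : IsPartner a b c D F Z ψ) :
    IsTripleLink a b c D k (F.image (partnerFlip a b c Z ψ)) := by
  have h2 : #({b, c} : Finset α) = 2 := card_pair hbc
  have hcase : ∀ Y ∈ F.image (partnerFlip a b c Z ψ),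
      (Y ∈ F ∧ Y ∉ partnerSupp b c Z ψ) ∨
        ∃ X ∈ partnerSupp b c Z ψ, X ∈ F ∧ Y = (partnerMap a b c Z ψ X)ᶜ := by
    intro Y hY
    obtain ⟨X, hX, rfl⟩ := mem_image.1 hY
    unfold partnerFlip coFlip
    split_ifs with h1
    · exact Or.inr ⟨X, h1, hX, rfl⟩
    · exact Or.inl ⟨hX, h1⟩
  have hsupp : ∀ Y, Y ∉ partnerSupp b c Z ψ →
      Y ∉ Z ∧ (∀ X ∈ Z, Y ≠ ψ X) ∧ ¬ (#Y = 3 ∧ b ∈ Y ∧ c ∈ Y) := by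
    intro Y hY
    simp only [partnerSupp, mem_union, mem_filter, mem_univ, true_and, mem_image] at hY
    refine ⟨by tauto, fun X hX h => hY (Or.inl (Or.inr ⟨X, hX, h.symm⟩)), by tauto⟩
  refine ⟨?_, ?_, ?_, ?_, ?_⟩
  · apply meets_image_coFlip hF.meets
    · intro Y hY hYS X hX hXS hsub
      obtain ⟨hYZ, hYψ, hY3⟩ := hsupp Y hYS
      have hc := card_le_card hsub
      have hYpair := fun h2 => hYZ (h.pair Y hY h2)
      have hY2 := hF.two_le Y hY
      have heqc : #(partnerMap a b c Z ψ X) ≤ #Y → Y = partnerMap a b c Z ψ X :=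
        eq_of_subset_of_card_le hsub
      rcases partnerMap_cases (a := a) hXS with h1 | h1 | h1 | h1
      · have h4 := h.four X h1.1
        have h5 := h.triple Y hY
        have h6 := hF.hits Y hY
        have h7 := hYψ X h1.1
        unfold Splits at h5
        rw [h1.2] at hsub hc heqc
        have : #Y = 3 := by
          by_contra h8
          exact h7 (heqc (by lia))
        exact hYZ (h5 this (by tauto) X h1.1 hsub)
      · have h4 := (h.low _ h1.1).1
        exact hYZ (heqc (by lia) ▸ h1.1)
      · rw [h1.2.2.2.2] at hsub hc heqc
        have := heqc (by lia)
        subst this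
        exact hY3 ⟨h1.1, h1.2.1, h1.2.2.1⟩
      · rw [h1.2.2.2.2, h2] at hc
        lia
    · intro X _ hX Y _ hY
      have := card_partnerMap_le hbc h hX
      have := card_partnerMap_le hbc h hY
      lia
  · rw [card_image_of_injOn, hF.card]
    exact (coFlip_injOn (partnerMap_injOn hab hac hbc h)).mono
      fun X hX => ne_compl_partnerMap hbc hF h hX
  · intro Y hY
    rcases hcase Y hY with ⟨h1, _⟩ | ⟨X, hX, -, rfl⟩
    · exact Or.inr (hF.hits Y h1)
    · simp only [mem_compl]
      have hlow := h.low
      have hns := h.not_subset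
      unfold Splits at hlow
      rcases partnerMap_cases (a := a) hX with h1 | h1 | h1 | h1 <;> grind
  · intro Y hY
    rcases hcase Y hY with ⟨h1, h3⟩ | ⟨X, hX, -, rfl⟩
    · have := hF.two_le Y h1
      by_contra h4
      exact (hsupp Y h3).1 (h.pair Y h1 (by lia))
    · have := card_partnerMap_le hbc h hX
      rw [card_compl]
      lia
  · intro Y hY hY3
    rcases hcase Y hY with ⟨h1, h3⟩ | ⟨X, hX, -, rfl⟩
    · have h4 := hsupp Y h3
      have h5 := hF.hits Y h1
      refine ⟨?_, fun hD => h4.1 (h.forbidden Y h1 hD)⟩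
      unfold Splits
      tauto
    · have := card_partnerMap_le hbc h hX
      rw [card_compl] at hY3
      lia

theorem compl_partner_mem_image (h : IsPartner a b c D F Z ψ) {X : Finset α} (hX : X ∈ Z) :
    (ψ X)ᶜ ∈ F.image (partnerFlip a b c Z ψ) := by
  refine mem_image.2 ⟨X, h.subset hX, ?_⟩
  simp [partnerFlip, coFlip, partnerSupp, partnerMap, hX]

theorem exists_of_compl_mem_image (hbc : b ≠ c) (h : IsPartner a b c D F Z ψ) {X : Finset α}
    (hX : #X = 4) (hXF : Xᶜ ∉ F) (hX' : Xᶜ ∈ F.image (partnerFlip a b c Z ψ)) :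
    ∃ Y ∈ Z, ψ Y = X := by
  obtain ⟨Y, hY, hYX⟩ := mem_image.1 hX'
  unfold partnerFlip coFlip at hYX
  split_ifs at hYX with h1
  · have hYX := compl_injective hYX
    have h2 : #({b, c} : Finset α) = 2 := card_pair hbc
    rcases partnerMap_cases (a := a) h1 with h3 | h3 | h3 | h3
    · exact ⟨Y, h3.1, by rw [← hYX, h3.2]⟩
    · have := (h.low _ h3.1).1
      grind
    · grind
    · grind
  · exact absurd (hYX ▸ hY) hXF

theorem mem_image_iff_of_splits (hbc : b ≠ c) (hn : 9 ≤ Fintype.card α)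
    (h : IsPartner a b c D F Z ψ) {Y : Finset α} (hY : #Y = 3) (hYs : Splits b c Y) :
    Y ∈ F.image (partnerFlip a b c Z ψ) ↔ Y ∈ F ∧ Y ∉ Z := by
  constructor
  · intro hm
    obtain ⟨X, hX, hXY⟩ := mem_image.1 hm
    unfold partnerFlip coFlip at hXY
    split_ifs at hXY with h1
    · have := card_partnerMap_le hbc h h1
      rw [← hXY, card_compl] at hY
      lia
    · subst hXY
      refine ⟨hX, fun hZ => h1 ?_⟩
      simp [partnerSupp, hZ]
  · rintro ⟨h1, h2⟩
    refine mem_image.2 ⟨Y, h1, ?_⟩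
    unfold partnerFlip coFlip
    rw [if_neg]
    simp only [partnerSupp, mem_union, mem_filter, mem_univ, true_and, mem_image]
    have := h.four
    unfold Splits at hYs
    grind

end Swap

theorem thirtytwo_mul_pow_le {k : ℕ} (hk : 77 ≤ k) : 32 * k * 8 ^ k ≤ 9 ^ k := by
  induction k, hk using Nat.le_induction with
  | base => norm_num
  | succ k hk ih =>
    have : 32 * (k + 1) * 8 ≤ 9 * (32 * k) := by lia
    calc 32 * (k + 1) * 8 ^ (k + 1) = 32 * (k + 1) * 8 * 8 ^ k := by ring
      _ ≤ 9 * (32 * k) * 8 ^ k := by gcongr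
      _ = 9 * (32 * k * 8 ^ k) := by ring
      _ ≤ 9 * 9 ^ k := by gcongr
      _ = 9 ^ (k + 1) := by ring

theorem pow_mul_choose_le {M v : ℕ} (h : 9 * M ≤ 8 * v) (k : ℕ) :
    9 ^ k * M.choose k ≤ 8 ^ k * v.choose k := by
  induction k with
  | zero => simp
  | succ k ih =>
    have h1 := Nat.choose_succ_right_eq M k
    have h2 := Nat.choose_succ_right_eq v k
    apply Nat.le_of_mul_le_mul_right _ (Nat.succ_pos k)
    calc 9 ^ (k + 1) * M.choose (k + 1) * (k + 1) = 9 ^ k * M.choose k * (9 * (M - k)) := by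
          rw [mul_assoc, h1]; ring
      _ ≤ 8 ^ k * v.choose k * (8 * (v - k)) := by
          gcongr ?_ * ?_
          lia
      _ = 8 ^ (k + 1) * v.choose (k + 1) * (k + 1) := by
          rw [mul_assoc (8 ^ (k + 1)), h2]; ring

theorem mul_choose_le_choose_pred {M v k : ℕ} (hk : 77 ≤ k) (hM : M ≤ 5 * k) (hkM : k ≤ M)
    (h : 9 * M ≤ 8 * v) : M * M.choose k ≤ v.choose (k - 1) := by
  obtain ⟨w, hw1, hw2, hwv⟩ : ∃ w, 9 * M ≤ 8 * w ∧ 4 * w ≤ 5 * M ∧ w ≤ v :=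
    ⟨(9 * M + 7) / 8, by lia, by lia, by lia⟩
  refine le_trans ?_ (Nat.choose_le_choose _ hwv)
  obtain ⟨j, rfl⟩ : ∃ j, k = j + 1 := ⟨k - 1, by lia⟩
  have h1 := pow_mul_choose_le hw1 (j + 1)
  have h2 := thirtytwo_mul_pow_le hk
  have h3 := Nat.choose_succ_right_eq w j
  have h4 : M * w ≤ 32 * (j + 1) * (j + 1) := by
    have : 4 * (M * w) ≤ 5 * (M * M) := by nlinarith
    have : M * M ≤ 5 * (j + 1) * (5 * (j + 1)) := Nat.mul_le_mul hM hM
    nlinarith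
  rw [Nat.add_sub_cancel]
  refine (Nat.mul_le_mul_left_iff (show 0 < 9 ^ (j + 1) * (j + 1) by positivity)).1 ?_
  calc 9 ^ (j + 1) * (j + 1) * (M * M.choose (j + 1))
      = M * (j + 1) * (9 ^ (j + 1) * M.choose (j + 1)) := by ring
    _ ≤ M * (j + 1) * (8 ^ (j + 1) * w.choose (j + 1)) := by gcongr
    _ = M * 8 ^ (j + 1) * (w.choose (j + 1) * (j + 1)) := by ring
    _ = M * 8 ^ (j + 1) * (w.choose j * (w - j)) := by rw [h3]
    _ ≤ M * 8 ^ (j + 1) * (w.choose j * w) := by gcongr; lia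
    _ = M * w * 8 ^ (j + 1) * w.choose j := by ring
    _ ≤ 32 * (j + 1) * (j + 1) * 8 ^ (j + 1) * w.choose j := by gcongr
    _ = 32 * (j + 1) * 8 ^ (j + 1) * ((j + 1) * w.choose j) := by ring
    _ ≤ 9 ^ (j + 1) * ((j + 1) * w.choose j) := by gcongr
    _ = 9 ^ (j + 1) * (j + 1) * w.choose j := by ring

section Heavy
variable {α : Type*} [Fintype α] [DecidableEq α] {a b c : α}

/-- The sets with two or three elements containing exactly one of `b` and `c`. -/
def lowSets (b c : α) : Finset (Finset α) := {X | 2 ≤ #X ∧ #X ≤ 3 ∧ Splits b c X}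

theorem mem_lowSets {X : Finset α} : X ∈ lowSets b c ↔ 2 ≤ #X ∧ #X ≤ 3 ∧ Splits b c X := by
  simp [lowSets]

theorem card_lowSets_le (hbc : b ≠ c) :
    #(lowSets b c) ≤ (Fintype.card α - 1) * (Fintype.card α - 2) := by
  have hc : #(univ \ {b, c} : Finset α) = Fintype.card α - 2 := by
    rw [card_sdiff_of_subset (subset_univ _), card_pair hbc, card_univ]
  have h2 : 2 ≤ Fintype.card α := by
    rw [← card_univ, ← card_pair hbc]
    exact card_le_card (subset_univ _)
  have hsub : lowSets b c ⊆ (({b, c} : Finset α) ×ˢ (powersetCard 1 (univ \ {b, c}) ∪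
      powersetCard 2 (univ \ {b, c}))).image fun p => insert p.1 p.2 := by
    intro X hX
    simp only [mem_lowSets, Splits] at hX
    simp only [mem_image, mem_product, mem_union, mem_powersetCard, mem_insert, mem_singleton]
    by_cases hb : b ∈ X
    · have hc : c ∉ X := by tauto
      have hcard := card_erase_of_mem hb
      refine ⟨(b, X.erase b), ⟨by simp, ?_⟩, insert_erase hb⟩
      have hs : X.erase b ⊆ univ \ {b, c} := by
        intro y; simp; grind
      simp only [hs, true_and, hcard]
      lia
    · have hc : c ∈ X := by tauto
      have hcard := card_erase_of_mem hc
      refine ⟨(c, X.erase c), ⟨by simp, ?_⟩, insert_erase hc⟩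
      have hs : X.erase c ⊆ univ \ {b, c} := by
        intro y; simp; grind
      simp only [hs, true_and, hcard]
      lia
  have h1 := (card_le_card hsub).trans card_image_le
  rw [card_product, card_pair hbc] at h1
  have h3 := card_union_le (powersetCard 1 (univ \ {b, c})) (powersetCard 2 (univ \ {b, c}))
  rw [card_powersetCard, card_powersetCard, hc] at h3
  obtain ⟨m, hm⟩ : ∃ m, Fintype.card α = m + 2 := ⟨_, (Nat.sub_add_cancel h2).symm⟩
  rw [hm] at h3 ⊢
  have h4 := Nat.triangle_succ m
  have h5 := Nat.choose_two_right m
  have h6 : 2 * m.choose 2 = m * (m - 1) := by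
    rw [h5]
    exact Nat.mul_div_cancel' (Nat.even_mul_pred_self m).two_dvd
  simp at h3
  rw [show m + 2 - 1 = m + 1 from rfl, show m + 2 - 2 = m from rfl]
  have h7 : m * (m - 1) + 2 * m = (m + 1) * m := by
    cases m <;> simp; ring
  lia

/-- The four-element sets containing exactly one of `b` and `c` and some triple of `H`. -/
def fourSets (b c : α) (H : Finset (Finset α)) : Finset (Finset α) :=
  {X | #X = 4 ∧ Splits b c X ∧ ∃ Y ∈ H, #Y = 3 ∧ Y ⊆ X}

theorem mem_fourSets {H : Finset (Finset α)} {X : Finset α} :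
    X ∈ fourSets b c H ↔ #X = 4 ∧ Splits b c X ∧ ∃ Y ∈ H, #Y = 3 ∧ Y ⊆ X := by
  simp [fourSets]

theorem le_card_fourSets {H : Finset (Finset α)} (hH : ∀ Y ∈ H, Splits b c Y) :
    #{Y ∈ H | #Y = 3} * (Fintype.card α - 4) ≤ #(fourSets b c H) * 3 := by
  apply card_mul_le_card_mul (fun Y X => Y ⊆ X)
  · intro Y hY
    simp only [mem_filter] at hY
    have hs := hH Y hY.1
    unfold Splits at hs
    have hcard : #(Y ∪ {b, c}) = 4 := by
      have : Y ∪ {b, c} = if b ∈ Y then insert c Y else insert b Y := by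
        ext y; split_ifs <;> simp <;> grind
      rw [this]
      split_ifs with h
      · rw [card_insert_of_notMem (by tauto)]; lia
      · rw [card_insert_of_notMem h]; lia
    have h1 : #(univ \ (Y ∪ {b, c})) = Fintype.card α - 4 := by
      rw [card_sdiff_of_subset (subset_univ _), card_univ, hcard]
    rw [← h1]
    apply card_le_card_of_injOn (fun j => insert j Y)
    · intro j hj
      simp only [coe_sdiff, Set.mem_sdiff, mem_coe, mem_univ, true_and, mem_union, mem_insert,
        mem_singleton, not_or] at hj
      simp only [mem_coe, mem_bipartiteAbove, mem_fourSets]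
      refine ⟨⟨by rw [card_insert_of_notMem hj.1, hY.2], ?_, Y, hY.1, hY.2, subset_insert _ _⟩,
        subset_insert _ _⟩
      unfold Splits
      simp only [mem_insert, Ne.symm hj.2.1, Ne.symm hj.2.2, false_or]
      exact hs
    · intro j hj i hi h
      simp only [coe_sdiff, Set.mem_sdiff, mem_coe, mem_univ, true_and, mem_union, mem_insert,
        mem_singleton, not_or] at hj hi
      have h1 : insert j Y = insert i Y := h
      have h2 : j ∈ insert i Y := h1 ▸ mem_insert_self _ _
      grind
  · intro X hX
    simp only [mem_fourSets] at hX
    have hs := hX.2.1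
    unfold Splits at hs
    have h1 : #(X \ {b, c}) = 3 := by
      have : X \ {b, c} = if b ∈ X then X.erase b else X.erase c := by
        ext y; split_ifs <;> simp <;> grind
      rw [this]
      split_ifs with h
      · rw [card_erase_of_mem h, hX.1]
      · rw [card_erase_of_mem (by tauto), hX.1]
    rw [← h1]
    refine le_trans (card_le_card ?_) (card_image_le (f := fun j => X.erase j))
    intro Y hY
    simp only [mem_bipartiteBelow, mem_filter] at hY
    have hYs := hH Y hY.1.1
    unfold Splits at hYs
    obtain ⟨j, hj, hjY⟩ := exists_mem_notMem_of_card_lt_card (show #Y < #X by lia)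
    refine mem_image.2 ⟨j, ?_, ?_⟩
    · have := @hY.2 b
      have := @hY.2 c
      simp; grind
    · symm
      apply eq_of_subset_of_card_le
      · intro y hy
        exact mem_erase.2 ⟨fun h => hjY (h ▸ hy), hY.2 hy⟩
      · rw [card_erase_of_mem hj]; lia

end Heavy

theorem exists_injOn_image_subset {A B : Type*} [DecidableEq B] [Nonempty B] {s : Finset A}
    {t : Finset B} (h : #s ≤ #t) : ∃ f : A → B, Set.InjOn f s ∧ s.image f ⊆ t := by
  classical
  obtain ⟨e⟩ := Function.Embedding.nonempty_of_card_le (α := s) (β := t) (by simpa using h)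
  refine ⟨fun x => if hx : x ∈ s then e ⟨x, hx⟩ else Classical.arbitrary B, ?_, ?_⟩
  · intro x hx y hy hxy
    simp only [mem_coe] at hx hy
    simp only [hx, hy, dif_pos] at hxy
    simpa using e.injective (Subtype.ext hxy)
  · intro y hy
    obtain ⟨x, hx, rfl⟩ := mem_image.1 hy
    simp [hx]

section Link
variable {α : Type*} [Fintype α] [DecidableEq α] {a b c : α}

/-- The pairs disjoint from `{a, b, c}`. -/
def spare (a b c : α) : Finset (Finset α) := powersetCard 2 (univ \ {a, b, c})

/-- A pair together with `b` and `c`. -/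
def quad (b c : α) (U : Finset α) : Finset α := insert b (insert c U)

theorem mem_spare {U : Finset α} : U ∈ spare a b c ↔ #U = 2 ∧ a ∉ U ∧ b ∉ U ∧ c ∉ U := by
  simp only [spare, mem_powersetCard, subset_iff, mem_sdiff, mem_univ, true_and, mem_insert,
    mem_singleton]
  grind

theorem card_quad (hbc : b ≠ c) {U : Finset α} (hU : U ∈ spare a b c) : #(quad b c U) = 4 := by
  rw [mem_spare] at hU
  unfold quad
  rw [card_insert_of_notMem (by simp [hbc, hU]), card_insert_of_notMem (by simp [hU]), hU.1]

theorem quad_injOn : Set.InjOn (quad b c) (spare a b c : Finset (Finset α)) := by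
  intro U hU V hV h
  simp only [mem_coe, mem_spare] at hU hV
  ext y
  have := congrArg (y ∈ ·) h
  simp only [quad, mem_insert, eq_iff_iff] at this
  grind

omit [Fintype α] in
theorem eq_insert_of_subset_quad {U Y : Finset α} (hU : #U = 2) (hY : #Y = 3)
    (hs : Splits b c Y) (h : Y ⊆ quad b c U) : Y = insert b U ∨ Y = insert c U := by
  unfold Splits at hs
  unfold quad at h
  by_cases hb : b ∈ Y
  · left
    apply eq_of_subset_of_card_le
    · intro y hy; have := h hy; simp only [mem_insert] at this ⊢; grind
    · have := card_insert_le b U; lia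
  · right
    apply eq_of_subset_of_card_le
    · intro y hy; have := h hy; simp only [mem_insert] at this ⊢; grind
    · have := card_insert_le c U; lia

/-- The pairs that may not serve as partners. -/
def blocked (a b c : α) (F : Finset (Finset α)) : Finset (Finset α) :=
  {U ∈ spare a b c | insert b U ∈ F ∨ insert c U ∈ F}

theorem mem_blocked {F : Finset (Finset α)} {U : Finset α} :
    U ∈ blocked a b c F ↔ U ∈ spare a b c ∧ (insert b U ∈ F ∨ insert c U ∈ F) := by
  simp [blocked]

theorem card_splits_insert (hbc : b ≠ c) {U : Finset α} (hU : U ∈ spare a b c) :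
    (#(insert b U) = 3 ∧ Splits b c (insert b U)) ∧
      #(insert c U) = 3 ∧ Splits b c (insert c U) := by
  rw [mem_spare] at hU
  refine ⟨⟨?_, ?_⟩, ?_, ?_⟩
  · rw [card_insert_of_notMem hU.2.2.1, hU.1]
  · unfold Splits; simp only [mem_insert]; grind
  · rw [card_insert_of_notMem hU.2.2.2, hU.1]
  · unfold Splits; simp only [mem_insert]; grind

variable {D F : Finset (Finset α)} {k : ℕ}

/-- The small sets of a family containing exactly one of `b` and `c`. -/
def lowPart (b c : α) (F : Finset (Finset α)) : Finset (Finset α) := {X ∈ F | #X ≤ 3 ∧ Splits b c X}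

omit [Fintype α] in
theorem mem_lowPart {X : Finset α} :
    X ∈ lowPart b c F ↔ X ∈ F ∧ #X ≤ 3 ∧ Splits b c X := by
  simp [lowPart]

theorem isPartner_inter (hab : a ≠ b) (hac : a ≠ c) (hbc : b ≠ c) (hF : IsPairLink b c D k F)
    (hD : ∀ X ∈ D, #X ≤ 3 ∧ Splits b c X) {ψ : Finset α → Finset α} (hψ : Set.InjOn ψ D)
    (hψF : D.image ψ ⊆ spare a b c \ blocked a b c (F \ D)) :
    IsPartner a b c D F (F ∩ D) fun X => quad b c (ψ X) := by
  have hm : ∀ X ∈ D, ψ X ∈ spare a b c ∧ ψ X ∉ blocked a b c (F \ D) := fun X hX => by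
    have := hψF (mem_image_of_mem ψ hX)
    rwa [mem_sdiff] at this
  refine ⟨inter_subset_left, ?_, ?_, ?_, ?_, ?_, ?_, ?_, ?_⟩
  · intro X hX Y hY h
    have hX := (mem_inter.1 hX).2
    have hY := (mem_inter.1 hY).2
    exact hψ hX hY (quad_injOn (hm X hX).1 (hm Y hY).1 h)
  · intro X hX
    exact hD X (mem_inter.1 hX).2
  · intro X hX
    exact card_quad hbc (hm X (mem_inter.1 hX).2).1
  · intro X hX
    have := mem_spare.1 (hm X (mem_inter.1 hX).2).1
    left
    simp only [quad, mem_insert]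
    grind
  · intro X hX h
    have := hF.hits _ h
    simp [quad] at this
  · intro X hX h2
    exact mem_inter.2 ⟨hX, hF.pair X hX h2⟩
  · intro X hX h
    exact mem_inter.2 ⟨hX, h⟩
  · intro Y hY h3 hs X hX hYX
    have hX := hm X (mem_inter.1 hX).2
    by_contra hYD
    have hYD : Y ∉ D := fun h => hYD (mem_inter.2 ⟨hY, h⟩)
    apply hX.2
    rw [mem_blocked]
    refine ⟨hX.1, ?_⟩
    rcases eq_insert_of_subset_quad (mem_spare.1 hX.1).1 h3 hs hYX with rfl | rfl
    · exact Or.inl (mem_sdiff.2 ⟨hY, hYD⟩)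
    · exact Or.inr (mem_sdiff.2 ⟨hY, hYD⟩)

theorem blocked_image_partnerFlip (hbc : b ≠ c) (hn : 9 ≤ Fintype.card α)
    {Z : Finset (Finset α)} {ψ : Finset α → Finset α} (h : IsPartner a b c D F Z ψ) :
    blocked a b c (F.image (partnerFlip a b c Z ψ)) = blocked a b c (F \ Z) := by
  ext U
  simp only [mem_blocked, mem_sdiff]
  refine and_congr_right fun hU => ?_
  have hs := card_splits_insert hbc hU
  rw [mem_image_iff_of_splits hbc hn h hs.1.1 hs.1.2,
    mem_image_iff_of_splits hbc hn h hs.2.1 hs.2.2]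

theorem isPartner_lowPart (hF : IsPairLink b c D k F)
    (hD : ∀ X ∈ D, #X ≤ 3 ∧ Splits b c X) {U : Finset α} (hU : U ∈ spare a b c)
    (hab : a ≠ b) (hac : a ≠ c) (hbc : b ≠ c)
    {K : Finset (Finset α)} (hK : K ⊆ fourSets b c (lowPart b c F)) {ψ : Finset α → Finset α}
    (hψ : Set.InjOn ψ (lowPart b c F))
    (hψF : (lowPart b c F).image ψ ⊆ insert (quad b c U) K) :
    IsPartner a b c D F (lowPart b c F) ψ := by
  have hm : ∀ X ∈ lowPart b c F, ψ X = quad b c U ∨ ψ X ∈ fourSets b c (lowPart b c F) :=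
    fun X hX => by
      have := hψF (mem_image_of_mem ψ hX)
      rw [mem_insert] at this
      exact this.imp_right fun h => hK h
  refine ⟨filter_subset _ _, hψ, fun X hX => (mem_lowPart.1 hX).2, ?_, ?_, ?_, ?_, ?_, ?_⟩
  · intro X hX
    rcases hm X hX with h | h
    · rw [h, card_quad hbc hU]
    · exact (mem_fourSets.1 h).1
  · intro X hX
    rcases hm X hX with h | h
    · rw [h]
      have := mem_spare.1 hU
      left
      simp only [quad, mem_insert]
      grind
    · have := (mem_fourSets.1 h).2.1
      unfold Splits at this
      tauto
  · intro X hX hc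
    rcases hm X hX with h | h
    · rw [h] at hc
      have := hF.hits _ hc
      simp [quad] at this
    · obtain ⟨-, -, Y, hY, -, hYX⟩ := mem_fourSets.1 h
      obtain ⟨y, hy⟩ := hF.meets Y (mem_lowPart.1 hY).1 _ hc
      have := @hYX y
      simp at hy
      tauto
  · intro X hX h2
    exact mem_lowPart.2 ⟨hX, hD X (hF.pair X hX h2)⟩
  · intro X hX h
    exact mem_lowPart.2 ⟨hX, hD X h⟩
  · intro Y hY h3 hs X hX hYX
    exact mem_lowPart.2 ⟨hY, h3.le, hs⟩

end Link

section Count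
variable {α : Type*} [Fintype α] [DecidableEq α] {a b c : α} {D : Finset (Finset α)} {k : ℕ}

theorem card_le_card_lowPart (hbc : b ≠ c) {F : Finset (Finset α)} :
    #(blocked a b c F) ≤ #{Y ∈ lowPart b c F | #Y = 3} := by
  classical
  refine card_le_card_of_injOn (fun U => if insert b U ∈ F then insert b U else insert c U) ?_ ?_
  · intro U hU
    obtain ⟨hU, h⟩ := mem_blocked.1 hU
    have hs := card_splits_insert hbc hU
    simp only [mem_coe, mem_filter, mem_lowPart]
    split_ifs with h1
    · exact ⟨⟨h1, hs.1.1.le, hs.1.2⟩, hs.1.1⟩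
    · exact ⟨⟨h.resolve_left h1, hs.2.1.le, hs.2.2⟩, hs.2.1⟩
  · intro U hU V hV h
    have hU := mem_spare.1 (mem_blocked.1 hU).1
    have hV := mem_spare.1 (mem_blocked.1 hV).1
    have key : U = (if insert b U ∈ F then insert b U else insert c U) \ {b, c} ∧
        V = (if insert b V ∈ F then insert b V else insert c V) \ {b, c} := by
      constructor <;> split_ifs <;> ext y <;>
        simp only [mem_sdiff, mem_insert, mem_singleton] <;> grind
    simp only at h
    rw [key.1, key.2, h]

/-- The families of the target in which every pair is available and one partner is used. -/
def IsFull (b c : α) (U : Finset α) (F : Finset (Finset α)) : Prop :=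
  (quad b c U)ᶜ ∈ F ∧ ∀ Y ∈ F, #Y = 3 → ¬ Splits b c Y

theorem isFull_partnerFlip (hbc : b ≠ c) (hn : 9 ≤ Fintype.card α)
    {F : Finset (Finset α)} {U : Finset α} {ψ : Finset α → Finset α}
    (h : IsPartner a b c D F (lowPart b c F) ψ) (hU : ∃ X ∈ lowPart b c F, ψ X = quad b c U) :
    IsFull b c U (F.image (partnerFlip a b c (lowPart b c F) ψ)) := by
  obtain ⟨X, hX, hXU⟩ := hU
  refine ⟨hXU ▸ compl_partner_mem_image h hX, fun Y hY h3 hs => ?_⟩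
  rw [mem_image_iff_of_splits hbc hn h h3 hs] at hY
  exact hY.2 (mem_lowPart.2 ⟨hY.1, h3.le, hs⟩)

open Classical in
/-- Families with a large set of blocked pairs, for a fixed small part. -/
theorem card_heavy_mul_le (hab : a ≠ b) (hac : a ≠ c) (hbc : b ≠ c) (hn : 9 ≤ Fintype.card α)
    (hD : ∀ X ∈ D, #X ≤ 3 ∧ Splits b c X) {U : Finset α} (hU : U ∈ spare a b c)
    {H : Finset (Finset α)} (hH : H.Nonempty) :
    #{F | IsPairLink b c D k F ∧ lowPart b c F = H} * (#(fourSets b c H)).choose (#H - 1) ≤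
      #{F | IsTripleLink a b c D k F ∧ IsFull b c U F} := by
  rw [← card_powersetCard, ← card_product]
  have hψ : ∀ K ∈ powersetCard (#H - 1) (fourSets b c H), ∃ ψ : Finset α → Finset α,
      Set.InjOn ψ H ∧ H.image ψ = insert (quad b c U) K := by
    intro K hK
    rw [mem_powersetCard] at hK
    have hq : quad b c U ∉ K := fun h => by
      have := (mem_fourSets.1 (hK.1 h)).2.1
      simp [Splits, quad] at this
    have hc : #(insert (quad b c U) K) = #H := by
      rw [card_insert_of_notMem hq, hK.2, Nat.sub_add_cancel hH.card_pos]
    obtain ⟨ψ, h1, h2⟩ := exists_injOn_image_subset hc.ge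
    exact ⟨ψ, h1, eq_of_subset_of_card_le h2 (by rw [card_image_of_injOn h1, hc])⟩
  choose! ψ hψ1 hψ2 using hψ
  have hpart : ∀ F K, IsPairLink b c D k F → lowPart b c F = H →
      K ∈ powersetCard (#H - 1) (fourSets b c H) → IsPartner a b c D F H (ψ K) := by
    intro F K hF hFH hK
    have := isPartner_lowPart (ψ := ψ K) hF hD hU hab hac hbc
      (hFH.symm ▸ (mem_powersetCard.1 hK).1) (hFH.symm ▸ hψ1 K hK) (hFH.symm ▸ (hψ2 K hK).subset)
    rwa [hFH] at this
  refine card_le_card_of_injOn (fun p => p.1.image (partnerFlip a b c H (ψ p.2))) ?_ ?_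
  · rintro ⟨F, K⟩ hp
    simp only [coe_product, Set.mem_prod, mem_coe, mem_filter, mem_univ, true_and] at hp ⊢
    obtain ⟨⟨hF, hFH⟩, hK⟩ := hp
    have hP := hpart F K hF hFH hK
    refine ⟨isTripleLink_partnerFlip hab hac hbc hn hF hP, ?_⟩
    have hq : quad b c U ∈ H.image (ψ K) := by rw [hψ2 K hK]; exact mem_insert_self _ _
    subst hFH
    exact isFull_partnerFlip hbc hn hP (mem_image.1 hq)
  · rintro ⟨F, K⟩ hp ⟨F', K'⟩ hp' heq
    simp only [coe_product, Set.mem_prod, mem_coe, mem_filter, mem_univ, true_and] at hp hp' heq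
    obtain ⟨⟨hF, hFH⟩, hK⟩ := hp
    obtain ⟨⟨hF', hFH'⟩, hK'⟩ := hp'
    have decode : ∀ F K, IsPairLink b c D k F → lowPart b c F = H →
        K ∈ powersetCard (#H - 1) (fourSets b c H) →
        K = {X ∈ fourSets b c H | Xᶜ ∈ F.image (partnerFlip a b c H (ψ K))} := by
      intro F K hF hFH hK
      have hP := hpart F K hF hFH hK
      ext X
      rw [mem_filter]
      constructor
      · intro hX
        refine ⟨(mem_powersetCard.1 hK).1 hX, ?_⟩
        obtain ⟨Y, hY, rfl⟩ := mem_image.1 ((hψ2 K hK).symm ▸ mem_insert_of_mem hX :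
          X ∈ H.image (ψ K))
        exact compl_partner_mem_image hP hY
      · rintro ⟨hX, hXF⟩
        have hX' := mem_fourSets.1 hX
        obtain ⟨Y, hY, hYX⟩ := exists_of_compl_mem_image hbc hP hX'.1 (by
          intro hc
          obtain ⟨-, -, Y, hY, -, hYX⟩ := hX'
          obtain ⟨y, hy⟩ := hF.meets Y (mem_lowPart.1 (hFH.symm ▸ hY)).1 _ hc
          have := @hYX y
          simp at hy
          tauto) hXF
        have : X ∈ insert (quad b c U) K := by
          rw [← hψ2 K hK, ← hYX]
          exact mem_image_of_mem _ hY
        refine (mem_insert.1 this).resolve_left ?_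
        rintro rfl
        have := hX'.2.1
        simp [Splits, quad] at this
    have hKK : K = K' := by
      rw [decode F K hF hFH hK, decode F' K' hF' hFH' hK', heq]
    subst hKK
    exact Prod.ext (partnerFlip_injOn hab hac hbc hF hF' (hpart F K hF hFH hK)
      (hpart F' K hF' hFH' hK) heq) rfl

open Classical in
/-- Families with few blocked pairs. -/
theorem card_light_le (hab : a ≠ b) (hac : a ≠ c) (hbc : b ≠ c) (hn : 9 ≤ Fintype.card α)
    (hD : ∀ X ∈ D, #X ≤ 3 ∧ Splits b c X) (hDN : #D < #(spare a b c)) :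
    ∃ U ∈ spare a b c,
      #{F | IsPairLink b c D k F ∧ #(blocked a b c (F \ D)) + #D ≤ #(spare a b c)} ≤
        #{F | IsTripleLink a b c D k F ∧ ¬ IsFull b c U F} := by
  have hψ : ∀ O : Finset (Finset α), O ⊆ spare a b c ∧ #O + #D ≤ #(spare a b c) →
      ∃ ψ : Finset α → Finset α, Set.InjOn ψ D ∧ D.image ψ ⊆ spare a b c \ O := by
    rintro O ⟨hO, hc⟩
    apply exists_injOn_image_subset
    rw [card_sdiff_of_subset hO]
    lia
  choose! ψ hψ1 hψ2 using hψ
  obtain ⟨U, hU, hUψ⟩ : ∃ U ∈ spare a b c, U ∉ D.image (ψ ∅) :=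
    exists_mem_notMem_of_card_lt_card (card_image_le.trans_lt hDN)
  refine ⟨U, hU, ?_⟩
  have hbl : ∀ F, #(blocked a b c (F \ D)) + #D ≤ #(spare a b c) →
      blocked a b c (F \ D) ⊆ spare a b c ∧ #(blocked a b c (F \ D)) + #D ≤ #(spare a b c) :=
    fun F h => ⟨filter_subset _ _, h⟩
  have hpart : ∀ F, IsPairLink b c D k F → #(blocked a b c (F \ D)) + #D ≤ #(spare a b c) →
      IsPartner a b c D F (F ∩ D) fun X => quad b c (ψ (blocked a b c (F \ D)) X) :=
    fun F hF h => isPartner_inter hab hac hbc hF hD (hψ1 _ (hbl F h)) (hψ2 _ (hbl F h))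
  let Φ : Finset (Finset α) → Finset (Finset α) := fun F => F.image
    (partnerFlip a b c (F ∩ D) fun X => quad b c (ψ (blocked a b c (F \ D)) X))
  have hΦ : ∀ F, IsPairLink b c D k F → #(blocked a b c (F \ D)) + #D ≤ #(spare a b c) →
      blocked a b c (Φ F) = blocked a b c (F \ D) := by
    intro F hF h
    rw [blocked_image_partnerFlip hbc hn (hpart F hF h), sdiff_inter_self_left]
  have hused : ∀ F, IsPairLink b c D k F → #(blocked a b c (F \ D)) + #D ≤ #(spare a b c) →
      ∀ V ∈ spare a b c, (quad b c V)ᶜ ∈ Φ F →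
        ∃ Y ∈ F ∩ D, ψ (blocked a b c (F \ D)) Y = V := by
    intro F hF h V hV hm
    obtain ⟨Y, hY, hYV⟩ := exists_of_compl_mem_image hbc (hpart F hF h) (card_quad hbc hV) (by
      intro hc
      have := hF.hits _ hc
      simp [quad] at this) hm
    refine ⟨Y, hY, quad_injOn ?_ hV hYV⟩
    have := hψ2 _ (hbl F h) (mem_image_of_mem _ (mem_inter.1 hY).2)
    exact (mem_sdiff.1 this).1
  refine card_le_card_of_injOn Φ ?_ ?_
  · intro F hF
    simp only [mem_coe, mem_filter, mem_univ, true_and] at hF ⊢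
    obtain ⟨hF, hl⟩ := hF
    refine ⟨isTripleLink_partnerFlip hab hac hbc hn hF (hpart F hF hl), ?_⟩
    rintro ⟨h1, h2⟩
    have h0 : blocked a b c (F \ D) = ∅ := by
      rw [← hΦ F hF hl]
      refine eq_empty_of_forall_notMem fun V hV => ?_
      obtain ⟨hV, h⟩ := mem_blocked.1 hV
      have hs := card_splits_insert hbc hV
      rcases h with h | h
      · exact h2 _ h hs.1.1 hs.1.2
      · exact h2 _ h hs.2.1 hs.2.2
    obtain ⟨Y, hY, hYU⟩ := hused F hF hl U hU h1
    rw [h0] at hYU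
    exact hUψ (mem_image.2 ⟨Y, (mem_inter.1 hY).2, hYU⟩)
  · intro F hF F' hF' heq
    simp only [mem_coe, mem_filter, mem_univ, true_and] at hF hF'
    obtain ⟨hF, hl⟩ := hF
    obtain ⟨hF', hl'⟩ := hF'
    have hO : blocked a b c (F \ D) = blocked a b c (F' \ D) := by
      rw [← hΦ F hF hl, ← hΦ F' hF' hl', heq]
    have hsub : ∀ F F', IsPairLink b c D k F →
        #(blocked a b c (F \ D)) + #D ≤ #(spare a b c) → IsPairLink b c D k F' →
        #(blocked a b c (F' \ D)) + #D ≤ #(spare a b c) → Φ F = Φ F' →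
        blocked a b c (F \ D) = blocked a b c (F' \ D) → F ∩ D ⊆ F' ∩ D := by
      intro F F' hF hl hF' hl' heq hO X hX
      have hXD := (mem_inter.1 hX).2
      have h1 := compl_partner_mem_image (hpart F hF hl) hX
      change _ ∈ Φ F at h1
      have hs := (mem_sdiff.1 (hψ2 _ (hbl F hl) (mem_image_of_mem _ hXD))).1
      rw [heq] at h1
      obtain ⟨Y, hY, hYX⟩ := hused F' hF' hl' _ hs h1
      rw [hO] at hYX
      have := hψ1 _ (hbl F' hl') (mem_inter.1 hY).2 hXD hYX
      exact this ▸ hY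
    have hZ : F ∩ D = F' ∩ D := Subset.antisymm (hsub F F' hF hl hF' hl' heq hO)
      (hsub F' F hF' hl' hF hl heq.symm hO.symm)
    have hP := hpart F hF hl
    have hP' := hpart F' hF' hl'
    simp only [Φ] at heq
    rw [← hO, ← hZ] at hP' heq
    exact partnerFlip_injOn hab hac hbc hF hF' hP hP' heq

end Count

section Link
variable {α : Type*} [Fintype α] [DecidableEq α] {a b c : α} {D : Finset (Finset α)} {k : ℕ}

theorem card_spare (hab : a ≠ b) (hac : a ≠ c) (hbc : b ≠ c) :
    #(spare a b c) = (Fintype.card α - 3).choose 2 := by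
  rw [spare, card_powersetCard, card_sdiff_of_subset (subset_univ _), card_univ,
    card_eq_three.2 ⟨a, b, c, hab, hac, hbc, rfl⟩]

theorem two_mul_choose_two (m : ℕ) : 2 * m.choose 2 = m * (m - 1) := by
  rw [Nat.choose_two_right]
  exact Nat.mul_div_cancel' (Nat.even_mul_pred_self m).two_dvd

theorem mul_choose_le_choose_fourSets (hab : a ≠ b) (hac : a ≠ c) (hbc : b ≠ c)
    (hn : 21 ≤ Fintype.card α) {F : Finset (Finset α)} (hF : IsPairLink b c D k F)
    (hDN : 2 * #D ≤ #(spare a b c)) (h : #(spare a b c) < #(blocked a b c (F \ D)) + #D) :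
    (lowPart b c F).Nonempty ∧ lowPart b c F ⊆ lowSets b c ∧
    #(lowSets b c) * (#(lowSets b c)).choose (#(lowPart b c F)) ≤
      (#(fourSets b c (lowPart b c F))).choose (#(lowPart b c F) - 1) := by
  have hsub : lowPart b c F ⊆ lowSets b c := by
    intro X hX
    rw [mem_lowPart] at hX
    exact mem_lowSets.2 ⟨hF.two_le X hX.1, hX.2⟩
  have h1 := card_le_card_lowPart (a := a) hbc (F := F)
  have h2 : #(blocked a b c (F \ D)) ≤ #(blocked a b c F) := by
    refine card_le_card fun U hU => ?_
    rw [mem_blocked] at hU ⊢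
    exact ⟨hU.1, hU.2.imp (fun h => (mem_sdiff.1 h).1) fun h => (mem_sdiff.1 h).1⟩
  have h3 := card_le_card (filter_subset (fun Y => #Y = 3) (lowPart b c F))
  have h4 := card_lowSets_le hbc
  have h5 := le_card_fourSets (H := lowPart b c F) fun Y hY => (mem_lowPart.1 hY).2.2
  have h6 := two_mul_choose_two (Fintype.card α - 3)
  rw [← card_spare hab hac hbc] at h6
  generalize #(spare a b c) = N at *
  generalize #{Y ∈ lowPart b c F | #Y = 3} = t at *
  have hNt : N + 1 ≤ 2 * t := by lia
  obtain ⟨m, hm⟩ : ∃ m, Fintype.card α = m + 21 := ⟨_, (Nat.sub_add_cancel hn).symm⟩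
  rw [hm, show m + 21 - 3 = m + 18 by lia, show m + 18 - 1 = m + 17 by lia] at h6
  rw [hm, show m + 21 - 1 = m + 20 by lia, show m + 21 - 2 = m + 19 by lia] at h4
  rw [hm, show m + 21 - 4 = m + 17 by lia] at h5
  refine ⟨card_pos.1 (by lia), hsub, mul_choose_le_choose_pred ?_ ?_ (card_le_card hsub) ?_⟩
  · nlinarith
  · nlinarith
  · nlinarith [Nat.mul_le_mul_right (m + 17) hNt]

open Classical in
theorem card_isPairLink_le_card_isTripleLink (hab : a ≠ b) (hac : a ≠ c) (hbc : b ≠ c)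
    (hn : 21 ≤ Fintype.card α) (hD : ∀ X ∈ D, #X ≤ 3 ∧ Splits b c X)
    (hDN : 2 * #D ≤ (Fintype.card α - 3).choose 2) :
    #{F | IsPairLink b c D k F} ≤ #{F | IsTripleLink a b c D k F} := by
  have hN := card_spare hab hac hbc
  have hN0 : 0 < #(spare a b c) := hN ▸ Nat.choose_pos (by lia)
  rw [← hN] at hDN
  obtain ⟨U, hU, hlight⟩ := card_light_le (k := k) hab hac hbc (by lia) hD (by lia)
  set M := #(lowSets b c)
  set light : Finset (Finset α) → Prop := fun F =>
    #(blocked a b c (F \ D)) + #D ≤ #(spare a b c)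
  set R := #{F | IsTripleLink a b c D k F ∧ IsFull b c U F}
  set heavy : Finset (Finset (Finset α)) := {F | IsPairLink b c D k F ∧ ¬ light F}
  have hprop : ∀ F ∈ heavy, _ := fun F hF =>
    mul_choose_le_choose_fourSets hab hac hbc hn (mem_filter.1 hF).2.1 hDN
      (not_le.1 (mem_filter.1 hF).2.2)
  have hfix : ∀ H, #{F ∈ heavy | lowPart b c F = H} * (M * M.choose #H) ≤ R := by
    intro H
    rcases eq_empty_or_nonempty {F ∈ heavy | lowPart b c F = H} with h | ⟨F, hF⟩
    · simp [h]
    · obtain ⟨hFh, rfl⟩ := mem_filter.1 hF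
      obtain ⟨h1, -, h2⟩ := hprop F hFh
      refine (Nat.mul_le_mul ?_ h2).trans (card_heavy_mul_le hab hac hbc (by lia) hD hU h1)
      refine card_le_card fun F hF => ?_
      simp only [heavy, mem_filter, mem_univ, true_and] at hF ⊢
      exact ⟨hF.1.1, hF.2⟩
  have hlevel : ∀ j ∈ Icc 1 M, #{F ∈ heavy | #(lowPart b c F) = j} * M ≤ R := by
    intro j hj
    have hpos : 0 < M.choose j := Nat.choose_pos (mem_Icc.1 hj).2
    have hfib := card_eq_sum_card_fiberwise (s := {F ∈ heavy | #(lowPart b c F) = j})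
      (t := powersetCard j (lowSets b c)) (f := lowPart b c) (by
        intro F hF
        simp only [mem_coe, mem_filter, mem_powersetCard] at hF ⊢
        exact ⟨(hprop F hF.1).2.1, hF.2⟩)
    refine Nat.le_of_mul_le_mul_right ?_ hpos
    rw [mul_assoc, hfib, sum_mul]
    calc _ ≤ ∑ _H ∈ powersetCard j (lowSets b c), R := by
          refine sum_le_sum fun H hH => ?_
          refine le_trans (Nat.mul_le_mul_right _ (card_le_card ?_))
            ((mem_powersetCard.1 hH).2 ▸ hfix H)
          intro F hF
          simp only [mem_filter] at hF ⊢
          exact ⟨hF.1.1, hF.2⟩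
      _ = R * M.choose j := by
          rw [sum_const, card_powersetCard, smul_eq_mul, mul_comm]
  have hheavy : #heavy ≤ R := by
    rcases Nat.eq_zero_or_pos M with h0 | hpos
    · rcases eq_empty_or_nonempty heavy with h | ⟨F, hF⟩
      · simp [h]
      · obtain ⟨h1, h2, -⟩ := hprop F hF
        have := card_le_card h2
        have := h1.card_pos
        lia
    · have hfib := card_eq_sum_card_fiberwise (s := heavy) (t := Icc 1 M)
        (f := fun F => #(lowPart b c F)) (by
          intro F hF
          obtain ⟨h1, h2, -⟩ := hprop F hF
          exact mem_coe.2 (mem_Icc.2 ⟨h1.card_pos, card_le_card h2⟩))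
      refine Nat.le_of_mul_le_mul_right ?_ hpos
      rw [hfib, sum_mul]
      calc _ ≤ ∑ _j ∈ Icc 1 M, R := sum_le_sum hlevel
        _ = R * M := by simp [mul_comm]
  have e1 := card_filter_add_card_filter_not (s := {F | IsPairLink b c D k F}) light
  have e2 := card_filter_add_card_filter_not (s := {F | IsTripleLink a b c D k F}) (IsFull b c U)
  rw [filter_filter, filter_filter] at e1 e2
  rw [← e1, ← e2, add_comm]
  exact Nat.add_le_add hheavy hlight

end Link

section Relabel
variable {α : Type*} [DecidableEq α]

/-- The image of a family under a permutation of the ground set. -/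
def relabel (σ : Equiv.Perm α) (F : Finset (Finset α)) : Finset (Finset α) :=
  F.map (mapEmbedding σ.toEmbedding).toEmbedding

omit [DecidableEq α] in
theorem mem_relabel {σ : Equiv.Perm α} {F : Finset (Finset α)} {Y : Finset α} :
    Y ∈ relabel σ F ↔ ∃ X ∈ F, X.map σ.toEmbedding = Y := by
  simp [relabel]

omit [DecidableEq α] in
theorem card_relabel (σ : Equiv.Perm α) (F : Finset (Finset α)) : #(relabel σ F) = #F :=
  card_map _

omit [DecidableEq α] in
theorem relabel_injective (σ : Equiv.Perm α) : Function.Injective (relabel σ) :=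
  map_injective _

theorem Meets.relabel {F : Finset (Finset α)} (hF : Meets F) (σ : Equiv.Perm α) :
    Meets (relabel σ F) := by
  intro Y hY Y' hY'
  obtain ⟨X, hX, rfl⟩ := mem_relabel.1 hY
  obtain ⟨X', hX', rfl⟩ := mem_relabel.1 hY'
  rw [← map_inter, map_nonempty]
  exact hF X hX X' hX'

end Relabel

section Exchange
variable {α : Type*} [Fintype α] [DecidableEq α]

/-- The pairs of `A` sharing exactly one element with `{u, w}`. -/
def touching (u w : α) (A : Finset (Finset α)) : Finset (Finset α) :=
  {X ∈ edgesOf A | Splits u w X}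

omit [Fintype α] in
theorem mem_touching {u w : α} {A : Finset (Finset α)} {X : Finset α} :
    X ∈ touching u w A ↔ X ∈ A ∧ #X = 2 ∧ Splits u w X := by
  simp [touching, edgesOf, and_assoc]

omit [Fintype α] in
theorem card_touching_le {u w : α} (huw : u ≠ w) {A : Finset (Finset α)}
    (he : {u, w} ∈ edgesOf A) : #(touching u w A) ≤ 2 * (#(edgeSupp A) - 2) := by
  have hs : {u, w} ⊆ edgeSupp A := subset_biUnion_of_mem id he
  have hsub : touching u w A ⊆ (({u, w} : Finset α) ×ˢ (edgeSupp A \ {u, w})).image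
      fun p => {p.1, p.2} := by
    intro X hX
    obtain ⟨hXA, hX2, hs⟩ := mem_touching.1 hX
    have hXs : X ⊆ edgeSupp A := subset_biUnion_of_mem id (mem_filter.2 ⟨hXA, hX2⟩ : X ∈ edgesOf A)
    obtain ⟨x, y, hxy, rfl⟩ := card_eq_two.1 hX2
    have h1 := hXs (mem_insert_self x {y})
    have h2 := hXs (mem_insert_of_mem (mem_singleton_self y))
    simp only [mem_image, mem_product, mem_sdiff, mem_insert, mem_singleton, Prod.exists]
    simp only [Splits, mem_insert, mem_singleton] at hs
    by_cases hx : x = u ∨ x = w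
    · exact ⟨x, y, ⟨hx, h2, by grind⟩, rfl⟩
    · exact ⟨y, x, ⟨by grind, h1, hx⟩, pair_comm y x⟩
  have := (card_le_card hsub).trans card_image_le
  rwa [card_product, card_pair huw, card_sdiff_of_subset hs, card_pair huw] at this

omit [Fintype α] in
theorem card_triples_le {b c : α} (hbc : b ≠ c) {Q : Finset α} (hb : b ∈ Q) (hc : c ∈ Q) :
    #{X ∈ powersetCard 3 Q | Splits b c X} ≤ (#Q - 2) * (#Q - 3) := by
  have hs : {b, c} ⊆ Q := by simp [insert_subset_iff, hb, hc]
  have hsub : {X ∈ powersetCard 3 Q | Splits b c X} ⊆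
      (({b, c} : Finset α) ×ˢ powersetCard 2 (Q \ {b, c})).image fun p => insert p.1 p.2 := by
    intro X hX
    simp only [mem_filter, mem_powersetCard] at hX
    obtain ⟨⟨hXQ, h3⟩, hX⟩ := hX
    unfold Splits at hX
    simp only [mem_image, mem_product, mem_powersetCard, mem_insert, mem_singleton, Prod.exists]
    by_cases hbX : b ∈ X
    · refine ⟨b, X.erase b, ⟨by simp, ?_, by rw [card_erase_of_mem hbX, h3]⟩, insert_erase hbX⟩
      intro y hy
      simp only [mem_sdiff, mem_insert, mem_singleton]
      grind
    · have hcX : c ∈ X := by tauto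
      refine ⟨c, X.erase c, ⟨by simp, ?_, by rw [card_erase_of_mem hcX, h3]⟩, insert_erase hcX⟩
      intro y hy
      simp only [mem_sdiff, mem_insert, mem_singleton]
      grind
  have := (card_le_card hsub).trans card_image_le
  rw [card_product, card_pair hbc, card_powersetCard, card_sdiff_of_subset hs, card_pair hbc,
    two_mul_choose_two] at this
  exact this

theorem card_meetFams_le_compr_pair {A : Finset (Finset α)} {a b c u w : α} {s : ℕ} (hs : 1 ≤ s)
    (hn : 21 ≤ Fintype.card α) (h2 : ∀ X ∈ A, 2 ≤ #X) (hA : ∀ X, 4 ≤ #X → X ∈ A)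
    (huw : u ≠ w) (he : {u, w} ∈ A) (hab : a ≠ b) (hac : a ≠ c) (hbc : b ≠ c)
    (hB : {a, b, c} ∉ A) (huc : u ≠ c)
    (hD : 2 * (#(touching u w A) + #{X ∈ missing A | Splits b c X}) ≤
      (Fintype.card α - 3).choose 2) (hm : ∀ X ∈ missing A, #X = 3) :
    #(meetFams s A) ≤ #(meetFams s (compr {{u, w}} (fun _ => {a, b, c}) A)) := by
  classical
  set e : Finset α := {u, w} with he_def
  set B : Finset α := {a, b, c} with hB_def
  have hmemc : ∀ X, X ∈ compr {e} (fun _ => B) A ↔ (X ∈ A ∧ X ≠ e) ∨ X = B := by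
    intro X
    simp only [compr, mem_union, mem_filter, mem_singleton, hB, imp_false, mem_image, mem_inter]
    refine or_congr Iff.rfl ⟨?_, ?_⟩
    · rintro ⟨Y, -, rfl⟩; rfl
    · rintro rfl; exact ⟨e, ⟨he, rfl⟩, rfl⟩
  set A' := compr {e} (fun _ => B) A
  let σ : Equiv.Perm α := Equiv.swap u b * Equiv.swap w c
  have hσu : σ u = b := by
    simp [σ, Equiv.swap_apply_of_ne_of_ne huw huc]
  have hσw : σ w = c := by
    simp [σ, Equiv.swap_apply_of_ne_of_ne huc.symm hbc.symm]
  have hσ : ∀ X : Finset α, (b ∈ X.map σ.toEmbedding ↔ u ∈ X) ∧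
      (c ∈ X.map σ.toEmbedding ↔ w ∈ X) := by
    intro X
    rw [← hσu, ← hσw]
    constructor
    · exact mem_map' σ.toEmbedding
    · exact mem_map' σ.toEmbedding
  let D := relabel σ (touching u w A) ∪ {X ∈ missing A | Splits b c X}
  have hDs : ∀ X ∈ D, #X ≤ 3 ∧ Splits b c X := by
    intro X hX
    rcases mem_union.1 hX with h | h
    · obtain ⟨Y, hY, rfl⟩ := mem_relabel.1 h
      obtain ⟨-, hY2, hYs⟩ := mem_touching.1 hY
      unfold Splits at hYs ⊢
      rw [card_map, (hσ Y).1, (hσ Y).2]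
      exact ⟨by lia, hYs⟩
    · rw [mem_filter] at h
      exact ⟨(hm X h.1).le, h.2⟩
  have hDc : 2 * #D ≤ (Fintype.card α - 3).choose 2 := by
    have := card_union_le (relabel σ (touching u w A)) {X ∈ missing A | Splits b c X}
    rw [card_relabel] at this
    change #D ≤ _ at this
    lia
  have key := card_isPairLink_le_card_isTripleLink (k := s - 1) hab hac hbc hn hDs hDc
  have h1 : #{F ∈ meetFams s A | e ∈ F} ≤ #{F | IsPairLink b c D (s - 1) F} := by
    refine card_le_card_of_injOn (fun F => relabel σ (F.erase e)) ?_ ?_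
    · intro F hF
      simp only [mem_coe, mem_filter, mem_meetFams, mem_univ, true_and] at hF ⊢
      obtain ⟨⟨hFA, hFs, hFm⟩, heF⟩ := hF
      have hhit : ∀ X ∈ F, u ∈ X ∨ w ∈ X := by
        intro X hX
        obtain ⟨y, hy⟩ := hFm X hX e heF
        simp only [he_def, mem_inter, mem_insert, mem_singleton] at hy
        grind
      have hmap : e.map σ.toEmbedding = {b, c} := by
        simp [he_def, map_insert, hσu, hσw]
      refine ⟨Meets.relabel (fun X hX Y hY => hFm X (mem_of_mem_erase hX) Y (mem_of_mem_erase hY)) σ,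
        by rw [card_relabel, card_erase_of_mem heF, hFs], ?_, ?_, ?_, ?_⟩
      · intro Y hY
        obtain ⟨X, hX, rfl⟩ := mem_relabel.1 hY
        rw [(hσ X).1, (hσ X).2]
        exact hhit X (mem_of_mem_erase hX)
      · intro Y hY
        obtain ⟨X, hX, rfl⟩ := mem_relabel.1 hY
        rw [← hmap]
        exact fun h => ne_of_mem_erase hX (map_injective _ h)
      · intro Y hY
        obtain ⟨X, hX, rfl⟩ := mem_relabel.1 hY
        rw [card_map]
        exact h2 X (hFA (mem_of_mem_erase hX))
      · intro Y hY hY2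
        obtain ⟨X, hX, rfl⟩ := mem_relabel.1 hY
        rw [card_map] at hY2
        refine mem_union_left _ (mem_relabel.2 ⟨X, mem_touching.2
          ⟨hFA (mem_of_mem_erase hX), hY2, ?_⟩, rfl⟩)
        have h1 := hhit X (mem_of_mem_erase hX)
        intro h
        refine ne_of_mem_erase hX (eq_of_subset_of_card_le ?_ ?_).symm
        · rw [he_def, insert_subset_iff, singleton_subset_iff]; tauto
        · rw [he_def, card_pair huw]; lia
    · intro F hF F' hF' heq
      have := relabel_injective σ heq
      rw [mem_coe, mem_filter] at hF hF'
      rw [← insert_erase hF.2, ← insert_erase hF'.2, this]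
  have hB3 : #B = 3 := card_eq_three.2 ⟨a, b, c, hab, hac, hbc, rfl⟩
  have hnB : ∀ F, IsTripleLink a b c D (s - 1) F → B ∉ F := by
    intro F hF hBF
    have := (hF.triple B hBF hB3).1
    simp [Splits, hB_def] at this
  have h3 : #{F | IsTripleLink a b c D (s - 1) F} ≤ #{F ∈ meetFams s A' | B ∈ F} := by
    refine card_le_card_of_injOn (fun F => insert B F) ?_ ?_
    · intro F hF
      simp only [mem_coe, mem_filter, mem_meetFams, mem_univ, true_and] at hF ⊢
      have hhit : ∀ X ∈ F, (X ∩ B).Nonempty := by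
        intro X hX
        rcases hF.hits X hX with h | h | h
        · exact ⟨a, by simp [hB_def, h]⟩
        · exact ⟨b, by simp [hB_def, h]⟩
        · exact ⟨c, by simp [hB_def, h]⟩
      have hBB : (B ∩ B).Nonempty := ⟨a, by simp [hB_def]⟩
      refine ⟨⟨?_, ?_, ?_⟩, mem_insert_self _ _⟩
      · intro X hX
        rw [hmemc]
        rcases mem_insert.1 hX with rfl | hX
        · exact Or.inr rfl
        · have hX3 := hF.three_le X hX
          refine Or.inl ⟨?_, ?_⟩
          · rcases hX3.eq_or_lt with h | h
            · obtain ⟨h4, h5⟩ := hF.triple X hX h.symm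
              by_contra hXA
              refine h5 (mem_union_right _ (mem_filter.2 ⟨?_, h4⟩))
              simp [missing, bigSets, hXA, hX3]
            · exact hA X h
          · rintro rfl
            rw [he_def, card_pair huw] at hX3
            lia
      · rw [card_insert_of_notMem (hnB F hF), hF.card]
        lia
      · intro X hX Y hY
        rcases mem_insert.1 hX with rfl | hX <;> rcases mem_insert.1 hY with rfl | hY
        · exact hBB
        · rw [inter_comm]; exact hhit Y hY
        · exact hhit X hX
        · exact hF.meets X hX Y hY
    · intro F hF F' hF' heq
      simp only [mem_coe, mem_filter, mem_univ, true_and] at hF hF'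
      simp only at heq
      rw [← erase_insert (hnB F hF), ← erase_insert (hnB F' hF'), heq]
  have h4 : #{F ∈ meetFams s A | e ∉ F} ≤ #{F ∈ meetFams s A' | B ∉ F} := by
    refine card_le_card fun F hF => ?_
    simp only [mem_filter, mem_meetFams] at hF ⊢
    refine ⟨⟨fun X hX => ?_, hF.1.2⟩, fun h => hB (hF.1.1 h)⟩
    rw [hmemc]
    exact Or.inl ⟨hF.1.1 hX, fun h => hF.2 (h ▸ hX)⟩
  rw [← card_filter_add_card_filter_not (s := meetFams s A) (fun F => e ∈ F),
    ← card_filter_add_card_filter_not (s := meetFams s A') (fun F => B ∈ F)]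
  exact Nat.add_le_add (h1.trans (key.trans h3)) h4

end Exchange

section Missing
variable {α : Type*} [Fintype α] [DecidableEq α]

theorem IsStablePair.missing_right_eq_empty {s : ℕ} {A A' : Finset (Finset α)}
    (h : IsStablePair s A A') (hn : 21 ≤ Fintype.card α)
    (hc : #A' = #(bigSets α) + (Fintype.card α - 1).choose 2) : missing A' = ∅ := by
  obtain ⟨-, hA⟩ := h.isClosedFam
  have h2 : ∀ X ∈ A', 2 ≤ #X := fun X => card_le_one_notMem hA hc.le (by lia)
  have hadd := card_add_card_missing h2
  have hpos : 0 < (Fintype.card α - 1).choose 2 := Nat.choose_pos (by lia)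
  have hne : (edgesOf A').Nonempty := card_pos.1 (by lia)
  rw [eq_empty_iff_forall_notMem]
  intro X hX
  obtain ⟨h3, hd⟩ := hA.of_mem_missing hne hX
  have hle := card_edgesOf_le A'
  have h5 := card_union_of_disjoint hd
  have h6 := card_le_univ (X ∪ edgeSupp A')
  have h7 : (#(edgeSupp A')).choose 2 ≤ (Fintype.card α - 1).choose 2 :=
    Nat.choose_le_choose 2 (by lia)
  have h8 := card_pos.2 ⟨X, hX⟩
  lia

theorem exchange_bound {n p q t d₂ d₃ : ℕ} (hn : 21 ≤ n) (hpq : p + q = n) (hq : 3 ≤ q)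
    (hp : 2 ≤ p) (h2 : d₂ ≤ 2 * (p - 2)) (h3 : d₃ ≤ (q - 2) * (q - 3)) (ht : d₃ + 1 ≤ t)
    (hG : n - 1 + t ≤ p.choose 2) : 2 * (d₂ + d₃) ≤ (n - 3).choose 2 := by
  have e1 := two_mul_choose_two p
  have e2 := two_mul_choose_two (n - 3)
  subst hpq
  obtain ⟨x, rfl⟩ : ∃ x, p = x + 2 := ⟨p - 2, by lia⟩
  obtain ⟨y, rfl⟩ : ∃ y, q = y + 3 := ⟨q - 3, by lia⟩
  rw [show x + 2 - 1 = x + 1 by lia] at e1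
  rw [show x + 2 + (y + 3) - 3 = x + y + 2 by lia, show x + y + 2 - 1 = x + y + 1 by lia] at e2
  rw [show x + 2 - 2 = x by lia] at h2
  rw [show y + 3 - 2 = y + 1 by lia, show y + 3 - 3 = y by lia] at h3
  have hs : 4 * (d₂ + d₃) ≤ (x + y + 2) * (x + y + 1) := by
    by_cases hc : 2 * x ≤ 3 * y + 5
    · have : 2 * (x + y + 4 + d₃ + 1) ≤ (x + 2) * (x + 1) := by lia
      nlinarith [mul_nonneg (show (0:ℤ) ≤ 3 * y + 5 - 2 * x by lia)
        (show (0:ℤ) ≤ x by lia)]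
    · nlinarith
  lia

theorem le_choose_two {m : ℕ} (hm : 3 ≤ m) : m ≤ m.choose 2 := by
  have := two_mul_choose_two m
  obtain ⟨k, rfl⟩ : ∃ k, m = k + 3 := ⟨_, (Nat.sub_add_cancel hm).symm⟩
  rw [show k + 3 - 1 = k + 2 by lia] at this
  nlinarith

theorem IsStablePair.missing_left_eq_empty {s : ℕ} {A A' : Finset (Finset α)} (hs : 1 ≤ s)
    (h : IsStablePair s A A') (hn : 21 ≤ Fintype.card α)
    (hc : #A = #(bigSets α) + (Fintype.card α - 1)) (hA' : missing A' = ∅) : missing A = ∅ := by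
  obtain ⟨hA, -⟩ := h.isClosedFam
  have hle : Fintype.card α - 1 ≤ (Fintype.card α - 1).choose 2 := le_choose_two (by lia)
  have h2 : ∀ X ∈ A, 2 ≤ #X := fun X => card_le_one_notMem hA (by lia) (by lia)
  have hadd := card_add_card_missing h2
  have hne : (edgesOf A).Nonempty := card_pos.1 (by lia)
  by_contra hmis
  obtain ⟨B, hB⟩ := nonempty_iff_ne_empty.2 hmis
  obtain ⟨h3, hd⟩ := hA.of_mem_missing hne hB
  obtain ⟨e, he⟩ := hne
  have he' := mem_filter.1 he
  have hes : e ⊆ edgeSupp A := subset_biUnion_of_mem id he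
  obtain ⟨u, w, huw, rfl⟩ := card_eq_two.1 he'.2
  obtain ⟨a, b, c, hab, hac, hbc, rfl⟩ := card_eq_three.1 h3
  have hBA : ({a, b, c} : Finset α) ∉ A := (mem_sdiff.1 hB).2
  have hBA' : ({a, b, c} : Finset α) ∈ A' := by
    by_contra hc
    have : ({a, b, c} : Finset α) ∈ missing A' := mem_sdiff.2 ⟨(mem_sdiff.1 hB).1, hc⟩
    simp [hA'] at this
  have hus : u ∈ edgeSupp A := hes (by simp)
  have huc : u ≠ c := by
    rintro rfl
    exact disjoint_left.1 hd (by simp) hus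
  have hbQ : b ∈ (edgeSupp A)ᶜ := mem_compl.2 (disjoint_left.1 hd (by simp))
  have hcQ : c ∈ (edgeSupp A)ᶜ := mem_compl.2 (disjoint_left.1 hd (by simp))
  have hD : 2 * (#(touching u w A) + #{X ∈ missing A | Splits b c X}) ≤
      (Fintype.card α - 3).choose 2 := by
    have hq : 3 ≤ #(edgeSupp A)ᶜ := by
      rw [← h3]
      exact card_le_card fun x hx => mem_compl.2 (disjoint_left.1 hd hx)
    have hp : 2 ≤ #(edgeSupp A) := he'.2 ▸ card_le_card hes
    refine exchange_bound hn (card_add_card_compl _) hq hp (card_touching_le huw he)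
      (t := #(missing A)) ?_ ?_ ?_
    · refine le_trans (card_le_card ?_) (card_triples_le hbc hbQ hcQ)
      intro X hX
      rw [mem_filter] at hX ⊢
      obtain ⟨h4, h5⟩ := hA.of_mem_missing ⟨_, he⟩ hX.1
      exact ⟨mem_powersetCard.2 ⟨fun x hx => mem_compl.2 (disjoint_left.1 h5 hx), h4⟩, hX.2⟩
    · refine card_lt_card (filter_ssubset.2 ⟨_, hB, ?_⟩)
      simp [Splits]
    · have := card_edgesOf_le A
      lia
  have hlt : #({u, w} : Finset α) < #({a, b, c} : Finset α) := by lia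
  have hexch := card_meetFams_le_compr_pair hs hn h2 (fun X => hA.big_mem ⟨_, he⟩) huw he'.1
    hab hac hbc hBA huc hD fun X hX => (hA.of_mem_missing ⟨_, he⟩ hX).1
  have hself : compr {{u, w}} (fun _ => {a, b, c}) A' = A' := compr_eq_self fun _ _ _ => hBA'
  have hl := isLift_singleton hlt
  have h8 : #(meetFams s A') ≤ #(meetFams s (compr {{u, w}} (fun _ => {a, b, c}) A')) :=
    (congrArg (fun X => #(meetFams s X)) hself).ge
  have h9 := h.stable _ _ hl hexch h8
  have h10 := (h9 _ (mem_singleton_self _)).1 he'.1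
  exact hBA h10
end Missing

section Perm
variable {α : Type*} [Fintype α] [DecidableEq α]

theorem exists_perm_map_eq {S S' : Finset α} (h : #S = #S') :
    ∃ σ : Equiv.Perm α, S.map σ.toEmbedding = S' := by
  let e := Finset.equivOfCardEq h
  refine ⟨e.extendSubtype, ?_⟩
  refine eq_of_subset_of_card_le ?_ (by rw [card_map, h])
  intro y hy
  obtain ⟨x, hx, rfl⟩ := mem_map.1 hy
  exact e.extendSubtype_mem x hx

theorem exists_perm_map_eq_of_notMem {z z' : α} {S S' : Finset α} (hz : z ∉ S) (hz' : z' ∉ S')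
    (h : #S = #S') : ∃ σ : Equiv.Perm α, σ z = z' ∧ S.map σ.toEmbedding = S' := by
  obtain ⟨σ, hσ⟩ := exists_perm_map_eq h
  have hσz : σ z ∉ S' := by
    rw [← hσ]
    intro h
    exact hz ((mem_map' σ.toEmbedding).1 h)
  refine ⟨σ.trans (Equiv.swap (σ z) z'), by simp, ?_⟩
  refine eq_of_subset_of_card_le ?_ (by rw [card_map, h])
  intro y hy
  obtain ⟨x, hx, rfl⟩ := mem_map.1 hy
  have hx' : σ x ∈ S' := hσ ▸ mem_map_of_mem _ hx
  simp only [Equiv.coe_toEmbedding, Equiv.trans_apply]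
  rw [Equiv.swap_apply_of_ne_of_ne]
  · exact hx'
  · rintro h; exact hσz (h ▸ hx')
  · rintro h; exact hz' (h ▸ hx')

end Perm

section Trace
variable {α : Type*} [Fintype α] [DecidableEq α] {s : ℕ}

/-- The intersecting families of size `s` without sets of size less than two whose pairs are
exactly the members of `E`. -/
def withEdges (s : ℕ) (E : Finset (Finset α)) : Finset (Finset (Finset α)) :=
  {F | Meets F ∧ #F = s ∧ (∀ X ∈ F, 2 ≤ #X) ∧ edgesOf F = E}

theorem mem_withEdges {E F : Finset (Finset α)} :
    F ∈ withEdges s E ↔ Meets F ∧ #F = s ∧ (∀ X ∈ F, 2 ≤ #X) ∧ edgesOf F = E := by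
  simp [withEdges]

theorem card_meetFams_bigSets_union {G : Finset (Finset α)} (hG : ∀ e ∈ G, #e = 2) :
    #(meetFams s (bigSets α ∪ G)) = ∑ E ∈ G.powerset, #(withEdges s E) := by
  rw [card_eq_sum_card_fiberwise (f := edgesOf) (t := G.powerset)]
  · refine sum_congr rfl fun E hE => congrArg card ?_
    ext F
    simp only [mem_filter, mem_meetFams, mem_withEdges]
    constructor
    · rintro ⟨⟨h1, h2, h3⟩, h4⟩
      refine ⟨h3, h2, fun X hX => ?_, h4⟩
      rcases mem_union.1 (h1 hX) with h | h
      · simp only [bigSets, mem_filter, mem_univ, true_and] at h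
        lia
      · exact (hG X h).ge
    · rintro ⟨h1, h2, h3, h4⟩
      refine ⟨⟨fun X hX => ?_, h2, h1⟩, h4⟩
      rw [mem_union]
      by_cases h : #X = 2
      · right
        exact mem_powerset.1 hE (h4 ▸ mem_filter.2 ⟨hX, h⟩)
      · left
        have := h3 X hX
        simp only [bigSets, mem_filter, mem_univ, true_and]
        lia
  · intro F hF
    simp only [mem_coe, mem_meetFams, mem_powerset] at hF ⊢
    intro X hX
    simp only [edgesOf, mem_filter] at hX
    rcases mem_union.1 (hF.1 hX.1) with h | h
    · simp only [bigSets, mem_filter, mem_univ, true_and] at h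
      lia
    · exact h

omit [Fintype α] [DecidableEq α] in
theorem edgesOf_relabel (σ : Equiv.Perm α) (F : Finset (Finset α)) :
    edgesOf (relabel σ F) = relabel σ (edgesOf F) := by
  ext Y
  simp only [edgesOf, mem_filter, mem_relabel]
  constructor
  · rintro ⟨⟨X, hX, rfl⟩, h⟩
    exact ⟨X, ⟨hX, by simpa using h⟩, rfl⟩
  · rintro ⟨X, ⟨hX, h⟩, rfl⟩
    exact ⟨⟨X, hX, rfl⟩, by simpa using h⟩

theorem card_withEdges_le_relabel (σ : Equiv.Perm α) (E : Finset (Finset α)) :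
    #(withEdges s E) ≤ #(withEdges s (relabel σ E)) := by
  refine card_le_card_of_injOn (relabel σ) ?_ (relabel_injective σ).injOn
  intro F hF
  simp only [mem_coe, mem_withEdges] at hF ⊢
  refine ⟨hF.1.relabel σ, by rw [card_relabel, hF.2.1], fun Y hY => ?_, ?_⟩
  · obtain ⟨X, hX, rfl⟩ := mem_relabel.1 hY
    rw [card_map]
    exact hF.2.2.1 X hX
  · rw [edgesOf_relabel, hF.2.2.2]

/-- The pairs joining `z` to the elements of `S`. -/
def starEdges (z : α) (S : Finset α) : Finset (Finset α) := S.image fun j => {z, j}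

omit [Fintype α] in
theorem mem_starEdges {z : α} {S : Finset α} {X : Finset α} : X ∈ starEdges z S ↔ ∃ j ∈ S, {z, j} = X := by
  simp [starEdges]

omit [Fintype α] in
theorem pair_injOn {z : α} {S : Finset α} (hz : z ∉ S) :
    Set.InjOn (fun j => ({z, j} : Finset α)) S := by
  intro i hi j hj h
  have h1 : i ∈ ({z, j} : Finset α) := (show ({z, i} : Finset α) = {z, j} from h) ▸ by simp
  simp only [mem_insert, mem_singleton] at h1
  rcases h1 with rfl | h1
  · exact absurd hi hz
  · exact h1

omit [Fintype α] in
theorem card_starEdges {z : α} {S : Finset α} (hz : z ∉ S) : #(starEdges z S) = #S :=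
  card_image_of_injOn (pair_injOn hz)

omit [Fintype α] in
theorem card_of_mem_starEdges {z : α} {S : Finset α} (hz : z ∉ S) {X : Finset α} (hX : X ∈ starEdges z S) :
    #X = 2 := by
  obtain ⟨j, hj, rfl⟩ := mem_starEdges.1 hX
  exact card_pair (by rintro rfl; exact hz hj)

omit [Fintype α] in
theorem pair_mem_starEdges {z j : α} {S : Finset α} (hj : j ≠ z) :
    {z, j} ∈ starEdges z S ↔ j ∈ S := by
  rw [mem_starEdges]
  constructor
  · rintro ⟨i, hi, h⟩
    have : j ∈ ({z, i} : Finset α) := h ▸ by simp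
    simp only [mem_insert, mem_singleton] at this
    rcases this with h | rfl
    · exact absurd h hj
    · exact hi
  · exact fun h => ⟨j, h, rfl⟩

omit [Fintype α] in
theorem relabel_starEdges (σ : Equiv.Perm α) (z : α) (S : Finset α) :
    relabel σ (starEdges z S) = starEdges (σ z) (S.map σ.toEmbedding) := by
  ext Y
  simp only [mem_relabel, mem_starEdges, mem_map]
  constructor
  · rintro ⟨X, ⟨j, hj, rfl⟩, rfl⟩
    exact ⟨σ j, ⟨j, hj, rfl⟩, by simp⟩
  · rintro ⟨_, ⟨j, hj, rfl⟩, rfl⟩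
    exact ⟨{z, j}, ⟨j, hj, rfl⟩, by simp⟩

theorem card_withEdges_starEdges_eq {z z' : α} {S S' : Finset α} (hz : z ∉ S) (hz' : z' ∉ S')
    (h : #S = #S') : #(withEdges s (starEdges z S)) = #(withEdges s (starEdges z' S')) := by
  have key : ∀ {z z' : α} {S S' : Finset α}, z ∉ S → z' ∉ S' → #S = #S' →
      #(withEdges s (starEdges z S)) ≤ #(withEdges s (starEdges z' S')) := by
    intro z z' S S' hz hz' h
    obtain ⟨σ, rfl, rfl⟩ := exists_perm_map_eq_of_notMem hz hz' h
    rw [← relabel_starEdges]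
    exact card_withEdges_le_relabel σ _
  exact le_antisymm (key hz hz' h) (key hz' hz h.symm)

theorem card_withEdges_triangle_eq {T T' : Finset α} (h : #T = #T') :
    #(withEdges s (powersetCard 2 T)) = #(withEdges s (powersetCard 2 T')) := by
  have key : ∀ {T T' : Finset α}, #T = #T' →
      #(withEdges s (powersetCard 2 T)) ≤ #(withEdges s (powersetCard 2 T')) := by
    intro T T' h
    obtain ⟨σ, rfl⟩ := exists_perm_map_eq h
    rw [powersetCard_map]
    exact card_withEdges_le_relabel σ _
  exact le_antisymm (key h) (key h.symm)

variable (α) in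
/-- The number of intersecting families of size `s` whose pairs form a given star with `k` edges. -/
def starCount (s k : ℕ) : ℕ :=
  ({p | p.1 ∉ p.2 ∧ #p.2 = k} : Finset (α × Finset α)).sup fun p => #(withEdges s (starEdges p.1 p.2))

variable (α) in
/-- The number of intersecting families of size `s` whose pairs form a given triangle. -/
def triangleCount (s : ℕ) : ℕ :=
  ({T | #T = 3} : Finset (Finset α)).sup fun T => #(withEdges s (powersetCard 2 T))

theorem card_withEdges_starEdges {z : α} {S : Finset α} (hz : z ∉ S) :
    #(withEdges s (starEdges z S)) = starCount α s #S := by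
  apply le_antisymm
  · exact le_sup (f := fun p : α × Finset α => #(withEdges s (starEdges p.1 p.2))) (b := (z, S))
      (by simp [hz])
  · refine Finset.sup_le fun p hp => ?_
    simp only [mem_filter, mem_univ, true_and] at hp
    exact (card_withEdges_starEdges_eq hp.1 hz hp.2).le

theorem card_withEdges_triangle {T : Finset α} (hT : #T = 3) :
    #(withEdges s (powersetCard 2 T)) = triangleCount α s := by
  apply le_antisymm
  · exact le_sup (f := fun T : Finset α => #(withEdges s (powersetCard 2 T))) (by simp [hT])
  · refine Finset.sup_le fun T' hT' => ?_
    simp only [mem_filter, mem_univ, true_and] at hT'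
    exact (card_withEdges_triangle_eq (hT'.trans hT.symm)).le

theorem starCount_succ_mul_le (hn : 7 ≤ Fintype.card α) {k : ℕ} (hk : k + 2 ≤ Fintype.card α) :
    (Fintype.card α - k - 1) * starCount α s (k + 1) ≤ starCount α s k := by
  obtain ⟨R, -, hR⟩ := exists_subset_card_eq (s := (univ : Finset α)) (n := k + 2) (by simpa using hk)
  obtain ⟨z, R', hz, -, hR'⟩ := card_eq_succ.1 hR
  obtain ⟨v, S, hv, rfl, hS⟩ := card_eq_succ.1 hR'
  have hzS : z ∉ S := fun h => hz (mem_insert_of_mem h)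
  have hzv : z ≠ v := fun h => hz (h ▸ mem_insert_self _ _)
  rw [← hR', ← hS, ← card_withEdges_starEdges hzS, hS, ← card_withEdges_starEdges hz]
  have hcard : Fintype.card α - k - 1 = #(univ \ insert z S) := by
    rw [card_sdiff_of_subset (subset_univ _), card_univ, card_insert_of_notMem hzS, hS]
    lia
  rw [hcard, ← card_product]
  set e : Finset α := {z, v} with he
  have he2 : #e = 2 := card_pair hzv
  let T : α → Finset α := fun j => insert j e
  have hT3 : ∀ j, #(T j) ≤ 3 := fun j => (card_insert_le _ _).trans (by lia)
  have heT : ∀ j, e ⊆ T j := fun j => subset_insert _ _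
  have hTinj : ∀ i j, i ∉ insert z S → j ∉ insert z S → T i = T j → i = j := by
    intro i j hi hj h
    have h1 : i ∈ T j := h ▸ mem_insert_self _ _
    have h2 : j ∈ T i := h ▸ mem_insert_self _ _
    simp only [T, he, mem_insert, mem_singleton] at h1 h2 hi hj
    grind
  let flip : α → Finset α → Finset α := fun j => coFlip {e, T j} (Equiv.swap e (T j))
  have hswap : ∀ j, ∀ X ∈ ({e, T j} : Finset (Finset α)),
      (X = e ∧ Equiv.swap e (T j) X = T j) ∨ (X = T j ∧ Equiv.swap e (T j) X = e) := by
    intro j X hX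
    simp only [mem_insert, mem_singleton] at hX
    rcases hX with rfl | rfl
    · left; simp
    · right; simp
  have havoid : ∀ j, ∀ F ∈ withEdges s (starEdges z (insert v S)), ∀ X ∈ F,
      X ≠ eᶜ ∧ X ≠ (T j)ᶜ := by
    intro j F hF X hX
    obtain ⟨hm, -, -, hE⟩ := mem_withEdges.1 hF
    have heF : e ∈ F := by
      have : e ∈ edgesOf F := hE ▸ mem_starEdges.2 ⟨v, mem_insert_self _ _, rfl⟩
      exact (mem_filter.1 this).1
    constructor
    · rintro rfl
      obtain ⟨y, hy⟩ := hm _ hX e heF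
      simp at hy
    · rintro rfl
      obtain ⟨y, hy⟩ := hm _ hX e heF
      have := @heT j y
      simp only [mem_inter, mem_compl] at hy
      tauto
  have hinj : ∀ j, ∀ F ∈ withEdges s (starEdges z (insert v S)),
      F ⊆ univ.filter fun X => ∀ Y ∈ ({e, T j} : Finset (Finset α)), X ≠ (Equiv.swap e (T j) Y)ᶜ := by
    intro j F hF X hX
    simp only [mem_filter, mem_univ, true_and]
    intro Y hY
    rcases hswap j Y hY with ⟨-, h⟩ | ⟨-, h⟩
    · rw [h]; exact (havoid j F hF X hX).2
    · rw [h]; exact (havoid j F hF X hX).1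
  have hflipinj : ∀ j, Set.InjOn (flip j)
      {X | ∀ Y ∈ ({e, T j} : Finset (Finset α)), X ≠ (Equiv.swap e (T j) Y)ᶜ} := fun j =>
    coFlip_injOn (Equiv.swap e (T j)).injective.injOn
  have hcases : ∀ (j : α) (F : Finset (Finset α)), ∀ Y ∈ F.image (flip j), (Y ∈ F ∧ Y ≠ e ∧ Y ≠ T j) ∨ Y = eᶜ ∨ Y = (T j)ᶜ := by
    intro j F Y hY
    obtain ⟨X, hX, rfl⟩ := mem_image.1 hY
    simp only [flip, coFlip]
    split_ifs with h
    · right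
      rcases hswap j X h with ⟨-, h⟩ | ⟨-, h⟩
      · rw [h]; exact Or.inr rfl
      · rw [h]; exact Or.inl rfl
    · left
      simp only [mem_insert, mem_singleton, not_or] at h
      exact ⟨hX, h⟩
  refine card_le_card_of_injOn (fun p => p.2.image (flip p.1)) ?_ ?_
  · rintro ⟨j, F⟩ hp
    simp only [coe_product, Set.mem_prod, mem_coe, mem_sdiff, mem_univ, true_and] at hp ⊢
    obtain ⟨hj, hF⟩ := hp
    obtain ⟨hm, hs, h2, hE⟩ := mem_withEdges.1 hF
    have hlarge : ∀ Y, Y = eᶜ ∨ Y = (T j)ᶜ → 3 < #Y := by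
      rintro Y (rfl | rfl)
      · rw [card_compl]; lia
      · have := hT3 j
        rw [card_compl]; lia
    rw [mem_withEdges]
    refine ⟨meets_image_coFlip hm ?_ ?_, ?_, ?_, ?_⟩
    · intro Y hY hYS X hX hXS hYX
      simp only [mem_insert, mem_singleton, not_or] at hYS
      have hY2 := h2 Y hY
      have hYT : Y ⊆ T j := by
        rcases hswap j X hXS with ⟨-, h⟩ | ⟨-, h⟩
        · exact h ▸ hYX
        · exact (h ▸ hYX).trans (heT j)
      have hlt := card_lt_card (hYT.ssubset_of_ne hYS.2)
      have hTj := hT3 j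
      have hYE : Y ∈ starEdges z (insert v S) := hE ▸ mem_filter.2 ⟨hY, by lia⟩
      obtain ⟨i, hi, rfl⟩ := mem_starEdges.1 hYE
      have hiT : i ∈ T j := hYT (by simp)
      have hiz : i ≠ z := fun h => hz (h ▸ hi)
      simp only [T, he, mem_insert, mem_singleton] at hiT hi hj
      rcases hiT with h | h | h
      · subst h
        rcases hi with h | h
        · exact hYS.1 (by rw [h])
        · tauto
      · exact hiz h
      · exact hYS.1 (by rw [h])
    · intro X hX hXS Y hY hYS
      have hle : ∀ X ∈ ({e, T j} : Finset (Finset α)), #(Equiv.swap e (T j) X) ≤ 3 := by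
        intro X hX
        rcases hswap j X hX with ⟨-, h⟩ | ⟨-, h⟩
        · rw [h]; exact hT3 j
        · rw [h]; lia
      have := hle X hXS
      have := hle Y hYS
      lia
    · rw [card_image_of_injOn, hs]
      intro X hX Y hY h
      exact hflipinj j (mem_filter.1 (hinj j F hF hX)).2 (mem_filter.1 (hinj j F hF hY)).2 h
    · intro Y hY
      rcases hcases j F Y hY with h | h
      · exact h2 Y h.1
      · have := hlarge Y h; lia
    · ext Y
      have hYstar : Y ∈ starEdges z S ↔ Y ∈ starEdges z (insert v S) ∧ Y ≠ e := by
        constructor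
        · intro h
          obtain ⟨i, hi, rfl⟩ := mem_starEdges.1 h
          refine ⟨mem_starEdges.2 ⟨i, mem_insert_of_mem hi, rfl⟩, fun h => hv ?_⟩
          rw [← pair_mem_starEdges hzv.symm, ← he, ← h]
          exact mem_starEdges.2 ⟨i, hi, rfl⟩
        · rintro ⟨h, hne⟩
          obtain ⟨i, hi, rfl⟩ := mem_starEdges.1 h
          refine mem_starEdges.2 ⟨i, (mem_insert.1 hi).resolve_left ?_, rfl⟩
          rintro rfl
          exact hne rfl
      rw [hYstar, ← hE, edgesOf, edgesOf, mem_filter, mem_filter]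
      constructor
      · rintro ⟨h, hY2⟩
        rcases hcases j F Y h with h | h
        · exact ⟨⟨h.1, hY2⟩, h.2.1⟩
        · have := hlarge Y h; lia
      · rintro ⟨⟨hY, hY2⟩, hne⟩
        refine ⟨mem_image.2 ⟨Y, hY, ?_⟩, hY2⟩
        have hne' : Y ≠ T j := by
          rintro rfl
          exact hne (eq_of_subset_of_card_le (heT j) (by lia)).symm
        simp [flip, coFlip, hne, hne']
  · rintro ⟨j, F⟩ hp ⟨j', F'⟩ hp' heq
    simp only [coe_product, Set.mem_prod, mem_coe, mem_sdiff, mem_univ, true_and] at hp hp' heq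
    obtain ⟨hj, hF⟩ := hp
    obtain ⟨hj', hF'⟩ := hp'
    have hjj : j = j' := by
      have heF : e ∈ F := by
        have : e ∈ edgesOf F := (mem_withEdges.1 hF).2.2.2 ▸
          mem_starEdges.2 ⟨v, mem_insert_self _ _, rfl⟩
        exact (mem_filter.1 this).1
      have h1 : (T j)ᶜ ∈ F.image (flip j) := mem_image.2 ⟨e, heF, by simp [flip, coFlip]⟩
      have heF' : e ∈ F' := by
        have : e ∈ edgesOf F' := (mem_withEdges.1 hF').2.2.2 ▸
          mem_starEdges.2 ⟨v, mem_insert_self _ _, rfl⟩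
        exact (mem_filter.1 this).1
      have h2 : (T j')ᶜ ∈ F'.image (flip j') := mem_image.2 ⟨e, heF', by simp [flip, coFlip]⟩
      rw [heq] at h1
      rw [← heq] at h2
      have key : ∀ i i' : α, ∀ F ∈ withEdges s (starEdges z (insert v S)), i ∉ insert z S →
          i' ∉ insert z S → (T i)ᶜ ∈ F.image (flip i') → T i = e ∨ i = i' := by
        intro i i' F hF hi hi' h
        rcases hcases i' F _ h with h | h | h
        · exact absurd rfl (havoid i F hF _ h.1).2
        · exact Or.inl (compl_injective h)
        · exact Or.inr (hTinj i i' hi hi' (compl_injective h))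
      rcases key j j' F' hF' hj hj' h1 with h | h
      · rcases key j' j F hF hj' hj h2 with h' | h'
        · exact hTinj j j' hj hj' (h.trans h'.symm)
        · exact h'.symm
      · exact h
    subst hjj
    refine Prod.ext rfl ?_
    have one : ∀ F ∈ withEdges s (starEdges z (insert v S)), ∀ F' ∈ withEdges s (starEdges z (insert v S)),
        F.image (flip j) = F'.image (flip j) → F ⊆ F' := by
      intro F hF F' hF' heq X hX
      have h1 : flip j X ∈ F'.image (flip j) := heq ▸ mem_image_of_mem _ hX
      obtain ⟨Y, hY, hYX⟩ := mem_image.1 h1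
      rwa [← hflipinj j (mem_filter.1 (hinj j F' hF' hY)).2 (mem_filter.1 (hinj j F hF hX)).2 hYX]
    exact Subset.antisymm (one F hF F' hF' heq) (one F' hF' F hF heq.symm)

end Trace

section Classification
variable {α : Type*} [Fintype α] [DecidableEq α]

theorem exists_eq_starEdges {E : Finset (Finset α)} {z : α} (h2 : ∀ e ∈ E, #e = 2)
    (hz : ∀ e ∈ E, z ∈ e) : ∃ S, z ∉ S ∧ E = starEdges z S := by
  refine ⟨univ.filter fun j => j ≠ z ∧ {z, j} ∈ E, by simp, ?_⟩
  ext X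
  rw [mem_starEdges]
  simp only [mem_filter, mem_univ, true_and]
  constructor
  · intro hX
    obtain ⟨j, hj⟩ := card_eq_one.1 (show #(X.erase z) = 1 by rw [card_erase_of_mem (hz X hX), h2 X hX])
    have hX' : {z, j} = X := by rw [← insert_erase (hz X hX), hj]
    have : j ∈ X.erase z := hj ▸ mem_singleton_self j
    exact ⟨j, ⟨(mem_erase.1 this).1, hX'.symm ▸ hX⟩, hX'⟩
  · rintro ⟨j, ⟨-, h⟩, rfl⟩
    exact h

omit [Fintype α] in
theorem eq_pair_of_mem {e : Finset α} {a b : α} (he : #e = 2) (ha : a ∈ e) (hb : b ∈ e)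
    (hab : a ≠ b) : e = {a, b} :=
  (eq_of_subset_of_card_le (by simp [insert_subset_iff, ha, hb]) (by rw [he, card_pair hab])).symm

omit [Fintype α] in
theorem exists_center_or_eq_triangle [Nonempty α] {E : Finset (Finset α)} (h2 : ∀ e ∈ E, #e = 2)
    (hE : Meets E) : (∃ z, ∀ e ∈ E, z ∈ e) ∨ ∃ T, #T = 3 ∧ E = powersetCard 2 T := by
  by_contra! h
  obtain ⟨h1, h3⟩ := h
  obtain ⟨x⟩ := ‹Nonempty α›
  obtain ⟨e, he, -⟩ := h1 x
  obtain ⟨a, b, hab, rfl⟩ := card_eq_two.1 (h2 e he)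
  have meet : ∀ f ∈ E, ∀ g ∈ E, ∃ x, x ∈ f ∧ x ∈ g := fun f hf g hg => by
    obtain ⟨x, hx⟩ := hE f hf g hg
    exact ⟨x, mem_inter.1 hx⟩
  obtain ⟨f, hf, haf⟩ := h1 a
  obtain ⟨g, hg, hbg⟩ := h1 b
  have hbf : b ∈ f := by
    obtain ⟨x, hx, hx'⟩ := meet _ he f hf
    simp only [mem_insert, mem_singleton] at hx
    rcases hx with rfl | rfl <;> tauto
  have hag : a ∈ g := by
    obtain ⟨x, hx, hx'⟩ := meet _ he g hg
    simp only [mem_insert, mem_singleton] at hx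
    rcases hx with rfl | rfl <;> tauto
  obtain ⟨c, hcf, hcg⟩ := meet f hf g hg
  have hca : c ≠ a := by rintro rfl; exact haf hcf
  have hcb : c ≠ b := by rintro rfl; exact hbg hcg
  obtain rfl := eq_pair_of_mem (h2 f hf) hbf hcf hcb.symm
  obtain rfl := eq_pair_of_mem (h2 g hg) hag hcg hca.symm
  have hT : #({a, b, c} : Finset α) = 3 := card_eq_three.2 ⟨a, b, c, hab, hca.symm, hcb.symm, rfl⟩
  refine h3 {a, b, c} hT (eq_of_subset_of_card_le ?_ ?_)
  · intro k hk
    refine mem_powersetCard.2 ⟨?_, h2 k hk⟩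
    obtain ⟨x, hx, hxk⟩ := meet _ he k hk
    obtain ⟨y, hy, hyk⟩ := meet _ hf k hk
    obtain ⟨w, hw, hwk⟩ := meet _ hg k hk
    simp only [mem_insert, mem_singleton] at hx hy hw
    have key : ∃ u ∈ ({a, b, c} : Finset α), ∃ v ∈ ({a, b, c} : Finset α), u ≠ v ∧ u ∈ k ∧ v ∈ k := by
      by_cases hak : a ∈ k
      · refine ⟨a, by simp, y, by simp; tauto, ?_, hak, hyk⟩
        rcases hy with rfl | rfl
        · exact hab
        · exact hca.symm
      · exact ⟨b, by simp, c, by simp, hcb.symm, by grind, by grind⟩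
    obtain ⟨u, hu, v, hv, huv, huk, hvk⟩ := key
    rw [eq_pair_of_mem (h2 k hk) huk hvk huv]
    simp [insert_subset_iff, -mem_insert, -mem_singleton, hu, hv]
  · rw [card_powersetCard, hT]
    have : ({{a, b}, {b, c}, {a, c}} : Finset (Finset α)) ⊆ E := by
      simp [insert_subset_iff, he, hf, hg]
    refine le_trans ?_ (card_le_card this)
    have h3 : #({{a, b}, {b, c}, {a, c}} : Finset (Finset α)) = 3 := by
      refine card_eq_three.2 ⟨{a, b}, {b, c}, {a, c}, ?_, ?_, ?_, rfl⟩
      · intro h; exact haf (h ▸ by simp)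
      · intro h; exact hbg (h ▸ by simp)
      · intro h; exact haf (h.symm ▸ by simp)
    rw [h3]
    decide

variable {s : ℕ}

theorem withEdges_eq_empty_of_not_meets {E : Finset (Finset α)} (hE : ¬ Meets E) :
    withEdges s E = ∅ := by
  refine eq_empty_of_forall_notMem fun F hF => hE ?_
  obtain ⟨hm, -, -, rfl⟩ := mem_withEdges.1 hF
  exact fun X hX Y hY => hm X (filter_subset _ _ hX) Y (filter_subset _ _ hY)

theorem eq_starEdges_univ_erase {G : Finset (Finset α)} {z : α} (h2 : ∀ e ∈ G, #e = 2)
    (hz : ∀ e ∈ G, z ∈ e) (hc : #G = Fintype.card α - 1) : G = starEdges z (univ.erase z) := by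
  obtain ⟨S, hS, rfl⟩ := exists_eq_starEdges h2 hz
  rw [card_starEdges hS] at hc
  congr 1
  refine eq_of_subset_of_card_le (fun x hx => mem_erase.2 ⟨?_, mem_univ x⟩) ?_
  · rintro rfl; exact hS hx
  · rw [card_erase_of_mem (mem_univ z), card_univ, hc]

end Classification

section Positive
variable {α : Type*} [Fintype α] [DecidableEq α] {s : ℕ}

/-- The sets of size at most two through `z` which are not in the star with leaves `S`. -/
def offStar (z : α) (S : Finset α) : Finset (Finset α) :=
  {X | z ∈ X ∧ #X ≤ 2 ∧ X ∉ starEdges z S}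

theorem mem_offStar {z : α} {S X : Finset α} :
    X ∈ offStar z S ↔ z ∈ X ∧ #X ≤ 2 ∧ X ∉ starEdges z S := by
  simp [offStar]

/-- A maximum intersecting family whose pairs are the star with centre `z` and leaves `S`. -/
def starFam (z : α) (S : Finset α) : Finset (Finset α) :=
  {X | (z ∈ X ∧ X ∉ offStar z S) ∨ Xᶜ ∈ offStar z S}

theorem mem_starFam {z : α} {S X : Finset α} :
    X ∈ starFam z S ↔ (z ∈ X ∧ X ∉ offStar z S) ∨ Xᶜ ∈ offStar z S := by
  simp [starFam]

theorem compl_mem_starFam_iff {z : α} {S X : Finset α} : Xᶜ ∈ starFam z S ↔ X ∉ starFam z S := by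
  have h1 : X ∈ offStar z S → z ∈ X := fun h => (mem_offStar.1 h).1
  have h2 : Xᶜ ∈ offStar z S → z ∉ X := fun h => mem_compl.1 (mem_offStar.1 h).1
  rw [mem_starFam, mem_starFam, compl_compl, mem_compl]
  tauto

theorem two_mul_card_starFam (z : α) (S : Finset α) :
    2 * #(starFam z S) = 2 ^ Fintype.card α := by
  have h : #(starFam z S)ᶜ = #(starFam z S) := by
    refine card_nbij' compl compl ?_ ?_ ?_ ?_
    · intro X hX
      exact compl_mem_starFam_iff.2 (mem_compl.1 hX)
    · intro X hX
      simp only [mem_coe, mem_compl, compl_mem_starFam_iff, not_not] at hX ⊢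
      exact hX
    · intro X _; exact compl_compl X
    · intro X _; exact compl_compl X
  rw [← Fintype.card_finset, ← card_add_card_compl (starFam z S), h, two_mul]

theorem meets_starFam (hn : 5 ≤ Fintype.card α) {z : α} {S : Finset α} (hz : z ∉ S) :
    Meets (starFam z S) := by
  have mixed : ∀ X Y, (z ∈ X ∧ X ∉ offStar z S) → Yᶜ ∈ offStar z S → (X ∩ Y).Nonempty := by
    rintro X Y ⟨hzX, hX⟩ hY
    by_contra h
    rw [not_nonempty_iff_eq_empty, ← disjoint_iff_inter_eq_empty, ← subset_compl_iff_disjoint_right] at h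
    obtain ⟨-, hY2, hYS⟩ := mem_offStar.1 hY
    have hXS : X ∈ starEdges z S := by
      by_contra hXS
      exact hX (mem_offStar.2 ⟨hzX, (card_le_card h).trans hY2, hXS⟩)
    have := eq_of_subset_of_card_le h (by rw [card_of_mem_starEdges hz hXS]; exact hY2)
    exact hYS (this ▸ hXS)
  intro X hX Y hY
  rcases mem_starFam.1 hX with hX | hX <;> rcases mem_starFam.1 hY with hY | hY
  · exact ⟨z, mem_inter.2 ⟨hX.1, hY.1⟩⟩
  · exact mixed X Y hX hY
  · rw [inter_comm]; exact mixed Y X hY hX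
  · have h1 := (mem_offStar.1 hX).2.1
    have h2 := (mem_offStar.1 hY).2.1
    rw [← compl_ne_univ_iff_nonempty, compl_inter]
    intro h
    have h3 := card_union_le Xᶜ Yᶜ
    rw [h, card_univ] at h3
    lia

theorem two_le_card_of_mem_starFam (hn : 5 ≤ Fintype.card α) {z : α} {S X : Finset α}
    (hz : z ∉ S) (hX : X ∈ starFam z S) : 2 ≤ #X := by
  rcases mem_starFam.1 hX with ⟨hzX, hX⟩ | hX
  · by_contra! h
    refine hX (mem_offStar.2 ⟨hzX, by lia, fun h' => ?_⟩)
    have := card_of_mem_starEdges hz h'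
    lia
  · have := (mem_offStar.1 hX).2.1
    rw [card_compl] at this
    lia

theorem edgesOf_starFam (hn : 5 ≤ Fintype.card α) {z : α} {S : Finset α} (hz : z ∉ S) :
    edgesOf (starFam z S) = starEdges z S := by
  ext X
  rw [edgesOf, mem_filter, mem_starFam, mem_offStar, mem_offStar]
  constructor
  · rintro ⟨h, h2⟩
    rcases h with ⟨hz, h⟩ | ⟨-, h, -⟩
    · by_contra h'
      exact h ⟨hz, h2.le, h'⟩
    · rw [card_compl] at h
      lia
  · intro hX
    refine ⟨Or.inl ⟨?_, by tauto⟩, card_of_mem_starEdges hz hX⟩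
    obtain ⟨j, -, rfl⟩ := mem_starEdges.1 hX
    simp

theorem choose_le_starCount (hn : 5 ≤ Fintype.card α) {k : ℕ} (hk : k < Fintype.card α)
    (hks : k ≤ s) : (2 ^ (Fintype.card α - 1) - k).choose (s - k) ≤ starCount α s k := by
  obtain ⟨R, -, hR⟩ := exists_subset_card_eq (s := (univ : Finset α)) (n := k + 1) (by simpa using hk)
  obtain ⟨z, S, hz, -, rfl⟩ := card_eq_succ.1 hR
  have hsub : starEdges z S ⊆ starFam z S := edgesOf_starFam hn hz ▸ filter_subset _ _
  have hcard : #(starFam z S) = 2 ^ (Fintype.card α - 1) := by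
    have := two_mul_card_starFam z S
    obtain ⟨m, hm⟩ : ∃ m, Fintype.card α = m + 1 := ⟨_, (Nat.sub_add_cancel (by lia)).symm⟩
    rw [hm, pow_succ] at this
    rw [hm, Nat.add_sub_cancel]
    lia
  rw [← card_withEdges_starEdges hz]
  have hc : (2 ^ (Fintype.card α - 1) - #S).choose (s - #S) =
      #(powersetCard (s - #S) (starFam z S \ starEdges z S)) := by
    rw [card_powersetCard, card_sdiff_of_subset hsub, hcard, card_starEdges hz]
  rw [hc]
  have hdisj : ∀ Q ∈ powersetCard (s - #S) (starFam z S \ starEdges z S),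
      Disjoint Q (starEdges z S) := fun Q hQ =>
    disjoint_of_subset_left (mem_powersetCard.1 hQ).1 sdiff_disjoint
  refine card_le_card_of_injOn (· ∪ starEdges z S) ?_ ?_
  · intro Q hQ
    have hQ' := mem_powersetCard.1 (mem_coe.1 hQ)
    have hsubQ : Q ∪ starEdges z S ⊆ starFam z S :=
      union_subset (hQ'.1.trans sdiff_subset) hsub
    simp only [mem_coe, mem_withEdges]
    refine ⟨fun X hX Y hY => meets_starFam hn hz X (hsubQ hX) Y (hsubQ hY), ?_,
      fun X hX => two_le_card_of_mem_starFam hn hz (hsubQ hX), ?_⟩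
    · rw [card_union_of_disjoint (hdisj Q hQ), hQ'.2, card_starEdges hz]
      lia
    · apply Subset.antisymm
      · exact (filter_subset_filter _ hsubQ).trans (edgesOf_starFam hn hz).subset
      · exact fun X hX => mem_filter.2 ⟨mem_union_right _ hX, card_of_mem_starEdges hz hX⟩
  · intro Q hQ Q' hQ' h
    simp only at h
    rw [← union_sdiff_cancel_right (hdisj Q hQ), h, union_sdiff_cancel_right (hdisj Q' hQ')]

theorem triangleCount_le_choose :
    triangleCount α s ≤ (2 ^ (Fintype.card α - 1) - 3).choose (s - 3) := by
  refine Finset.sup_le fun T hT => ?_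
  have hT : #T = 3 := (mem_filter.1 hT).2
  set U : Finset (Finset α) := {X | 2 ≤ #(X ∩ T)} with hU
  have hP : #(powersetCard 2 T) = 3 := by rw [card_powersetCard, hT]; rfl
  have hPU : powersetCard 2 T ⊆ U := by
    intro e he
    obtain ⟨h1, h2⟩ := mem_powersetCard.1 he
    rw [hU, mem_filter, inter_eq_left.2 h1]
    exact ⟨mem_univ _, h2.ge⟩
  have hUint : (U : Set (Finset α)).Intersecting := by
    intro X hX Y hY hd
    have hX := (mem_filter.1 hX).2
    have hY := (mem_filter.1 hY).2
    have h := card_union_of_disjoint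
      (disjoint_of_subset_left inter_subset_left (disjoint_of_subset_right inter_subset_left hd) :
        Disjoint (X ∩ T) (Y ∩ T))
    have h' := card_le_card (union_subset inter_subset_right inter_subset_right :
      (X ∩ T) ∪ (Y ∩ T) ⊆ T)
    lia
  have hpos : 0 < Fintype.card α := (by lia : 0 < #T).trans_le (card_le_univ T)
  have hUc : #U ≤ 2 ^ (Fintype.card α - 1) := by
    have := hUint.card_le
    obtain ⟨m, hm⟩ : ∃ m, Fintype.card α = m + 1 := ⟨_, (Nat.sub_add_cancel hpos).symm⟩
    rw [Fintype.card_finset, hm, pow_succ] at this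
    rw [hm, Nat.add_sub_cancel]
    lia
  have hc : #(powersetCard (s - 3) (U \ powersetCard 2 T)) ≤
      (2 ^ (Fintype.card α - 1) - 3).choose (s - 3) := by
    rw [card_powersetCard, card_sdiff_of_subset hPU, hP]
    exact Nat.choose_le_choose _ (Nat.sub_le_sub_right hUc 3)
  refine le_trans ?_ hc
  have hsub : ∀ F ∈ withEdges s (powersetCard 2 T), powersetCard 2 T ⊆ F := fun F hF =>
    (mem_withEdges.1 hF).2.2.2 ▸ filter_subset _ _
  refine card_le_card_of_injOn (· \ powersetCard 2 T) ?_ ?_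
  · intro F hF
    obtain ⟨hm, hs, -, hE⟩ := mem_withEdges.1 (mem_coe.1 hF)
    simp only [mem_coe, mem_powersetCard]
    refine ⟨sdiff_subset_sdiff (fun X hX => ?_) le_rfl, ?_⟩
    · rw [hU, mem_filter]
      refine ⟨mem_univ _, ?_⟩
      by_contra! h
      have : 2 ≤ #(T \ X) := by
        have := card_sdiff_add_card_inter T X
        rw [inter_comm T X] at this
        lia
      obtain ⟨e, he, he2⟩ := exists_subset_card_eq this
      obtain ⟨x, hx⟩ := hm X hX e
        (hsub F hF (mem_powersetCard.2 ⟨he.trans sdiff_subset, he2⟩))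
      have := mem_inter.1 hx
      exact (mem_sdiff.1 (he this.2)).2 this.1
    · rw [card_sdiff_of_subset (hsub F hF), hs, hP]
  · intro F hF F' hF' h
    simp only at h
    rw [← sdiff_union_of_subset (hsub F hF), h, sdiff_union_of_subset (hsub F' hF')]

theorem triangleCount_eq_zero (hs : s < 3) : triangleCount α s = 0 := by
  refine Nat.le_zero.1 (Finset.sup_le fun T hT => ?_)
  have hT : #T = 3 := (mem_filter.1 hT).2
  rw [Nat.le_zero, card_eq_zero]
  refine eq_empty_of_forall_notMem fun F hF => ?_
  obtain ⟨-, hs', -, hE⟩ := mem_withEdges.1 hF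
  have := card_le_card (hE ▸ filter_subset _ _ : powersetCard 2 T ⊆ F)
  rw [card_powersetCard, hT, hs'] at this
  exact absurd this (by simp [Nat.choose]; lia)

theorem triangleCount_le_starCount (hn : 5 ≤ Fintype.card α) :
    triangleCount α s ≤ starCount α s 3 := by
  rcases lt_or_ge s 3 with hs | hs
  · rw [triangleCount_eq_zero hs]
    exact Nat.zero_le _
  · exact triangleCount_le_choose.trans (choose_le_starCount hn (by lia) hs)

theorem starCount_two_pos (hn : 5 ≤ Fintype.card α) (hs : 2 ≤ s)
    (hs' : s ≤ 2 ^ (Fintype.card α - 1)) : 0 < starCount α s 2 :=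
  (Nat.choose_pos (Nat.sub_le_sub_right hs' 2)).trans_le (choose_le_starCount hn (by lia) hs)

theorem card_withEdges_le_starCount (hn : 5 ≤ Fintype.card α) (E : Finset (Finset α)) :
    #(withEdges s E) ≤ starCount α s #E := by
  have : Nonempty α := Fintype.card_pos_iff.1 (by lia)
  rcases (withEdges s E).eq_empty_or_nonempty with h | ⟨F, hF⟩
  · simp [h]
  by_cases hm : Meets E
  · have h2 : ∀ e ∈ E, #e = 2 := fun e he => by
      obtain ⟨-, -, -, rfl⟩ := mem_withEdges.1 hF
      exact (mem_filter.1 he).2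
    rcases exists_center_or_eq_triangle h2 hm with ⟨z, hz⟩ | ⟨T, hT, rfl⟩
    · obtain ⟨S, hS, rfl⟩ := exists_eq_starEdges h2 hz
      rw [card_withEdges_starEdges hS, card_starEdges hS]
    · rw [card_withEdges_triangle hT, card_powersetCard, hT]
      exact triangleCount_le_starCount hn
  · simp [withEdges_eq_empty_of_not_meets hm]

end Positive

section StarComparison
variable {α : Type*} [Fintype α] [DecidableEq α] {s : ℕ}

theorem card_withEdges_of_center [Nonempty α] {E : Finset (Finset α)} {z : α}
    (h2 : ∀ e ∈ E, #e = 2) (hz : ∀ e ∈ E, z ∈ e) : #(withEdges s E) = starCount α s #E := by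
  obtain ⟨S, hS, rfl⟩ := exists_eq_starEdges h2 hz
  rw [card_withEdges_starEdges hS, card_starEdges hS]

theorem sum_card_withEdges_lt_star (hn : 5 ≤ Fintype.card α) (hs : 2 ≤ s)
    (hs' : s ≤ 2 ^ (Fintype.card α - 1)) {G : Finset (Finset α)} (h2 : ∀ e ∈ G, #e = 2)
    (hG : ¬ Meets G) {z : α} {S : Finset α} (hz : z ∉ S) (hc : #G = #S) :
    ∑ E ∈ G.powerset, #(withEdges s E) < ∑ E ∈ (starEdges z S).powerset, #(withEdges s E) := by
  have : Nonempty α := ⟨z⟩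
  have hstar : ∑ E ∈ (starEdges z S).powerset, #(withEdges s E) =
      ∑ E ∈ (starEdges z S).powerset, starCount α s #E := by
    refine sum_congr rfl fun E hE => ?_
    have hE := mem_powerset.1 hE
    refine card_withEdges_of_center (z := z) (fun e he => card_of_mem_starEdges hz (hE he)) ?_
    intro e he
    obtain ⟨j, -, rfl⟩ := mem_starEdges.1 (hE he)
    simp
  rw [hstar, sum_powerset_apply_card, card_starEdges hz, ← hc, ← sum_powerset_apply_card]
  obtain ⟨e, he, f, hf, hef⟩ : ∃ e ∈ G, ∃ f ∈ G, ¬ (e ∩ f).Nonempty := by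
    by_contra! h
    exact hG fun e he f hf => h e he f hf
  have hne : e ≠ f := by
    rintro rfl
    rw [inter_self, not_nonempty_iff_eq_empty] at hef
    have := h2 e he
    simp [hef] at this
  refine sum_lt_sum (fun E _ => card_withEdges_le_starCount hn E) ⟨{e, f}, ?_, ?_⟩
  · simp [insert_subset_iff, he, hf]
  · rw [withEdges_eq_empty_of_not_meets fun h => hef (h e (by simp) f (by simp)), card_empty,
      card_pair hne]
    exact starCount_two_pos hn hs hs'

end StarComparison

section Degrees
variable {α : Type*} [Fintype α] [DecidableEq α] {s : ℕ}

/-- The members of `G` containing `v`. -/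
def edgesAt (G : Finset (Finset α)) (v : α) : Finset (Finset α) := {e ∈ G | v ∈ e}

omit [Fintype α] in
theorem mem_edgesAt {G : Finset (Finset α)} {v : α} {e : Finset α} :
    e ∈ edgesAt G v ↔ e ∈ G ∧ v ∈ e := by
  simp [edgesAt]

/-- The triples all of whose pairs belong to `G`. -/
def triangles (G : Finset (Finset α)) : Finset (Finset α) := {T | #T = 3 ∧ powersetCard 2 T ⊆ G}

theorem mem_triangles {G : Finset (Finset α)} {T : Finset α} :
    T ∈ triangles G ↔ #T = 3 ∧ powersetCard 2 T ⊆ G := by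
  simp [triangles]

omit [Fintype α] in
theorem triangle_no_center {T : Finset α} (hT : #T = 3) (z : α) :
    ¬ ∀ e ∈ powersetCard 2 T, z ∈ e := by
  intro h
  obtain ⟨e, he, he2⟩ := exists_subset_card_eq (s := T.erase z) (n := 2) (by
    have := pred_card_le_card_erase (s := T) (a := z)
    lia)
  exact notMem_erase z T (he (h e (mem_powersetCard.2 ⟨he.trans (erase_subset _ _), he2⟩)))

omit [Fintype α] in
theorem center_unique {E : Finset (Finset α)} (h2 : ∀ e ∈ E, #e = 2) (hE : 2 ≤ #E) {u v : α}
    (hu : ∀ e ∈ E, u ∈ e) (hv : ∀ e ∈ E, v ∈ e) : u = v := by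
  by_contra huv
  have : E ⊆ {{u, v}} := fun e he =>
    mem_singleton.2 (eq_pair_of_mem (h2 e he) (hu e he) (hv e he) huv)
  have := card_le_card this
  rw [card_singleton] at this
  lia

theorem card_withEdges_eq_sum [Nonempty α] {E : Finset (Finset α)} (h2 : ∀ e ∈ E, #e = 2)
    (hE : 2 ≤ #E) :
    #(withEdges s E) = ∑ v : α, (if ∀ e ∈ E, v ∈ e then starCount α s #E else 0) +
      ∑ T : Finset α, (if #T = 3 ∧ powersetCard 2 T = E then triangleCount α s else 0) := by
  by_cases hm : Meets E
  · rcases exists_center_or_eq_triangle h2 hm with ⟨z, hz⟩ | ⟨T, hT, rfl⟩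
    · rw [sum_eq_single z, if_pos hz, sum_eq_zero, add_zero, card_withEdges_of_center h2 hz]
      · intro T _
        rw [if_neg]
        rintro ⟨hT, rfl⟩
        exact triangle_no_center hT z hz
      · intro v _ hv
        exact if_neg fun h => hv (center_unique h2 hE h hz)
      · simp
    · rw [sum_eq_zero, zero_add, sum_eq_single T, if_pos ⟨hT, rfl⟩, card_withEdges_triangle hT]
      · intro T' _ hne
        rw [if_neg]
        rintro ⟨-, h⟩
        apply hne
        rw [← powersetCard_sup T' 1 (by
          have := card_le_card (h ▸ Subset.refl _ : powersetCard 2 T ⊆ powersetCard 2 T')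
          rw [card_powersetCard, card_powersetCard, hT] at this
          by_contra! hlt
          interval_cases h : #T' <;> simp [Nat.choose] at this), 
          show powersetCard (Nat.succ 1) T' = powersetCard 2 T from h]
        exact powersetCard_sup T 1 (by lia)
      · simp
      · intro v _
        exact if_neg (triangle_no_center hT v)
  · have hv : ∀ v ∈ (univ : Finset α), (if ∀ e ∈ E, v ∈ e then starCount α s #E else 0) = 0 :=
      fun v _ => if_neg fun h => hm fun e he f hf => ⟨v, mem_inter.2 ⟨h e he, h f hf⟩⟩
    rw [withEdges_eq_empty_of_not_meets hm, card_empty, sum_eq_zero hv, zero_add, sum_eq_zero]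
    intro T _
    rw [if_neg]
    rintro ⟨hT, rfl⟩
    apply hm
    intro e he f hf
    obtain ⟨he, he2⟩ := mem_powersetCard.1 he
    obtain ⟨hf, hf2⟩ := mem_powersetCard.1 hf
    by_contra h
    rw [not_nonempty_iff_eq_empty, ← disjoint_iff_inter_eq_empty] at h
    have h1 := card_union_of_disjoint h
    have h2 := card_le_card (union_subset he hf)
    lia

/-- The contribution to the number of intersecting families of size `s` of the stars with at least
two edges and of the triangles in a graph `G`. -/
theorem sum_card_withEdges_eq [Nonempty α] {G : Finset (Finset α)} (h2 : ∀ e ∈ G, #e = 2) :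
    ∑ E ∈ G.powerset, #(withEdges s E) =
      ∑ k ∈ range (#G + 1), (#G).choose k * (if k < 2 then starCount α s k else 0) +
      ∑ v : α, ∑ k ∈ range (Fintype.card α + 1),
        (#(edgesAt G v)).choose k * (if k < 2 then 0 else starCount α s k) +
      #(triangles G) * triangleCount α s := by
  have hpt : ∀ E ∈ G.powerset, #(withEdges s E) =
      (if #E < 2 then starCount α s #E else 0) +
      (∑ v : α, (if ∀ e ∈ E, v ∈ e then (if #E < 2 then 0 else starCount α s #E) else 0) +
      ∑ T : Finset α, (if #T = 3 ∧ powersetCard 2 T = E then triangleCount α s else 0)) := by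
    intro E hE
    have hE := mem_powerset.1 hE
    have h2' : ∀ e ∈ E, #e = 2 := fun e he => h2 e (hE he)
    by_cases hlt : #E < 2
    · have hc : ∃ z, ∀ e ∈ E, z ∈ e := by
        rcases E.eq_empty_or_nonempty with rfl | ⟨e, he⟩
        · simp
        · obtain ⟨z, hz⟩ : e.Nonempty := card_pos.1 (by rw [h2' e he]; lia)
          exact ⟨z, fun f hf => card_le_one.1 (by lia : #E ≤ 1) e he f hf ▸ hz⟩
      obtain ⟨z, hz⟩ := hc
      simp only [hlt, if_true, ite_self, sum_const_zero, zero_add]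
      rw [sum_eq_zero, add_zero, card_withEdges_of_center h2' hz]
      intro T _
      rw [if_neg]
      rintro ⟨hT, rfl⟩
      exact triangle_no_center hT z hz
    · simp only [hlt, if_false, zero_add]
      exact card_withEdges_eq_sum h2' (by lia)
  rw [sum_congr rfl hpt, sum_add_distrib, sum_add_distrib, ← add_assoc,
    sum_powerset_apply_card (fun k => if k < 2 then starCount α s k else 0)]
  simp only [smul_eq_mul]
  congr 1
  · congr 1
    rw [sum_comm]
    refine sum_congr rfl fun v _ => ?_
    rw [← sum_filter]
    have : G.powerset.filter (fun E => ∀ e ∈ E, v ∈ e) = (edgesAt G v).powerset := by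
      ext E
      simp only [mem_filter, mem_powerset, edgesAt]
      constructor
      · rintro ⟨h, h'⟩ e he
        exact mem_filter.2 ⟨h he, h' e he⟩
      · exact fun h => ⟨fun e he => (mem_filter.1 (h he)).1, fun e he => (mem_filter.1 (h he)).2⟩
    rw [this, sum_powerset_apply_card (fun k => if k < 2 then 0 else starCount α s k)]
    simp only [smul_eq_mul]
    refine sum_subset (range_subset_range.2 ?_) ?_
    · obtain ⟨S, hS, h⟩ := exists_eq_starEdges (E := edgesAt G v) (z := v)
        (fun e he => h2 e (mem_edgesAt.1 he).1) (fun e he => (mem_edgesAt.1 he).2)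
      rw [h, card_starEdges hS]
      exact Nat.succ_le_succ (card_le_univ S)
    · intro k _ hk
      rw [Nat.choose_eq_zero_of_lt (by simpa using hk), zero_mul]
  · rw [sum_comm, triangles, card_filter, sum_mul]
    refine sum_congr rfl fun T _ => ?_
    by_cases hT : #T = 3
    · simp [hT, sum_ite_eq]
    · simp [hT]

end Degrees

section DegreeSums
variable {α : Type*} [Fintype α] [DecidableEq α]

theorem sum_sum_edgesAt (H : Finset (Finset α)) (f : α → ℕ) :
    ∑ v, #(edgesAt H v) * f v = ∑ e ∈ H, ∑ v ∈ e, f v := by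
  simp only [edgesAt, card_filter, sum_mul]
  rw [sum_comm]
  refine sum_congr rfl fun e _ => ?_
  simp

theorem sum_card_edgesAt {H : Finset (Finset α)} (h2 : ∀ e ∈ H, #e = 2) :
    ∑ v, #(edgesAt H v) = 2 * #H := by
  have h := sum_sum_edgesAt H fun _ => 1
  simp only [mul_one, sum_const, smul_eq_mul] at h
  rw [h, sum_congr rfl h2, sum_const, smul_eq_mul, mul_comm]

theorem sum_sq_card_edgesAt_le {H : Finset (Finset α)} (h2 : ∀ e ∈ H, #e = 2) :
    ∑ v, #(edgesAt H v) ^ 2 ≤ #H * (#H + 1) := by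
  simp only [sq]
  rw [sum_sum_edgesAt H fun v => #(edgesAt H v)]
  refine sum_le_card_nsmul _ _ _ fun e he => ?_
  obtain ⟨u, v, huv, rfl⟩ := card_eq_two.1 (h2 e he)
  rw [sum_pair huv, ← card_union_add_card_inter]
  refine Nat.add_le_add (card_le_card fun e he => ?_) (card_le_one.2 fun e he f hf => ?_)
  · rcases mem_union.1 he with h | h <;> exact (mem_edgesAt.1 h).1
  · simp only [mem_inter, mem_edgesAt] at he hf
    rw [eq_pair_of_mem (h2 e he.1.1) he.1.2 he.2.2 huv,
      eq_pair_of_mem (h2 f hf.1.1) hf.1.2 hf.2.2 huv]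

omit [Fintype α] in
theorem card_edgesAt_inter_le {H : Finset (Finset α)} (h2 : ∀ e ∈ H, #e = 2) {z v : α}
    (hv : v ≠ z) : #(edgesAt (edgesAt H z) v) ≤ 1 := by
  refine card_le_one.2 fun e he f hf => ?_
  simp only [mem_edgesAt] at he hf
  rw [eq_pair_of_mem (h2 e he.1.1) he.2 he.1.2 hv, eq_pair_of_mem (h2 f hf.1.1) hf.2 hf.1.2 hv]

theorem sum_sq_card_edgesAt_le_of_mem {H : Finset (Finset α)} (h2 : ∀ e ∈ H, #e = 2) (z : α)
    {c t : ℕ} (hc : #(edgesAt H z) = c) (ht : #H = c + t) :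
    ∑ v, #(edgesAt H v) ^ 2 ≤ c ^ 2 + c + 4 * t + t * (t + 1) := by
  set K := H \ edgesAt H z with hK
  have hK2 : ∀ e ∈ K, #e = 2 := fun e he => h2 e (mem_sdiff.1 he).1
  have hKc : #K = t := by
    rw [hK, card_sdiff_of_subset (show edgesAt H z ⊆ H from filter_subset _ _), hc, ht]
    lia
  have hsplit : ∀ v, #(edgesAt H v) = #(edgesAt (edgesAt H z) v) + #(edgesAt K v) := by
    intro v
    rw [← card_union_of_disjoint]
    · congr 1
      ext e
      simp only [mem_edgesAt, mem_union, hK, mem_sdiff]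
      tauto
    · rw [disjoint_left]
      intro e he hf
      simp only [mem_edgesAt, hK, mem_sdiff] at he hf
      tauto
  have hKz : #(edgesAt K z) = 0 := by
    rw [card_eq_zero]
    refine eq_empty_of_forall_notMem fun e he => ?_
    simp only [mem_edgesAt, hK, mem_sdiff] at he
    tauto
  have hHz : #(edgesAt (edgesAt H z) z) = c := by
    rw [← hc]
    have := hsplit z
    lia
  have hA : ∑ v ∈ univ.erase z, #(edgesAt (edgesAt H z) v) = c := by
    have h := sum_card_edgesAt (H := edgesAt H z) fun e he => h2 e (mem_edgesAt.1 he).1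
    rw [← add_sum_erase _ _ (mem_univ z), hHz, hc] at h
    lia
  have hB : ∑ v ∈ univ.erase z, #(edgesAt K v) = 2 * t := by
    have h := sum_card_edgesAt hK2
    rw [← add_sum_erase _ _ (mem_univ z), hKz, hKc] at h
    lia
  have hC : ∑ v ∈ univ.erase z, #(edgesAt K v) ^ 2 ≤ t * (t + 1) :=
    (sum_le_sum_of_subset (erase_subset _ _)).trans (hKc ▸ sum_sq_card_edgesAt_le hK2)
  rw [← add_sum_erase _ _ (mem_univ z), hc]
  have hpt : ∀ v ∈ univ.erase z, #(edgesAt H v) ^ 2 ≤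
      #(edgesAt (edgesAt H z) v) + 2 * #(edgesAt K v) + #(edgesAt K v) ^ 2 := by
    intro v hv
    have h1 := card_edgesAt_inter_le h2 (mem_erase.1 hv).1
    rw [hsplit v]
    interval_cases #(edgesAt (edgesAt H z) v)
    · nlinarith
    · nlinarith
  have := sum_le_sum hpt
  rw [sum_add_distrib, sum_add_distrib, ← mul_sum, hA, hB] at this
  lia

theorem card_edgesAt_lt {H : Finset (Finset α)} (h2 : ∀ e ∈ H, #e = 2) {v : α}
    (hv : #(edgesAt H v) ≠ 0) : #(edgesAt H v) < #{u | #(edgesAt H u) ≠ 0} := by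
  obtain ⟨S, hS, h⟩ := exists_eq_starEdges (E := edgesAt H v) (z := v)
    (fun e he => h2 e (mem_edgesAt.1 he).1) (fun e he => (mem_edgesAt.1 he).2)
  rw [h, card_starEdges hS, ← Nat.succ_le_iff, Nat.succ_eq_add_one, ← card_insert_of_notMem hS]
  refine card_le_card fun u hu => ?_
  simp only [mem_filter, mem_univ, true_and]
  rcases mem_insert.1 hu with rfl | hu
  · exact hv
  · have : {v, u} ∈ edgesAt H v := h ▸ mem_starEdges.2 ⟨u, hu, rfl⟩
    exact card_ne_zero_of_mem (mem_edgesAt.2 ⟨(mem_edgesAt.1 this).1, by simp⟩)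

/-- In a graph with one edge less than vertices and some isolated vertices, the sum of the
squares of the degrees is considerably smaller than in a star. -/
theorem sum_sq_card_edgesAt_lt {H : Finset (Finset α)} (h2 : ∀ e ∈ H, #e = 2) {n q : ℕ}
    (hα : Fintype.card α = n) (hn : 21 ≤ n) (hH : #H = n - 1)
    (hq : #{v | #(edgesAt H v) = 0} = q) (hq0 : 1 ≤ q) :
    (7 * q * (n - 1) * (n - 2) : ℤ) <
      4 * (n * (n - 1) - ∑ v, (#(edgesAt H v) : ℤ) ^ 2) * (4 * n - 13) := by
  obtain ⟨r, hr⟩ : ∃ r, #{v | #(edgesAt H v) ≠ 0} = r := ⟨_, rfl⟩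
  have hqr : q + r = n := by
    rw [← hq, ← hr, ← hα, card_filter_add_card_filter_not, card_univ]
  have hsum : (∑ v, (#(edgesAt H v) : ℤ)) = 2 * (n - 1) := by
    have := sum_card_edgesAt h2
    rw [hH] at this
    have h' : ((∑ v, #(edgesAt H v) : ℕ) : ℤ) = ((2 * (n - 1) : ℕ) : ℤ) := by rw [this]
    push_cast [Nat.cast_sub (by lia : 1 ≤ n)] at h'
    exact h'
  have hlt : ∀ v, #(edgesAt H v) ≠ 0 → #(edgesAt H v) < r := fun v hv => hr ▸ card_edgesAt_lt h2 hv
  obtain ⟨z, -, hz⟩ := exists_max_image univ (fun v => #(edgesAt H v))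
    (card_pos.1 (by rw [card_univ]; lia))
  simp only [mem_univ, forall_const] at hz
  obtain ⟨c, hc⟩ : ∃ c, #(edgesAt H z) = c := ⟨_, rfl⟩
  rw [hc] at hz
  have hn' : (21 : ℤ) ≤ n := by exact_mod_cast hn
  have hq' : (1 : ℤ) ≤ q := by exact_mod_cast hq0
  set Q := ∑ v, (#(edgesAt H v) : ℤ) ^ 2 with hQ
  have hc0 : c ≠ 0 := by
    rintro rfl
    have : ∑ v, (#(edgesAt H v) : ℤ) = 0 :=
      sum_eq_zero fun v _ => by have := hz v; simp only [Nat.cast_eq_zero]; lia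
    lia
  rcases le_or_gt (n + 1) (2 * q) with h | h
  · have hQle : Q ≤ r * (2 * (n - 1)) - r * (r - 1) := by
      have hpt : ∀ v ∈ ({v | #(edgesAt H v) ≠ 0} : Finset α), (#(edgesAt H v) : ℤ) ^ 2 ≤
          r * #(edgesAt H v) - (r - 1) := by
        intro v hv
        have h0 := (mem_filter.1 hv).2
        have h1 : (1 : ℤ) ≤ #(edgesAt H v) := by lia
        have h2 : (#(edgesAt H v) : ℤ) ≤ r - 1 := by have := hlt v h0; lia
        nlinarith
      have h1 : ∀ f : α → ℤ, (∀ v, #(edgesAt H v) = 0 → f v = 0) →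
          ∑ v ∈ ({v | #(edgesAt H v) ≠ 0} : Finset α), f v = ∑ v, f v := by
        intro f hf
        refine sum_subset (subset_univ _) fun v _ hv => hf v ?_
        simpa using hv
      have := sum_le_sum hpt
      rw [sum_sub_distrib, ← mul_sum, sum_const, hr, h1 _ (by simp +contextual),
        h1 _ (by simp +contextual), hsum, nsmul_eq_mul] at this
      exact this
    have hr' : (r : ℤ) = n - q := by lia
    rw [hr'] at hQle
    have h2D : (q : ℤ) * (q - 1) ≤ n * (n - 1) - Q := by nlinarith
    have h3 : (n : ℤ) + 1 ≤ 2 * q := by exact_mod_cast h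
    have h4 : (7 * (n - 1) * (n - 2) : ℤ) < 4 * (q - 1) * (4 * n - 13) := by nlinarith
    have h5 := mul_le_mul_of_nonneg_right h2D (by linarith : (0 : ℤ) ≤ 4 * (4 * n - 13))
    have h6 := mul_lt_mul_of_pos_left h4 (by linarith : (0 : ℤ) < q)
    linarith
  · have h3 : (2 * q : ℤ) ≤ n := by exact_mod_cast (by lia : 2 * q ≤ n)
    rcases le_or_gt (3 * c) n with hc3 | hc3
    · have hc3' : (3 * c : ℤ) ≤ n := by exact_mod_cast hc3
      have hQle : Q ≤ c * (2 * (n - 1)) := by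
        rw [← hsum, mul_sum]
        refine sum_le_sum fun v _ => ?_
        have : (#(edgesAt H v) : ℤ) ≤ c := by exact_mod_cast hz v
        nlinarith
      have h2D : (n * (n - 1) : ℤ) ≤ 3 * (n * (n - 1) - Q) := by nlinarith
      have h5 := mul_le_mul_of_nonneg_right h2D (by linarith : (0 : ℤ) ≤ 4 * (4 * n - 13))
      have h6 : (7 * q * (n - 1) * (n - 2) : ℤ) * 2 ≤ 7 * n * (n - 1) * (n - 2) := by
        have := mul_le_mul_of_nonneg_right h3
          (by nlinarith : (0 : ℤ) ≤ 7 * ((n - 1) * (n - 2)))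
        linarith
      have h7 : (21 * (n - 2) : ℤ) < 8 * (4 * n - 13) := by linarith
      have h8 := mul_lt_mul_of_pos_left h7 (by nlinarith : (0 : ℤ) < n * (n - 1))
      linarith
    · have hcr := hlt z (by lia)
      rw [hc] at hcr
      obtain ⟨t, ht⟩ : ∃ t, n = c + t + 1 := ⟨n - 1 - c, by lia⟩
      have hqt : q ≤ t := by lia
      have hQle : Q ≤ c ^ 2 + c + 4 * t + t * (t + 1) := by
        have := sum_sq_card_edgesAt_le_of_mem h2 z hc (by lia : #H = c + t)
        rw [hQ]
        exact_mod_cast this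
      have ht' : (t : ℤ) = n - c - 1 := by lia
      have hqt' : (q : ℤ) ≤ t := by exact_mod_cast hqt
      have hc' : (n : ℤ) + 1 ≤ 3 * c := by exact_mod_cast hc3
      have h2D : (2 * (t * (c - 2)) : ℤ) ≤ n * (n - 1) - Q := by
        have : (n : ℤ) = c + t + 1 := by exact_mod_cast ht
        rw [this]
        linarith
      have h5 := mul_le_mul_of_nonneg_right h2D (by linarith : (0 : ℤ) ≤ 4 * (4 * n - 13))
      have h6 : (7 * (n - 1) * (n - 2) : ℤ) < 8 * (c - 2) * (4 * n - 13) := by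
        have h9 := mul_le_mul_of_nonneg_right hc' (by linarith : (0 : ℤ) ≤ 4 * n - 13)
        have h10 := mul_le_mul_of_nonneg_right hn' (by linarith : (0 : ℤ) ≤ n)
        linarith
      have h7 : (q * (8 * (c - 2) * (4 * n - 13)) : ℤ) ≤ t * (8 * (c - 2) * (4 * n - 13)) :=
        mul_le_mul_of_nonneg_right hqt'
          (mul_nonneg (by linarith) (by linarith))
      have h8 := mul_lt_mul_of_pos_left h6 (by linarith : (0 : ℤ) < q)
      linarith

end DegreeSums

section BinomialSums

theorem choose_two_mul_choose_le {d m : ℕ} (hdm : d ≤ m) {k : ℕ} (hk : 2 ≤ k) :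
    m.choose 2 * d.choose k ≤ d.choose 2 * m.choose k := by
  induction k, hk using Nat.le_induction with
  | base => rw [mul_comm]
  | succ k hk ih =>
    refine Nat.le_of_mul_le_mul_right (c := k + 1) ?_ (Nat.succ_pos k)
    rw [mul_assoc, mul_assoc, Nat.choose_succ_right_eq, Nat.choose_succ_right_eq, ← mul_assoc,
      ← mul_assoc]
    exact Nat.mul_le_mul ih (Nat.sub_le_sub_right hdm k)

theorem choose_two_mul_choose_succ (m k : ℕ) :
    (m.choose 2 : ℚ) * (m + 1).choose k =
      (m + 1).choose 2 * m.choose k + m / 2 * ((k : ℚ) - 2) * (m + 1).choose k := by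
  have h1 : (m.choose 2 : ℚ) = m * (m - 1) / 2 := Nat.cast_choose_two ℚ m
  have h2 : ((m + 1).choose 2 : ℚ) = (m + 1) * m / 2 := by
    rw [Nat.cast_choose_two]; push_cast; ring
  have h3 : (m.choose k : ℚ) * (m + 1) = (m + 1).choose k * ((m : ℚ) + 1 - k) := by
    rcases le_or_gt k (m + 1) with h | h
    · have := Nat.choose_mul_succ_eq m k
      have h' : ((m.choose k * (m + 1) : ℕ) : ℚ) = (((m + 1).choose k * (m + 1 - k) : ℕ) : ℚ) := by
        rw [this]
      push_cast [Nat.cast_sub h] at h'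
      exact h'
    · rw [Nat.choose_eq_zero_of_lt h, Nat.choose_eq_zero_of_lt (by lia)]
      simp
  rw [h1, h2]
  linear_combination (-(m : ℚ) / 2) * h3

/-- A bounded partial sum of the series `∑ (k - 2) / k! = 3 - e`. -/
theorem sum_sub_two_div_factorial_le {K : ℕ} (hK : 4 ≤ K) :
    ∑ k ∈ range (K + 1), (if k < 3 then 0 else ((k : ℚ) - 2) / k.factorial) ≤
      7 / 24 - 1 / K.factorial := by
  induction K, hK using Nat.le_induction with
  | base => norm_num [sum_range_succ, Nat.factorial]
  | succ K hK ih =>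
    rw [sum_range_succ, if_neg (by lia)]
    have hpos : (0 : ℚ) < K.factorial := by exact_mod_cast K.factorial_pos
    have h : ((K + 1 : ℕ) - 2 : ℚ) / (K + 1).factorial + 1 / (K + 1).factorial ≤ 1 / K.factorial := by
      rw [Nat.factorial_succ]
      push_cast
      rw [← add_div, div_le_div_iff₀ (by positivity) hpos]
      nlinarith
    linarith

theorem descFactorial_mul_le {g : ℕ → ℕ} {m : ℕ} (hg : ∀ k ≤ m, (m + 1 - k) * g (k + 1) ≤ g k)
    {k : ℕ} (hk : 3 ≤ k) :
    (m + 1).descFactorial k * g k ≤ (m + 1).descFactorial 3 * g 3 := by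
  induction k, hk using Nat.le_induction with
  | base => exact le_rfl
  | succ k hk ih =>
    refine le_trans ?_ ih
    rcases le_or_gt k m with h | h
    · rw [Nat.descFactorial_succ, mul_comm (m + 1 - k), mul_assoc]
      exact Nat.mul_le_mul_left _ (hg k h)
    · rw [Nat.descFactorial_eq_zero_iff_lt.2 (by lia), zero_mul]
      exact Nat.zero_le _

variable {ι : Type*} [Fintype ι]

theorem sum_choose_mul_le {d : ι → ℕ} {m q : ℕ} (hd : ∀ v, d v ≤ m + 1)
    (hq : #{v | d v = m + 1} = q) {k : ℕ} (hk : 2 ≤ k) :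
    (m.choose 2 : ℚ) * ∑ v, ((d v).choose k : ℚ) ≤
      m.choose k * ∑ v, ((d v).choose 2 : ℚ) + q * (m / 2 * ((k : ℚ) - 2) * (m + 1).choose k) := by
  have hpt : ∀ v, (m.choose 2 : ℚ) * (d v).choose k ≤ m.choose k * (d v).choose 2 +
      (if d v = m + 1 then m / 2 * ((k : ℚ) - 2) * (m + 1).choose k else 0) := by
    intro v
    split_ifs with h
    · rw [h, choose_two_mul_choose_succ, mul_comm ((m + 1).choose 2 : ℚ)]
    · have := choose_two_mul_choose_le (d := d v) (m := m) (by have := hd v; lia) hk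
      rw [add_zero, mul_comm (m.choose k : ℚ)]
      exact_mod_cast this
  have := sum_le_sum fun v (_ : v ∈ univ) => hpt v
  rw [← mul_sum, sum_add_distrib, ← mul_sum, ← sum_filter, sum_const, hq, nsmul_eq_mul] at this
  exact this

/-- A weighted sum of binomial coefficients of degrees is smaller than for a clique missing one
vertex, provided that the weights decay quickly. -/
theorem sum_sum_choose_lt {d : ι → ℕ} {g : ℕ → ℕ} {m q : ℕ} (hm : 4 ≤ m) (hd : ∀ v, d v ≤ m + 1)
    (hq : #{v | d v = m + 1} = q) (hg : ∀ k ≤ m, (m + 1 - k) * g (k + 1) ≤ g k) (hg2 : 0 < g 2)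
    (hD : (7 * q * (m + 1) * m : ℚ) <
      8 * ((m + 1) * m.choose 2 - ∑ v, ((d v).choose 2 : ℚ)) * (4 * m - 5)) :
    ∑ v, ∑ k ∈ range (m + 3), (d v).choose k * (if k < 2 then 0 else g k) <
      (m + 1) * ∑ k ∈ range (m + 3), m.choose k * (if k < 2 then 0 else g k) := by
  set D : ℚ := (m + 1) * m.choose 2 - ∑ v, ((d v).choose 2 : ℚ) with hDdef
  have hm' : (4 : ℚ) ≤ m := by exact_mod_cast hm
  have hD0 : 0 < D := by
    by_contra! h
    have h1 : (0 : ℚ) ≤ 7 * q * (m + 1) * m := by positivity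
    have h2 : 8 * D * (4 * m - 5) ≤ 0 :=
      mul_nonpos_of_nonpos_of_nonneg (by linarith) (by linarith)
    linarith
  have hM : (m.choose 2 : ℚ) = m * (m - 1) / 2 := Nat.cast_choose_two ℚ m
  have hM0 : (0 : ℚ) < m.choose 2 := by exact_mod_cast Nat.choose_pos (by lia)
  have hg3 : ((m : ℚ) - 1) * g 3 ≤ g 2 := by
    have := hg 2 (by lia)
    have h' : (((m + 1 - 2) * g 3 : ℕ) : ℚ) ≤ (g 2 : ℚ) := by exact_mod_cast this
    rw [show m + 1 - 2 = m - 1 by lia] at h'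
    push_cast [Nat.cast_sub (by lia : 1 ≤ m)] at h'
    exact h'
  have hpt : ∀ k ∈ range (m + 3),
      (∑ v, ((d v).choose k : ℚ) - (m + 1) * m.choose k) * (if k < 2 then 0 else (g k : ℚ)) ≤
        (if k = 2 then -D * g 2 else 0) + (if k = 3 then -(D * (m - 2) / 3 * g 3) else 0) +
        q * m * (m + 1) * g 3 * (if k < 3 then 0 else ((k : ℚ) - 2) / k.factorial) := by
    intro k _
    rcases lt_trichotomy k 2 with hk | rfl | hk
    · simp [hk, show k < 3 by lia, show k ≠ 2 by lia, show k ≠ 3 by lia]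
    · simp [hDdef]
    · have hk' : (3 : ℚ) ≤ k := by exact_mod_cast hk
      have h1 := sum_choose_mul_le hd hq (k := k) (by lia)
      have hfac : ((m + 1).choose k : ℚ) * g k * k.factorial ≤ (m + 1) * m * (m - 1) * g 3 := by
        have := descFactorial_mul_le hg (k := k) hk
        rw [Nat.descFactorial_eq_factorial_mul_choose] at this
        have h' : ((k.factorial * (m + 1).choose k * g k : ℕ) : ℚ) ≤
            (((m + 1).descFactorial 3 * g 3 : ℕ) : ℚ) := by exact_mod_cast this
        rw [show (m + 1).descFactorial 3 = (m - 1) * (m * (m + 1)) by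
          simp [Nat.descFactorial_succ, show m + 1 - 2 = m - 1 by lia]] at h'
        push_cast [Nat.cast_sub (by lia : 1 ≤ m)] at h'
        linarith
      have hkf : (0 : ℚ) < k.factorial := by exact_mod_cast k.factorial_pos
      have hfac' : ((m + 1).choose k : ℚ) * g k ≤ (m + 1) * m * (m - 1) * g 3 / k.factorial := by
        rwa [le_div_iff₀ hkf]
      have hsum : ∑ v, ((d v).choose 2 : ℚ) = (m + 1) * m.choose 2 - D := by rw [hDdef]; ring
      rw [hsum] at h1
      have h2 : (m.choose 2 : ℚ) * (∑ v, ((d v).choose k : ℚ) - (m + 1) * m.choose k) ≤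
          -D * m.choose k + q * (m / 2 * ((k : ℚ) - 2) * (m + 1).choose k) := by linarith
      have h3 := mul_le_mul_of_nonneg_right h2 (Nat.cast_nonneg (α := ℚ) (g k))
      have h4 := mul_le_mul_of_nonneg_left hfac'
        (by have : (0 : ℚ) ≤ k - 2 := by linarith
            positivity : (0 : ℚ) ≤ q * (m / 2 * ((k : ℚ) - 2)))
      have h5 : (m.choose 2 : ℚ) * ((∑ v, ((d v).choose k : ℚ) - (m + 1) * m.choose k) * g k) ≤
          m.choose 2 * (-D * m.choose k * g k / m.choose 2 +
            q * m * (m + 1) * g 3 * (((k : ℚ) - 2) / k.factorial)) := by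
        rw [mul_add, mul_div_cancel₀ _ hM0.ne']
        have h6 : (m.choose 2 : ℚ) * (q * m * (m + 1) * g 3 * (((k : ℚ) - 2) / k.factorial)) =
            q * (m / 2 * ((k : ℚ) - 2)) * ((m + 1) * m * (m - 1) * g 3 / k.factorial) := by
          rw [hM]; ring
        rw [h6]
        linarith
      have h7 := le_of_mul_le_mul_left h5 hM0
      rw [if_neg (by lia : ¬ k < 2), if_neg (by lia : ¬ k = 2), if_neg (by lia : ¬ k < 3), zero_add]
      refine h7.trans (add_le_add_left ?_ _)
      split_ifs with h3
      · subst h3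
        have hc : (m.choose 3 : ℚ) * 3 = m.choose 2 * (m - 2) := by
          have := Nat.choose_succ_right_eq m 2
          have h' : ((m.choose 3 * 3 : ℕ) : ℚ) = ((m.choose 2 * (m - 2) : ℕ) : ℚ) := by
            exact_mod_cast this
          push_cast [Nat.cast_sub (by lia : 2 ≤ m)] at h'
          exact h'
        rw [div_le_iff₀ hM0]
        apply le_of_eq
        linear_combination (-D * g 3 / 3) * hc
      · rw [div_le_iff₀ hM0, zero_mul]
        have : 0 ≤ D * m.choose k * g k := by positivity
        linarith
  have hsum := sum_le_sum hpt
  rw [sum_add_distrib, sum_add_distrib, sum_ite_eq', sum_ite_eq', if_pos (by simp),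
    if_pos (by simp; lia), ← mul_sum] at hsum
  have hfs := sum_sub_two_div_factorial_le (K := m + 2) (by lia)
  have hfs' : ∑ k ∈ range (m + 3), (if k < 3 then 0 else ((k : ℚ) - 2) / k.factorial) ≤ 7 / 24 := by
    have : (0 : ℚ) ≤ 1 / (m + 2).factorial := by positivity
    exact hfs.trans (by linarith)
  have hfs2 := mul_le_mul_of_nonneg_left hfs'
    (by positivity : (0 : ℚ) ≤ q * m * (m + 1) * g 3)
  have hneg : -D * g 2 + -(D * (m - 2) / 3 * g 3) + q * m * (m + 1) * g 3 * (7 / 24) < 0 := by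
    have hg2' : (0 : ℚ) < g 2 := by exact_mod_cast hg2
    have h1 := mul_le_mul_of_nonneg_left hg3 hD0.le
    rcases Nat.eq_zero_or_pos (g 3) with h0 | h0
    · rw [h0]
      have := mul_pos hD0 hg2'
      simp
      linarith
    · have h0' : (0 : ℚ) < g 3 := by exact_mod_cast h0
      have h2 := mul_lt_mul_of_pos_right hD h0'
      linarith
  have hfinal : ∑ k ∈ range (m + 3),
      (∑ v, ((d v).choose k : ℚ) - (m + 1) * m.choose k) * (if k < 2 then 0 else (g k : ℚ)) < 0 := by
    linarith
  simp only [sub_mul, sum_sub_distrib, sum_mul] at hfinal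
  rw [sum_comm, sub_neg] at hfinal
  simp only [mul_assoc, ← mul_sum] at hfinal
  exact_mod_cast hfinal

end BinomialSums

section Clique
variable {α : Type*} [Fintype α] [DecidableEq α] {s : ℕ}

omit [Fintype α] in
theorem edgesAt_powersetCard {T : Finset α} {v : α} (hv : v ∈ T) :
    edgesAt (powersetCard 2 T) v = starEdges v (T.erase v) := by
  ext e
  rw [mem_edgesAt, mem_powersetCard, mem_starEdges]
  constructor
  · rintro ⟨⟨h1, h2⟩, h3⟩
    obtain ⟨j, hj⟩ := card_eq_one.1 (show #(e.erase v) = 1 by rw [card_erase_of_mem h3, h2])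
    have hj' : j ∈ e.erase v := hj ▸ mem_singleton_self j
    exact ⟨j, erase_subset_erase v h1 hj', by rw [← insert_erase h3, hj]⟩
  · rintro ⟨j, hj, rfl⟩
    have hj := mem_erase.1 hj
    exact ⟨⟨by simp [insert_subset_iff, hv, hj.2], card_pair hj.1.symm⟩, by simp⟩

omit [Fintype α] in
theorem card_edgesAt_powersetCard {T : Finset α} {v : α} (hv : v ∈ T) :
    #(edgesAt (powersetCard 2 T) v) = #T - 1 := by
  rw [edgesAt_powersetCard hv, card_starEdges (notMem_erase v T), card_erase_of_mem hv]

omit [Fintype α] in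
theorem card_edgesAt_add_card_edgesAt_sdiff {G P : Finset (Finset α)} (h : G ⊆ P) (v : α) :
    #(edgesAt G v) + #(edgesAt (P \ G) v) = #(edgesAt P v) := by
  rw [← card_union_of_disjoint]
  · congr 1
    ext e
    have := @h e
    simp only [mem_edgesAt, mem_union, mem_sdiff]
    tauto
  · rw [disjoint_left]
    intro e he hf
    simp only [mem_edgesAt, mem_sdiff] at he hf
    tauto

theorem three_mul_card_triangles_le (G : Finset (Finset α)) :
    3 * #(triangles G) ≤ ∑ v, (#(edgesAt G v)).choose 2 := by
  have h := sum_sum_edgesAt (triangles G) fun _ => 1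
  simp only [mul_one, sum_const, smul_eq_mul] at h
  rw [sum_congr rfl fun T hT => (mem_triangles.1 hT).1, sum_const, smul_eq_mul, mul_comm] at h
  rw [← h]
  refine sum_le_sum fun v _ => ?_
  rw [← card_powersetCard]
  refine card_le_card_of_injOn (fun T => edgesAt (powersetCard 2 T) v) ?_ ?_
  · intro T hT
    obtain ⟨hT, hv⟩ := mem_edgesAt.1 (mem_coe.1 hT)
    obtain ⟨hT3, hTG⟩ := mem_triangles.1 hT
    simp only [mem_coe, mem_powersetCard]
    exact ⟨filter_subset_filter _ hTG, by rw [card_edgesAt_powersetCard hv, hT3]⟩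
  · intro T hT T' hT' heq
    have hv := (mem_edgesAt.1 (mem_coe.1 hT)).2
    have hv' := (mem_edgesAt.1 (mem_coe.1 hT')).2
    simp only [edgesAt_powersetCard hv, edgesAt_powersetCard hv'] at heq
    ext x
    by_cases hx : x = v
    · simp [hx, hv, hv']
    · have := pair_mem_starEdges (S := T.erase v) hx
      rw [heq, pair_mem_starEdges hx] at this
      simpa [hx] using this.symm

theorem choose_three_le_card_triangles (R : Finset α) :
    (#R).choose 3 ≤ #(triangles (powersetCard 2 R)) := by
  rw [← card_powersetCard]
  refine card_le_card fun T hT => ?_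
  obtain ⟨h1, h2⟩ := mem_powersetCard.1 hT
  exact mem_triangles.2 ⟨h2, powersetCard_mono h1⟩

/-- The degrees of a graph with a dominating vertex and as many edges as a clique missing one
vertex are far from those of the clique. -/
theorem sum_choose_two_card_edgesAt_lt {G : Finset (Finset α)} (h2 : ∀ e ∈ G, #e = 2) {m q : ℕ}
    (hα : Fintype.card α = m + 2) (hm : 19 ≤ m) (hG : #G = (m + 1).choose 2)
    (hq : #{v | #(edgesAt G v) = m + 1} = q) (hq0 : 1 ≤ q) :
    (7 * q * (m + 1) * m : ℚ) <
      8 * ((m + 1) * m.choose 2 - ∑ v, ((#(edgesAt G v)).choose 2 : ℚ)) * (4 * m - 5) := by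
  set P : Finset (Finset α) := powersetCard 2 univ with hP
  have hGP : G ⊆ P := fun e he => mem_powersetCard.2 ⟨subset_univ e, h2 e he⟩
  have hdeg : ∀ v, #(edgesAt G v) + #(edgesAt (P \ G) v) = m + 1 := fun v => by
    rw [card_edgesAt_add_card_edgesAt_sdiff hGP, hP, card_edgesAt_powersetCard (mem_univ v),
      card_univ, hα]
    rfl
  have hH : #(P \ G) = m + 2 - 1 := by
    rw [card_sdiff_of_subset hGP, hP, card_powersetCard, card_univ, hα, hG,
      show m + 2 = (m + 1) + 1 from rfl, Nat.choose_succ_succ' (m + 1) 1, Nat.choose_one_right]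
    lia
  have hH2 : ∀ e ∈ P \ G, #e = 2 := fun e he => (mem_powersetCard.1 (mem_sdiff.1 he).1).2
  have hq' : #{v | #(edgesAt (P \ G) v) = 0} = q := by
    rw [← hq]
    congr 1
    ext v
    have := hdeg v
    simp only [mem_filter, mem_univ, true_and]
    lia
  have key := sum_sq_card_edgesAt_lt hH2 hα (by lia) hH hq' hq0
  have hsum := sum_card_edgesAt hH2
  have hsum' : ∑ v, (#(edgesAt (P \ G) v) : ℚ) = 2 * (m + 1) := by
    rw [hH] at hsum
    exact_mod_cast hsum
  have key' : ((7 * q * ((m + 2 : ℕ) - 1) * ((m + 2 : ℕ) - 2) : ℤ) : ℚ) <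
      ((4 * ((m + 2 : ℕ) * ((m + 2 : ℕ) - 1) - ∑ v, (#(edgesAt (P \ G) v) : ℤ) ^ 2) *
        (4 * (m + 2 : ℕ) - 13) : ℤ) : ℚ) := by exact_mod_cast key
  push_cast at key'
  have hd : ∀ v, ((#(edgesAt G v)).choose 2 : ℚ) =
      (m + 1) * m / 2 - (2 * m + 1) / 2 * (#(edgesAt (P \ G) v) : ℚ) +
        1 / 2 * (#(edgesAt (P \ G) v) : ℚ) ^ 2 := by
    intro v
    rw [Nat.cast_choose_two]
    have : (#(edgesAt G v) : ℚ) = m + 1 - #(edgesAt (P \ G) v) := by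
      rw [eq_sub_iff_add_eq]
      exact_mod_cast hdeg v
    rw [this]
    ring
  rw [sum_congr rfl fun v _ => hd v, sum_add_distrib, sum_sub_distrib, ← mul_sum, ← mul_sum, hsum',
    sum_const, card_univ, hα, nsmul_eq_mul, Nat.cast_choose_two]
  push_cast
  linarith

theorem sum_card_withEdges_lt_clique (hn : 21 ≤ Fintype.card α) (hs : 2 ≤ s)
    (hs' : s ≤ 2 ^ (Fintype.card α - 1)) {G : Finset (Finset α)} (h2 : ∀ e ∈ G, #e = 2)
    (hG : #G = (Fintype.card α - 1).choose 2) {z : α} (hz : ∀ j ≠ z, {z, j} ∈ G) :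
    ∑ E ∈ G.powerset, #(withEdges s E) <
      ∑ E ∈ (powersetCard 2 (univ.erase z)).powerset, #(withEdges s E) := by
  have : Nonempty α := ⟨z⟩
  obtain ⟨m, hα⟩ : ∃ m, Fintype.card α = m + 2 := ⟨_, (Nat.sub_add_cancel (by lia)).symm⟩
  rw [hα, show m + 2 - 1 = m + 1 by lia] at hG
  have hR : #((univ : Finset α).erase z) = m + 1 := by
    rw [card_erase_of_mem (mem_univ z), card_univ, hα]
    rfl
  have hK2 : ∀ e ∈ powersetCard 2 ((univ : Finset α).erase z), #e = 2 := fun e he =>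
    (mem_powersetCard.1 he).2
  have hKdeg : ∀ v ≠ z, #(edgesAt (powersetCard 2 ((univ : Finset α).erase z)) v) = m := by
    intro v hv
    rw [card_edgesAt_powersetCard (mem_erase.2 ⟨hv, mem_univ v⟩), hR]
    rfl
  have hKz : #(edgesAt (powersetCard 2 ((univ : Finset α).erase z)) z) = 0 := by
    rw [card_eq_zero]
    refine eq_empty_of_forall_notMem fun e he => ?_
    obtain ⟨h1, h2⟩ := mem_edgesAt.1 he
    exact notMem_erase z univ ((mem_powersetCard.1 h1).1 h2)
  have hGP : G ⊆ powersetCard 2 univ := fun e he => mem_powersetCard.2 ⟨subset_univ e, h2 e he⟩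
  have hdle : ∀ v, #(edgesAt G v) ≤ m + 1 := by
    intro v
    have h := card_edgesAt_add_card_edgesAt_sdiff hGP v
    rw [card_edgesAt_powersetCard (mem_univ v), card_univ, hα] at h
    lia
  have hdz : #(edgesAt G z) = m + 1 := by
    refine le_antisymm (hdle z) ?_
    rw [← hR, ← card_starEdges (notMem_erase z univ)]
    refine card_le_card fun e he => ?_
    obtain ⟨j, hj, rfl⟩ := mem_starEdges.1 he
    exact mem_edgesAt.2 ⟨hz j (mem_erase.1 hj).1, by simp⟩
  obtain ⟨q, hq⟩ : ∃ q, #{v | #(edgesAt G v) = m + 1} = q := ⟨_, rfl⟩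
  have hq0 : 1 ≤ q := hq ▸ card_pos.2 ⟨z, by simp [hdz]⟩
  have hD := sum_choose_two_card_edgesAt_lt h2 hα (by lia) hG hq hq0
  have hlt := sum_sum_choose_lt (g := starCount α s) (by lia : 4 ≤ m) hdle hq
    (fun k hk => by
      have := starCount_succ_mul_le (α := α) (s := s) (by lia) (by lia : k + 2 ≤ Fintype.card α)
      rwa [hα, show m + 2 - k - 1 = m + 1 - k by lia] at this)
    (starCount_two_pos (by lia) hs hs') hD
  have htri : #(triangles G) ≤ #(triangles (powersetCard 2 ((univ : Finset α).erase z))) := by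
    have h1 := three_mul_card_triangles_le G
    have h2 := choose_three_le_card_triangles ((univ : Finset α).erase z)
    rw [hR] at h2
    have h3 : ∑ v, (#(edgesAt G v)).choose 2 ≤ (m + 1) * m.choose 2 := by
      have hm' : (19 : ℚ) ≤ m := by exact_mod_cast (by lia : 19 ≤ m)
      have h4 : (0 : ℚ) ≤ 7 * q * (m + 1) * m := by positivity
      have h5 : (0 : ℚ) < (m + 1) * m.choose 2 - ∑ v, ((#(edgesAt G v)).choose 2 : ℚ) := by
        by_contra! h
        have := mul_nonpos_of_nonpos_of_nonneg h (by linarith : (0 : ℚ) ≤ 4 * m - 5)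
        linarith
      have h6 : ∑ v, ((#(edgesAt G v)).choose 2 : ℚ) ≤ (m + 1) * m.choose 2 := by linarith
      exact_mod_cast h6
    have h4 := Nat.add_one_mul_choose_eq m 2
    lia
  have hKsum : ∑ v, ∑ k ∈ range (m + 3),
      (#(edgesAt (powersetCard 2 ((univ : Finset α).erase z)) v)).choose k *
        (if k < 2 then 0 else starCount α s k) =
      (m + 1) * ∑ k ∈ range (m + 3), m.choose k * (if k < 2 then 0 else starCount α s k) := by
    rw [← add_sum_erase _ _ (mem_univ z), hKz, sum_eq_zero, zero_add, ← hR, ← smul_eq_mul,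
      ← sum_const]
    · exact sum_congr rfl fun v hv => by rw [hKdeg v (mem_erase.1 hv).1]
    · intro k _
      rcases Nat.eq_zero_or_pos k with rfl | hk
      · simp
      · rw [Nat.choose_eq_zero_of_lt hk, zero_mul]
  rw [sum_card_withEdges_eq h2, sum_card_withEdges_eq hK2, card_powersetCard, hR, hG, hα]
  have hmul := Nat.mul_le_mul_right (triangleCount α s) htri
  rw [← hKsum] at hlt
  lia

end Clique

section Conclusion
variable {α : Type*} [Fintype α] [DecidableEq α] {s : ℕ}

theorem IsMaxFam.sum_card_withEdges_le {A G G' : Finset (Finset α)} (hA : IsMaxFam s A)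
    (hAG : A = bigSets α ∪ G) (hG : ∀ e ∈ G, #e = 2) (hG' : ∀ e ∈ G', #e = 2) (hc : #G' = #G) :
    ∑ E ∈ G'.powerset, #(withEdges s E) ≤ ∑ E ∈ G.powerset, #(withEdges s E) := by
  have hdisj : ∀ {G : Finset (Finset α)}, (∀ e ∈ G, #e = 2) → Disjoint (bigSets α) G := by
    intro G hG
    rw [disjoint_left]
    intro e he heG
    have h1 := (mem_filter.1 he).2
    have h2 := hG e heG
    lia
  rw [← card_meetFams_bigSets_union hG, ← card_meetFams_bigSets_union hG', ← hAG]
  apply hA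
  rw [hAG, card_union_of_disjoint (hdisj hG), card_union_of_disjoint (hdisj hG'), hc]

theorem not_isStablePair (hn : 21 ≤ Fintype.card α) (hs : 2 ≤ s)
    (hs' : s ≤ 2 ^ (Fintype.card α - 1)) {A A' : Finset (Finset α)}
    (hA : #A = #(bigSets α) + (Fintype.card α - 1))
    (hA' : #A' = #(bigSets α) + (Fintype.card α - 1).choose 2) : ¬ IsStablePair s A A' := by
  intro h
  have hm' := h.missing_right_eq_empty hn hA'
  have hm := h.missing_left_eq_empty (by lia) hn hA hm'
  have hle : Fintype.card α - 1 ≤ (Fintype.card α - 1).choose 2 := le_choose_two (by lia)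
  have h2 : ∀ X ∈ A, 2 ≤ #X := fun X hX =>
    card_le_one_notMem h.isClosedFam.1 (by lia) (by lia) hX
  have h2' : ∀ X ∈ A', 2 ≤ #X := fun X hX =>
    card_le_one_notMem h.isClosedFam.2 (by lia) (by lia) hX
  have hAE : A = bigSets α ∪ edgesOf A := by
    have := eq_bigSets_sdiff_union_edgesOf h2
    rwa [hm, sdiff_empty] at this
  have hAE' : A' = bigSets α ∪ edgesOf A' := by
    have := eq_bigSets_sdiff_union_edgesOf h2'
    rwa [hm', sdiff_empty] at this
  have hc : #(edgesOf A) = Fintype.card α - 1 := by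
    have := card_add_card_missing h2
    rw [hm, card_empty] at this
    lia
  have hc' : #(edgesOf A') = (Fintype.card α - 1).choose 2 := by
    have := card_add_card_missing h2'
    rw [hm', card_empty] at this
    lia
  have he : ∀ e ∈ edgesOf A, #e = 2 := fun e he => (mem_filter.1 he).2
  have he' : ∀ e ∈ edgesOf A', #e = 2 := fun e he => (mem_filter.1 he).2
  have : Nonempty α := Fintype.card_pos_iff.1 (by lia)
  have hmeets : Meets (edgesOf A) := by
    by_contra hnm
    obtain ⟨z⟩ := this
    have hzc : #((univ : Finset α).erase z) = Fintype.card α - 1 := by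
      rw [card_erase_of_mem (mem_univ z), card_univ]
    have hz := notMem_erase z (univ : Finset α)
    have hlt := sum_card_withEdges_lt_star (by lia) hs hs' he hnm hz (hc.trans hzc.symm)
    have hle := h.max.sum_card_withEdges_le hAE he (fun e he => card_of_mem_starEdges hz he)
      (by rw [card_starEdges hz, hzc, hc])
    exact absurd hle (not_le.2 hlt)
  obtain ⟨z, hz⟩ : ∃ z, ∀ e ∈ edgesOf A, z ∈ e := by
    rcases exists_center_or_eq_triangle he hmeets with h | ⟨T, hT, hE⟩
    · exact h
    · rw [hE, card_powersetCard, hT, show Nat.choose 3 2 = 3 from rfl] at hc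
      lia
  have hstar := eq_starEdges_univ_erase he hz hc
  have hdom : ∀ j ≠ z, {z, j} ∈ edgesOf A' := by
    intro j hj
    have : {z, j} ∈ edgesOf A := hstar ▸ mem_starEdges.2 ⟨j, by simp [hj], rfl⟩
    exact filter_subset_filter _ h.subset this
  have hlt := sum_card_withEdges_lt_clique hn hs hs' he' hc' hdom
  have hle := h.max'.sum_card_withEdges_le hAE' he'
    (G' := powersetCard 2 (univ.erase z)) (fun e he => (mem_powersetCard.1 he).2)
    (by rw [card_powersetCard, card_erase_of_mem (mem_univ z), card_univ, hc'])
  exact absurd hle (not_le.2 hlt)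

/-- Maximising families of the two sizes are never nested. -/
theorem IsMaxFam.not_subset (hn : 21 ≤ Fintype.card α) (hs : 2 ≤ s)
    (hs' : s ≤ 2 ^ (Fintype.card α - 1)) {A A' : Finset (Finset α)}
    (hA : #A = #(bigSets α) + (Fintype.card α - 1))
    (hA' : #A' = #(bigSets α) + (Fintype.card α - 1).choose 2)
    (hmax : IsMaxFam s A) (hmax' : IsMaxFam s A') : ¬ A ⊆ A' := by
  intro h
  obtain ⟨B, B', hB, hB', hBB'⟩ := exists_isStablePair h hmax hmax'
  exact not_isStablePair hn hs hs' (hB.trans hA) (hB'.trans hA') hBB'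

end Conclusion

section Transfer
variable {α : Type*} {s : ℕ}

theorem mem_interFams {A F : Finset (Finset ℕ)} :
    F ∈ interFams s A ↔ F ⊆ A ∧ #F = s ∧ Meets F := by
  simp [interFams, Meets, mem_powersetCard, and_assoc]

/-- The image of a family under an embedding of the ground set. -/
def mapFam {β : Type*} (φ : α ↪ β) : Finset (Finset α) ↪ Finset (Finset β) :=
  (mapEmbedding (mapEmbedding φ).toEmbedding).toEmbedding

theorem mem_mapFam {β : Type*} {φ : α ↪ β} {F : Finset (Finset α)} {Y : Finset β} :
    Y ∈ mapFam φ F ↔ ∃ X ∈ F, X.map φ = Y := by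
  simp [mapFam]

theorem card_mapFam {β : Type*} (φ : α ↪ β) (F : Finset (Finset α)) : #(mapFam φ F) = #F :=
  card_map _

theorem meets_mapFam {β : Type*} [DecidableEq α] [DecidableEq β] {φ : α ↪ β}
    {F : Finset (Finset α)} : Meets (mapFam φ F) ↔ Meets F := by
  constructor
  · intro h X hX Y hY
    have := h _ (mem_mapFam.2 ⟨X, hX, rfl⟩) _ (mem_mapFam.2 ⟨Y, hY, rfl⟩)
    rwa [← map_inter, map_nonempty] at this
  · intro h Y hY Y' hY'
    obtain ⟨X, hX, rfl⟩ := mem_mapFam.1 hY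
    obtain ⟨X', hX', rfl⟩ := mem_mapFam.1 hY'
    rw [← map_inter, map_nonempty]
    exact h X hX X' hX'

theorem card_interFams_mapFam [DecidableEq α] (φ : α ↪ ℕ) (A : Finset (Finset α)) :
    #(interFams s (mapFam φ A)) = #(meetFams s A) := by
  rw [← card_map (mapFam φ)]
  congr 1
  ext F
  rw [mem_interFams, mem_map]
  constructor
  · rintro ⟨h1, h2, h3⟩
    obtain ⟨F, hF, rfl⟩ := subset_map_iff.1 h1
    change Meets (mapFam φ F) at h3
    exact ⟨F, mem_meetFams.2 ⟨hF, by rwa [card_map] at h2, meets_mapFam.1 h3⟩, rfl⟩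
  · rintro ⟨F, hF, rfl⟩
    obtain ⟨h1, h2, h3⟩ := mem_meetFams.1 hF
    exact ⟨map_subset_map.2 h1, by rw [card_mapFam, h2], meets_mapFam.2 h3⟩

theorem mapFam_subtype_subset (n : ℕ) (A : Finset (Finset (groundSet n))) :
    mapFam (.subtype (· ∈ groundSet n)) A ⊆ allFams n := by
  intro Y hY
  obtain ⟨X, -, rfl⟩ := mem_mapFam.1 hY
  exact mem_powerset.2 (by intro y hy; obtain ⟨x, -, rfl⟩ := mem_map.1 hy; exact x.2)

theorem exists_mapFam_subtype_eq {n : ℕ} {A : Finset (Finset ℕ)} (hA : A ⊆ allFams n) :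
    ∃ B : Finset (Finset (groundSet n)), mapFam (.subtype (· ∈ groundSet n)) B = A := by
  refine ⟨A.image fun X => X.subtype (· ∈ groundSet n), ?_⟩
  have key : ∀ X ∈ A, (X.subtype (· ∈ groundSet n)).map (.subtype (· ∈ groundSet n)) = X :=
    fun X hX => subtype_map_of_mem fun x hx => mem_powerset.1 (hA hX) hx
  ext Y
  simp only [mem_mapFam, mem_image]
  constructor
  · rintro ⟨_, ⟨X, hX, rfl⟩, rfl⟩
    rwa [key X hX]
  · exact fun hY => ⟨_, ⟨Y, hY, rfl⟩, key Y hY⟩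

theorem isMaxFam_of_mapFam {n N : ℕ} {A : Finset (Finset ℕ)} {B : Finset (Finset (groundSet n))}
    (hcard : #A = N)
    (hmax : ∀ A' ⊆ allFams n, #A' = N → #(interFams s A') ≤ #(interFams s A))
    (hB : mapFam (.subtype (· ∈ groundSet n)) B = A) : IsMaxFam s B := by
  intro B' hB'
  have := hmax _ (mapFam_subtype_subset n B') (by rw [card_mapFam, hB', ← hcard, ← hB, card_mapFam])
  rwa [← hB, card_interFams_mapFam, card_interFams_mapFam] at this

theorem card_groundSet (n : ℕ) : #(groundSet n) = n := by simp [groundSet]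

theorem card_bigSets_groundSet {n : ℕ} (hn : 3 ≤ n) :
    #(bigSets (groundSet n)) = ∑ k ∈ Icc 3 n, n.choose k := by
  have h := card_bigSets_add (α := groundSet n)
  rw [Fintype.card_coe, card_groundSet, ← Nat.sum_range_choose, range_eq_Ico,
    ← sum_Ico_consecutive _ (by lia : 0 ≤ 3) (by lia : 3 ≤ n + 1)] at h
  have h3 : ∑ k ∈ Ico 0 3, n.choose k = 1 + n + n.choose 2 := by
    simp [sum_range_succ]
  rw [h3] at h
  have h4 : Icc 3 n = Ico 3 (n + 1) := by ext; simp
  rw [h4]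
  lia

theorem not_subset_of_maximal {n s : ℕ} (hn : 21 ≤ n) (hs : 2 ≤ s) (hs' : s ≤ 2 ^ (n - 1))
    {N₁ N₂ : ℕ} (hN₁ : N₁ = (∑ k ∈ Icc 3 n, n.choose k) + (n - 1))
    (hN₂ : N₂ = (∑ k ∈ Icc 3 n, n.choose k) + (n - 1).choose 2) {A₁ A₂ : Finset (Finset ℕ)}
    (hA₁ : A₁ ⊆ allFams n) (hcard₁ : #A₁ = N₁)
    (hmax₁ : ∀ A' ⊆ allFams n, #A' = N₁ → #(interFams s A') ≤ #(interFams s A₁))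
    (hA₂ : A₂ ⊆ allFams n) (hcard₂ : #A₂ = N₂)
    (hmax₂ : ∀ A' ⊆ allFams n, #A' = N₂ → #(interFams s A') ≤ #(interFams s A₂)) :
    ¬ A₁ ⊆ A₂ := by
  obtain ⟨B₁, hB₁⟩ := exists_mapFam_subtype_eq hA₁
  obtain ⟨B₂, hB₂⟩ := exists_mapFam_subtype_eq hA₂
  have h1 := isMaxFam_of_mapFam hcard₁ hmax₁ hB₁
  have h2 := isMaxFam_of_mapFam hcard₂ hmax₂ hB₂
  have hα : Fintype.card (groundSet n) = n := by rw [Fintype.card_coe, card_groundSet]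
  have hbig := card_bigSets_groundSet (by lia : 3 ≤ n)
  intro h
  rw [← hB₁, ← hB₂] at h
  refine h1.not_subset (by rwa [hα]) hs (by rwa [hα]) ?_ ?_ h2 (map_subset_map.1 h)
  · rw [hα, hbig, ← hN₁, ← hcard₁, ← hB₁, card_mapFam]
  · rw [hα, hbig, ← hN₂, ← hcard₂, ← hB₂, card_mapFam]

theorem image_image_eq_mapFam (σ : Equiv.Perm ℕ) (A : Finset (Finset ℕ)) :
    (A.image fun X => X.image σ) = mapFam σ.toEmbedding A := by
  ext Y
  simp [mem_mapFam, map_eq_image]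

theorem card_interFams_le_mapFam (σ : Equiv.Perm ℕ) (A : Finset (Finset ℕ)) :
    #(interFams s A) ≤ #(interFams s (mapFam σ.toEmbedding A)) := by
  refine card_le_card_of_injOn (mapFam σ.toEmbedding) ?_ (mapFam σ.toEmbedding).injective.injOn
  intro F hF
  obtain ⟨h1, h2, h3⟩ := mem_interFams.1 (mem_coe.1 hF)
  exact mem_interFams.2 ⟨map_subset_map.2 h1, by rw [card_mapFam, h2], meets_mapFam.2 h3⟩

end Transfer

theorem stmt3 (n s : ℕ) (hn : 21 ≤ n) (hs1 : 2 ≤ s) (hs2 : s ≤ 2 ^ (n - 1))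
    (N₁ N₂ : ℕ) (hN₁ : N₁ = (∑ k ∈ Finset.Icc 3 n, n.choose k) + (n - 1))
    (hN₂ : N₂ = (∑ k ∈ Finset.Icc 3 n, n.choose k) + (n - 1).choose 2)
    (𝓐₁ 𝓐₂ : Finset (Finset ℕ))
    (h𝓐₁ : 𝓐₁ ⊆ allFams n) (hcard₁ : 𝓐₁.card = N₁)
    (hmax₁ : ∀ 𝓐' ⊆ allFams n, 𝓐'.card = N₁ →
        (interFams s 𝓐').card ≤ (interFams s 𝓐₁).card)
    (h𝓐₂ : 𝓐₂ ⊆ allFams n) (hcard₂ : 𝓐₂.card = N₂)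
    (hmax₂ : ∀ 𝓐' ⊆ allFams n, 𝓐'.card = N₂ →
        (interFams s 𝓐').card ≤ (interFams s 𝓐₂).card) :
    (¬∃ σ : Equiv.Perm ℕ, (∀ x ∈ groundSet n, σ x ∈ groundSet n) ∧
        𝓐₁.image (fun A => A.image σ) ⊆ 𝓐₂) ∧ ¬𝓐₁ ⊆ 𝓐₂ := by
  refine ⟨?_, not_subset_of_maximal hn hs1 hs2 hN₁ hN₂ h𝓐₁ hcard₁ hmax₁ h𝓐₂ hcard₂ hmax₂⟩
  rintro ⟨σ, hσ, hsub⟩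
  rw [image_image_eq_mapFam] at hsub
  refine not_subset_of_maximal hn hs1 hs2 hN₁ hN₂ (fun Y hY => ?_) ((card_mapFam _ _).trans hcard₁)
    (fun 𝓐' h h' => (hmax₁ 𝓐' h h').trans (card_interFams_le_mapFam σ 𝓐₁)) h𝓐₂ hcard₂ hmax₂ hsub
  obtain ⟨X, hX, rfl⟩ := mem_mapFam.1 hY
  refine mem_powerset.2 fun y hy => ?_
  obtain ⟨x, hx, rfl⟩ := mem_map.1 hy
  exact hσ x (mem_powerset.1 (h𝓐₁ hX) hx)
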